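/- Let m : ℝ³ × ℝ³ → ℂ be a symbol in the class 𝓑₀, i.e.: (1) m(λξ, λη) = m(ξ, η) for all λ > 0 and all (ξ,η); (2) m is smooth on the complement of {ξ = 0} ∪ {η = 0} ∪ {ξ = η}; (3) for each labeling (ξ₁, ξ₂, ξ₃) of the three frequencies (ξ, η, ξ − η), there exist δ > 0 and a smooth function 𝓐 : ℝ × ℝ³ × ℝ³ → ℂ such that m(ξ, η) = 𝓐(‖ξ₁‖, ξ₁/‖ξ₁‖, ξ₂) whenever 0 < ‖ξ₁‖ ≤ δ and 1/2 ≤ ‖ξ₂‖ ≤ 2. Then for all exponents 1 < p, q, r < ∞ with 1/r = 1/p + 1/q there exists a constant C > 0 such that for all Schwartz functions f, g : ℝ³ → ℂ, ‖T_m(f, g)‖_{L^r(ℝ³)} ≤ C ‖f‖_{L^p(ℝ³)} ‖g‖_{L^q(ℝ³)}. -/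

import Mathlib

open MeasureTheory
open scoped InnerProductSpace FourierTransform ENNReal

/-- The bilinear pseudo-product operator with symbol m:
T_m(f,g)(x) = ∫ e^{2πi⟨x,ξ⟩} ∫ m(ξ,η) f̂(η) ĝ(ξ−η) dη dξ. -/
noncomputable def pseudoProduct (m : EuclideanSpace ℝ (Fin 3) → EuclideanSpace ℝ (Fin 3) → ℂ)
    (f g : EuclideanSpace ℝ (Fin 3) → ℂ) (x : EuclideanSpace ℝ (Fin 3)) : ℂ :=
  ∫ ξ : EuclideanSpace ℝ (Fin 3),
    Complex.exp (2 * Real.pi * Complex.I * ((⟪x, ξ⟫_ℝ : ℝ) : ℂ)) *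
      ∫ η : EuclideanSpace ℝ (Fin 3), m ξ η * 𝓕 f η * 𝓕 g (ξ - η)

namespace PseudoProduct

open Set Filter Topology Metric Module

section MaximalFunction

variable {V : Type*} [NormedAddCommGroup V] [InnerProductSpace ℝ V] [FiniteDimensional ℝ V]
  [MeasurableSpace V] [BorelSpace V]

/-- The centered dyadic Hardy–Littlewood maximal function. -/
noncomputable def maximalFn (f : V → ℝ≥0∞) (x : V) : ℝ≥0∞ :=
  ⨆ n : ℤ, (∫⁻ y in closedBall x ((2 : ℝ) ^ n), f y) / volume (closedBall x ((2 : ℝ) ^ n))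

lemma volume_closedBall_mul (x y : V) {r s : ℝ} (hr : 0 ≤ r) (hs : 0 ≤ s) :
    volume (closedBall x (r * s)) =
      ENNReal.ofReal (r ^ finrank ℝ V) * volume (closedBall y s) := by
  rw [Measure.addHaar_closedBall_mul volume x hr hs, Measure.addHaar_closedBall_center volume y]

lemma volume_closedBall_pos (x : V) {r : ℝ} (hr : 0 < r) : volume (closedBall x r) ≠ 0 :=
  (measure_closedBall_pos volume x hr).ne'

lemma volume_closedBall_lt_top (x : V) (r : ℝ) : volume (closedBall x r) ≠ ∞ :=
  measure_closedBall_lt_top.ne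

lemma setLIntegral_div_le_maximalFn (f : V → ℝ≥0∞) (x : V) (n : ℤ) :
    (∫⁻ y in closedBall x ((2 : ℝ) ^ n), f y) / volume (closedBall x ((2 : ℝ) ^ n)) ≤ maximalFn f x :=
  le_iSup (fun n : ℤ => (∫⁻ y in closedBall x ((2 : ℝ) ^ n), f y) / volume (closedBall x ((2 : ℝ) ^ n))) n

lemma setLIntegral_closedBall_le_maximalFn (f : V → ℝ≥0∞) (x : V) (n : ℤ) :
    ∫⁻ y in closedBall x ((2 : ℝ) ^ n), f y ≤
      maximalFn f x * volume (closedBall x ((2 : ℝ) ^ n)) := by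
  rw [← ENNReal.div_le_iff (volume_closedBall_pos x (by positivity)) (volume_closedBall_lt_top _ _)]
  exact setLIntegral_div_le_maximalFn f x n

lemma measurable_setLIntegral_closedBall {f : V → ℝ≥0∞} (hf : Measurable f) (r : ℝ) :
    Measurable fun x => ∫⁻ y in closedBall x r, f y := by
  have h : (fun x => ∫⁻ y in closedBall x r, f y) =
      fun x => ∫⁻ y, {p : V × V | dist p.2 p.1 ≤ r}.indicator (fun p => f p.2) (x, y) := by
    funext x
    rw [← lintegral_indicator measurableSet_closedBall]
    rfl
  rw [h]
  refine Measurable.lintegral_prod_right' (f := {p : V × V | dist p.2 p.1 ≤ r}.indicator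
    (fun p => f p.2)) ?_
  exact (hf.comp measurable_snd).indicator
    (measurableSet_le (measurable_snd.dist measurable_fst) measurable_const)

lemma measurable_maximalFn {f : V → ℝ≥0∞} (hf : Measurable f) : Measurable (maximalFn f) := by
  refine Measurable.iSup fun n => ?_
  have : ∀ x : V, volume (closedBall x ((2 : ℝ) ^ n)) = volume (closedBall (0 : V) ((2 : ℝ) ^ n)) :=
    fun x => Measure.addHaar_closedBall_center volume x _
  simp only [this]
  exact (measurable_setLIntegral_closedBall hf _).div_const _

lemma maximalFn_mono {f g : V → ℝ≥0∞} (h : f ≤ g) : maximalFn f ≤ maximalFn g := by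
  intro x
  refine iSup_mono fun n => ?_
  gcongr
  exact h _

lemma ae_le_maximalFn {f : V → ℝ≥0∞} (hf : Measurable f) (h'f : ∫⁻ y, f y ≠ ∞) :
    ∀ᵐ x, f x ≤ maximalFn f x := by
  filter_upwards [(IsUnifLocDoublingMeasure.vitaliFamily (volume : Measure V) 1).ae_tendsto_lintegral_div'
    hf h'f] with x hx
  have hlim : Tendsto (fun n : ℕ => ((2 : ℝ) ^ (-(n : ℤ)))) atTop (𝓝[>] 0) := by
    refine tendsto_nhdsWithin_iff.2 ⟨?_, Eventually.of_forall fun n => by simp⟩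
    have : (fun n : ℕ => ((2 : ℝ) ^ (-(n : ℤ)))) = fun n : ℕ => ((2 : ℝ)⁻¹) ^ n := by
      funext n; simp
    rw [this]
    exact tendsto_pow_atTop_nhds_zero_of_lt_one (by norm_num) (by norm_num)
  have := hx.comp (IsUnifLocDoublingMeasure.tendsto_closedBall_filterAt (K := 1) volume (x := x)
    (fun _ => x) _ hlim (Eventually.of_forall fun n => mem_closedBall_self (by positivity)))
  refine le_of_tendsto this (Eventually.of_forall fun n => ?_)
  simp only [Function.comp]
  exact setLIntegral_div_le_maximalFn f x _

/-- Selection of maximal balls on which the average of `f` exceeds the height `t`. -/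
lemma exists_selected_balls [Nontrivial V] {f : V → ℝ≥0∞} (h'f : ∫⁻ y, f y ≠ ∞)
    {t : ℝ≥0∞} (ht : t ≠ 0) (ht' : t ≠ ∞) :
    ∃ (u : Set V) (n : V → ℤ), u.Countable ∧
      u.PairwiseDisjoint (fun x => closedBall x ((2 : ℝ) ^ n x)) ∧
      (∀ x ∈ u, t < (∫⁻ y in closedBall x ((2 : ℝ) ^ n x), f y) / volume (closedBall x ((2 : ℝ) ^ n x))) ∧
      (∀ x ∈ u, ∀ m, n x < m → (∫⁻ y in closedBall x ((2 : ℝ) ^ m), f y) / volume (closedBall x ((2 : ℝ) ^ m)) ≤ t) ∧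
      {x | t < maximalFn f x} ⊆ ⋃ x ∈ u, closedBall x (5 * (2 : ℝ) ^ n x) := by
  set I := ∫⁻ y, f y
  set c := volume (closedBall (0 : V) 1)
  have hc : c ≠ 0 := volume_closedBall_pos _ one_pos
  have hc' : c ≠ ∞ := volume_closedBall_lt_top _ _
  have hbound : ∃ R : ℝ, 1 ≤ R ∧ ∀ (x : V) (n : ℤ),
      t < (∫⁻ y in closedBall x ((2 : ℝ) ^ n), f y) / volume (closedBall x ((2 : ℝ) ^ n)) → (2 : ℝ) ^ n ≤ R := by
    have hI : I / (t * c) ≠ ∞ := ENNReal.div_ne_top h'f (mul_ne_zero ht hc)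
    refine ⟨max 1 (I / (t * c)).toReal, le_max_left _ _, fun x n h => ?_⟩
    by_contra! hlt
    have h1 : (1 : ℝ) < 2 ^ n := (le_max_left _ _).trans_lt hlt
    have h2 : (I / (t * c)).toReal < 2 ^ n := (le_max_right _ _).trans_lt hlt
    have hv : ENNReal.ofReal (2 ^ n) * c ≤ volume (closedBall x ((2 : ℝ) ^ n)) := by
      have := volume_closedBall_mul x (0 : V) (r := 2 ^ n) (s := 1) (by positivity) one_pos.le
      rw [mul_one] at this
      rw [this]
      gcongr
      exact le_self_pow₀ h1.le finrank_pos.ne'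
    have h3 : t * volume (closedBall x ((2 : ℝ) ^ n)) < I :=
      ((ENNReal.lt_div_iff_mul_lt (Or.inl (volume_closedBall_pos x (by positivity)))
        (Or.inl (volume_closedBall_lt_top _ _))).1 h).trans_le (setLIntegral_le_lintegral _ _)
    have h4 : I / (t * c) < ENNReal.ofReal (2 ^ n) :=
      (ENNReal.lt_ofReal_iff_toReal_lt hI).2 h2
    rw [ENNReal.div_lt_iff (Or.inl (mul_ne_zero ht hc)) (Or.inl (ENNReal.mul_ne_top ht' hc'))] at h4
    have h5 : ENNReal.ofReal (2 ^ n) * (t * c) ≤ t * volume (closedBall x ((2 : ℝ) ^ n)) := by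
      calc _ = t * (ENNReal.ofReal (2 ^ n) * c) := by ring
        _ ≤ _ := by gcongr
    exact absurd (h4.trans_le h5) (not_lt.2 h3.le)
  obtain ⟨R, -, hR⟩ := hbound
  have hmax : ∀ x : V, t < maximalFn f x → ∃ n : ℤ,
      t < (∫⁻ y in closedBall x ((2 : ℝ) ^ n), f y) / volume (closedBall x ((2 : ℝ) ^ n)) ∧
      ∀ m : ℤ, t < (∫⁻ y in closedBall x ((2 : ℝ) ^ m), f y) / volume (closedBall x ((2 : ℝ) ^ m)) → m ≤ n := by
    intro x hx
    refine Int.exists_greatest_of_bdd ⟨⌈R⌉, fun m hm => ?_⟩ (lt_iSup_iff.1 hx)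
    have h1 := hR x m hm
    have h2 : (m : ℝ) ≤ 2 ^ m := by
      rcases le_total m 0 with h | h
      · exact (Int.cast_nonpos.2 h).trans (by positivity)
      · lift m to ℕ using h
        simpa using (Nat.cast_le (α := ℝ)).2 (Nat.lt_two_pow_self (n := m)).le
    exact_mod_cast (h2.trans h1).trans (Int.le_ceil R)
  choose! n hn hn' using hmax
  obtain ⟨u, hu, hdisj, hcov⟩ := Vitali.exists_disjoint_subfamily_covering_enlargement_closedBall
    {x | t < maximalFn f x} id (fun x => (2 : ℝ) ^ n x) R (fun x hx => hR x _ (hn x hx)) 5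
    (by norm_num)
  refine ⟨u, n, ?_, hdisj, fun x hx => hn x (hu hx), fun x hx m hm => ?_, fun x hx => ?_⟩
  · refine hdisj.countable_of_nonempty_interior fun x _ => ?_
    exact ⟨x, mem_interior_iff_mem_nhds.2 (closedBall_mem_nhds _ (by positivity))⟩
  · by_contra! h
    exact absurd (hn' x (hu hx) m h) (not_le.2 hm)
  · obtain ⟨b, hb, hsub⟩ := hcov x hx
    exact mem_iUnion₂.2 ⟨b, hb, hsub (mem_closedBall_self (by positivity))⟩

lemma maximalFn_weak [Nontrivial V] (f : V → ℝ≥0∞)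
    {t : ℝ≥0∞} (ht : t ≠ 0) (ht' : t ≠ ∞) :
    volume {x | t < maximalFn f x} ≤
      ENNReal.ofReal (5 ^ finrank ℝ V) / t * ∫⁻ y, f y := by
  by_cases h'f : ∫⁻ y, f y = ∞
  · rw [h'f, ENNReal.mul_top (ENNReal.div_ne_zero.2 ⟨by simp, ht'⟩)]
    exact le_top
  obtain ⟨u, n, hu, hdisj, hgt, -, hcov⟩ := exists_selected_balls h'f ht ht'
  have hball : ∀ x ∈ u, volume (closedBall x (5 * (2 : ℝ) ^ n x)) ≤
      ENNReal.ofReal (5 ^ finrank ℝ V) / t * ∫⁻ y in closedBall x ((2 : ℝ) ^ n x), f y := by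
    intro x hx
    rw [volume_closedBall_mul x x (by norm_num) (by positivity), div_eq_mul_inv, mul_assoc]
    gcongr
    have := hgt x hx
    rw [ENNReal.lt_div_iff_mul_lt
      (Or.inl (volume_closedBall_pos x (by positivity)))
        (Or.inl (volume_closedBall_lt_top _ _))] at this
    rw [mul_comm, ← div_eq_mul_inv, ENNReal.le_div_iff_mul_le (Or.inl ht) (Or.inl ht'), mul_comm]
    exact this.le
  calc volume {x | t < maximalFn f x}
      ≤ volume (⋃ x ∈ u, closedBall x (5 * (2 : ℝ) ^ n x)) := measure_mono hcov
    _ ≤ ∑' x : u, volume (closedBall (x : V) (5 * (2 : ℝ) ^ n x)) := measure_biUnion_le _ hu _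
    _ ≤ ∑' x : u, ENNReal.ofReal (5 ^ finrank ℝ V) / t *
          ∫⁻ y in closedBall (x : V) ((2 : ℝ) ^ n x), f y :=
        ENNReal.tsum_le_tsum fun x => hball x x.2
    _ = ENNReal.ofReal (5 ^ finrank ℝ V) / t *
          ∫⁻ y in ⋃ x ∈ u, closedBall (x : V) ((2 : ℝ) ^ n x), f y := by
        rw [ENNReal.tsum_mul_left, lintegral_biUnion hu
          (fun x _ => measurableSet_closedBall) hdisj]
    _ ≤ _ := by
        gcongr
        exact Measure.restrict_le_self

end MaximalFunction

section LayerCake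

lemma lintegral_Ioi_indicator_rpow {p : ℝ} (hp : 0 < p) (a : ℝ≥0∞) :
    ∫⁻ t in Ioi (0 : ℝ), {t : ℝ | ENNReal.ofReal t < a}.indicator
      (fun t => ENNReal.ofReal (p * t ^ (p - 1))) t = a ^ p := by
  have hmeas : ∀ a : ℝ≥0∞, MeasurableSet {t : ℝ | ENNReal.ofReal t < a} := fun a =>
    measurableSet_lt ENNReal.measurable_ofReal measurable_const
  have hfin : ∀ a : ℝ≥0∞, a ≠ ∞ → ∫⁻ t in Ioi (0 : ℝ), {t : ℝ | ENNReal.ofReal t < a}.indicator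
      (fun t => ENNReal.ofReal (p * t ^ (p - 1))) t = a ^ p := by
    intro a ha
    lift a to NNReal using ha
    rw [lintegral_indicator (hmeas _), Measure.restrict_restrict (hmeas _)]
    have hset : {t : ℝ | ENNReal.ofReal t < a} ∩ Ioi 0 = Ioo 0 (a : ℝ) := by
      ext t
      simp only [mem_inter_iff, mem_ofPred_eq, mem_Ioi, mem_Ioo]
      constructor
      · rintro ⟨h1, h2⟩
        exact ⟨h2, by simpa using (ENNReal.ofReal_lt_iff_lt_toReal h2.le (by simp)).1 h1⟩
      · rintro ⟨h1, h2⟩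
        exact ⟨(ENNReal.ofReal_lt_iff_lt_toReal h1.le (by simp)).2 (by simpa using h2), h1⟩
    have hint : IntervalIntegrable (fun t : ℝ => p * t ^ (p - 1)) volume 0 (a : ℝ) :=
      (intervalIntegral.intervalIntegrable_rpow' (by linarith)).const_mul p
    have hint' : IntegrableOn (fun t : ℝ => p * t ^ (p - 1)) (Ioc 0 (a : ℝ)) volume :=
      (intervalIntegrable_iff_integrableOn_Ioc_of_le a.coe_nonneg).1 hint
    rw [hset, restrict_Ioo_eq_restrict_Ioc, ← ofReal_integral_eq_lintegral_ofReal hint']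
    · rw [← intervalIntegral.integral_of_le a.coe_nonneg, intervalIntegral.integral_const_mul,
        integral_rpow (Or.inl (by linarith)), sub_add_cancel, Real.zero_rpow hp.ne', sub_zero,
        mul_div_cancel₀ _ hp.ne', ← ENNReal.ofReal_rpow_of_nonneg a.coe_nonneg hp.le]
      simp
    · filter_upwards [ae_restrict_mem measurableSet_Ioc] with t ht
      have := ht.1
      positivity
  by_cases ha : a = ∞
  · rw [ha, ENNReal.top_rpow_of_pos hp, eq_top_iff]
    refine ENNReal.le_of_forall_nnreal_lt fun r _ => ?_
    have h1 := hfin ((r : ℝ≥0∞) ^ p⁻¹) (by simp [hp.le])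
    rw [ENNReal.rpow_inv_rpow hp.ne'] at h1
    rw [← h1]
    refine lintegral_mono fun t => indicator_le_indicator_of_subset ?_ (fun _ => zero_le) t
    intro t ht
    simp
  · exact hfin a ha

lemma lintegral_rpow_eq_layercake {α : Type*} [MeasurableSpace α] (μ : Measure α) [SFinite μ]
    {F : α → ℝ≥0∞} (hF : Measurable F) {p : ℝ} (hp : 0 < p) :
    ∫⁻ x, F x ^ p ∂μ =
      ∫⁻ t in Ioi (0 : ℝ), ENNReal.ofReal (p * t ^ (p - 1)) * μ {x | ENNReal.ofReal t < F x} := by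
  simp_rw [← lintegral_Ioi_indicator_rpow hp]
  rw [lintegral_lintegral_swap]
  · refine lintegral_congr fun t => ?_
    rw [← setLIntegral_const, ← lintegral_indicator (measurableSet_lt measurable_const hF)]
    rfl
  · have hm : MeasurableSet {q : α × ℝ | ENNReal.ofReal q.2 < F q.1} :=
      measurableSet_lt (ENNReal.measurable_ofReal.comp measurable_snd) (hF.comp measurable_fst)
    have : Measurable ({q : α × ℝ | ENNReal.ofReal q.2 < F q.1}.indicator
        (fun q => ENNReal.ofReal (p * q.2 ^ (p - 1)))) :=
      Measurable.indicator (by fun_prop) hm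
    exact this.aemeasurable

lemma lintegral_Ioi_rpow_le {p : ℝ} (hp : p < 2) {m : ℝ≥0∞} (hm : m ≠ 0) :
    ∫⁻ t in Ioi (0 : ℝ), {t : ℝ | m ≤ ENNReal.ofReal t}.indicator
      (fun t => ENNReal.ofReal (t ^ (p - 3))) t ≤ ENNReal.ofReal (1 / (2 - p)) * m ^ (p - 2) := by
  have hmeas : MeasurableSet {t : ℝ | m ≤ ENNReal.ofReal t} :=
    measurableSet_le measurable_const ENNReal.measurable_ofReal
  by_cases hm' : m = ∞
  · simp [hm']
  lift m to NNReal using hm'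
  have hm0 : (0 : ℝ) < m := by
    have : m ≠ 0 := by simpa using hm
    positivity
  rw [lintegral_indicator hmeas, Measure.restrict_restrict hmeas]
  have hset : {t : ℝ | m ≤ ENNReal.ofReal t} ∩ Ioi 0 = Ici (m : ℝ) := by
    ext t
    simp only [mem_inter_iff, mem_ofPred_eq, mem_Ioi, mem_Ici]
    constructor
    · rintro ⟨h1, h2⟩
      simpa using (ENNReal.le_ofReal_iff_toReal_le (by simp) h2.le).1 h1
    · intro h1
      have h2 : 0 < t := hm0.trans_le h1
      exact ⟨(ENNReal.le_ofReal_iff_toReal_le (by simp) h2.le).2 (by simpa using h1), h2⟩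
  rw [hset, ← restrict_Ioi_eq_restrict_Ici, ← ofReal_integral_eq_lintegral_ofReal
    (f := fun t : ℝ => t ^ (p - 3)) (integrableOn_Ioi_rpow_of_lt (by linarith) hm0)]
  · rw [integral_Ioi_rpow_of_lt (by linarith) hm0]
    have h2 : (m : ℝ≥0∞) ^ (p - 2) = ENNReal.ofReal ((m : ℝ) ^ (p - 2)) := by
      rw [← ENNReal.ofReal_rpow_of_pos hm0]; simp
    rw [h2, ← ENNReal.ofReal_mul (by apply one_div_nonneg.2; linarith)]
    refine le_of_eq (congrArg _ ?_)
    rw [show p - 3 + 1 = p - 2 by ring]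
    have : p - 2 ≠ 0 := by linarith
    have : 2 - p ≠ 0 := by linarith
    field_simp
    ring
  · filter_upwards [ae_restrict_mem measurableSet_Ioi] with t ht
    have : 0 < t := hm0.trans ht
    positivity

end LayerCake

section MaximalFunction

variable {V : Type*} [NormedAddCommGroup V] [InnerProductSpace ℝ V] [FiniteDimensional ℝ V]
  [MeasurableSpace V] [BorelSpace V]

lemma maximalFn_le_add_const (f : V → ℝ≥0∞) (s : ℝ≥0∞) (x : V) :
    maximalFn f x ≤ maximalFn ({y | s < f y}.indicator f) x + s := by
  refine iSup_le fun n => ?_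
  have hb := volume_closedBall_pos x (r := (2 : ℝ) ^ n) (by positivity)
  have hb' := volume_closedBall_lt_top x ((2 : ℝ) ^ n)
  rw [ENNReal.div_le_iff hb hb', add_mul]
  calc ∫⁻ y in closedBall x ((2 : ℝ) ^ n), f y
      ≤ ∫⁻ y in closedBall x ((2 : ℝ) ^ n), ({y | s < f y}.indicator f y + s) := by
        refine lintegral_mono fun y => ?_
        by_cases h : s < f y
        · simp [indicator, h]
        · simp [indicator, h, not_lt.1 h]
    _ = (∫⁻ y in closedBall x ((2 : ℝ) ^ n), {y | s < f y}.indicator f y) +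
          s * volume (closedBall x ((2 : ℝ) ^ n)) := by
        rw [lintegral_add_right _ measurable_const, setLIntegral_const]
    _ ≤ _ := by
        gcongr
        exact setLIntegral_closedBall_le_maximalFn _ _ _

/-- The Hardy–Littlewood maximal inequality in `L^p`, for `1 < p < ∞`. -/
theorem exists_lintegral_maximalFn_rpow_le [Nontrivial V] {p : ℝ} (hp : 1 < p) :
    ∃ C : ℝ≥0∞, C ≠ ∞ ∧ ∀ f : V → ℝ≥0∞, Measurable f →
      ∫⁻ x, maximalFn f x ^ p ≤ C * ∫⁻ x, f x ^ p := by
  set D := ENNReal.ofReal (5 ^ finrank ℝ V)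
  set c := ENNReal.ofReal (p / (p - 1))
  refine ⟨2 * D * c * 2 ^ (p - 1), ?_, fun f hf => ?_⟩
  · exact ENNReal.mul_ne_top (ENNReal.mul_ne_top (ENNReal.mul_ne_top (by simp) (by simp [D]))
      (by simp [c])) (by simp)
  have hp0 : 0 < p := by linarith
  rw [lintegral_rpow_eq_layercake volume (measurable_maximalFn hf) hp0]
  have hstep : ∀ t ∈ Ioi (0 : ℝ), ENNReal.ofReal (p * t ^ (p - 1)) *
      volume {x | ENNReal.ofReal t < maximalFn f x} ≤
      2 * D * c * ∫⁻ y, f y * {t : ℝ | ENNReal.ofReal t < 2 * f y}.indicator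
        (fun t => ENNReal.ofReal ((p - 1) * t ^ (p - 1 - 1))) t := by
    intro t ht
    have ht : 0 < t := ht
    set s := ENNReal.ofReal (t / 2)
    have hs : s ≠ 0 := by simp [s, ht]
    have hst : ENNReal.ofReal t = s + s := by
      rw [← ENNReal.ofReal_add (by positivity) (by positivity)]; congr 1; ring
    have h1 : volume {x | ENNReal.ofReal t < maximalFn f x} ≤
        D / s * ∫⁻ y, {y | s < f y}.indicator f y := by
      refine (measure_mono fun x hx => ?_).trans
        (maximalFn_weak ({y | s < f y}.indicator f) hs ENNReal.ofReal_ne_top)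
      have h2 : ENNReal.ofReal t < _ := lt_of_lt_of_le hx (maximalFn_le_add_const f s x)
      rw [hst] at h2
      exact lt_of_add_lt_add_right h2
    calc _ ≤ ENNReal.ofReal (p * t ^ (p - 1)) *
          (D / s * ∫⁻ y, {y | s < f y}.indicator f y) := by gcongr
      _ = (ENNReal.ofReal (p * t ^ (p - 1)) * (D / s)) * ∫⁻ y, {y | s < f y}.indicator f y := by
          ring
      _ = (2 * D * c * ENNReal.ofReal ((p - 1) * t ^ (p - 1 - 1))) *
            ∫⁻ y, {y | s < f y}.indicator f y := by
          congr 1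
          have h2 : (2 : ℝ≥0∞) = ENNReal.ofReal 2 := by simp
          rw [h2]
          simp only [D, c, s]
          rw [← ENNReal.ofReal_div_of_pos (by positivity), ← ENNReal.ofReal_mul (by positivity),
            ← ENNReal.ofReal_mul (by positivity),
            ← ENNReal.ofReal_mul (by positivity), ← ENNReal.ofReal_mul
              (mul_nonneg (by positivity) (div_nonneg hp0.le (by linarith)))]
          congr 1
          have : p - 1 ≠ 0 := by linarith
          have h3 : t ^ (p - 1) = t ^ (p - 1 - 1) * t := by
            rw [← Real.rpow_add_one ht.ne']; congr 1; ring
          rw [h3]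
          field_simp
      _ = _ := by
          rw [mul_assoc, ← lintegral_const_mul _ (hf.indicator (measurableSet_lt
            measurable_const hf))]
          congr 1
          refine lintegral_congr fun y => ?_
          have : s < f y ↔ ENNReal.ofReal t < 2 * f y := by
            rw [hst, ← two_mul]
            exact (ENNReal.mul_lt_mul_iff_right (by simp) (by simp)).symm
          by_cases h : s < f y
          · rw [indicator_of_mem (s := {y | s < f y}) h,
              indicator_of_mem (s := {t : ℝ | ENNReal.ofReal t < 2 * f y}) (this.1 h)]
            ring
          · rw [indicator_of_notMem (s := {y | s < f y}) h,
              indicator_of_notMem (s := {t : ℝ | ENNReal.ofReal t < 2 * f y})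
                (fun h' => h (this.2 h'))]
            simp
  calc _ ≤ ∫⁻ t in Ioi (0 : ℝ), 2 * D * c * ∫⁻ y, f y *
        {t : ℝ | ENNReal.ofReal t < 2 * f y}.indicator
        (fun t => ENNReal.ofReal ((p - 1) * t ^ (p - 1 - 1))) t :=
        setLIntegral_mono' measurableSet_Ioi hstep
    _ = 2 * D * c * ∫⁻ y, f y * (2 * f y) ^ (p - 1) := by
        have hm : MeasurableSet {q : ℝ × V | ENNReal.ofReal q.1 < 2 * f q.2} :=
          measurableSet_lt (ENNReal.measurable_ofReal.comp measurable_fst)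
            ((hf.comp measurable_snd).const_mul 2)
        have hm' : Measurable (Function.uncurry fun (t : ℝ) (y : V) => f y *
          {t : ℝ | ENNReal.ofReal t < 2 * f y}.indicator
            (fun t => ENNReal.ofReal ((p - 1) * t ^ (p - 1 - 1))) t) := by
          have : Measurable ({q : ℝ × V | ENNReal.ofReal q.1 < 2 * f q.2}.indicator
            (fun q => ENNReal.ofReal ((p - 1) * q.1 ^ (p - 1 - 1)))) :=
            Measurable.indicator (by fun_prop) hm
          exact (hf.comp measurable_snd).mul this
        have hm2 : Measurable fun t : ℝ => ∫⁻ y, f y *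
          {t : ℝ | ENNReal.ofReal t < 2 * f y}.indicator
            (fun t => ENNReal.ofReal ((p - 1) * t ^ (p - 1 - 1))) t := hm'.lintegral_prod_right'
        rw [lintegral_const_mul _ hm2, lintegral_lintegral_swap hm'.aemeasurable]
        congr 1
        refine lintegral_congr fun y => ?_
        rw [lintegral_const_mul, lintegral_Ioi_indicator_rpow (by linarith)]
        exact Measurable.indicator (by fun_prop)
          (measurableSet_lt ENNReal.measurable_ofReal measurable_const)
    _ = 2 * D * c * 2 ^ (p - 1) * ∫⁻ y, f y ^ p := by
        rw [mul_assoc _ (2 ^ (p - 1)), ← lintegral_const_mul _ (hf.pow_const p)]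
        congr 1
        refine lintegral_congr fun y => ?_
        rw [ENNReal.mul_rpow_of_nonneg _ _ (by linarith)]
        have : f y ^ p = f y * f y ^ (p - 1) := by
          rw [← add_sub_cancel 1 p, ENNReal.rpow_add_of_nonneg _ _ zero_le_one (by linarith)]
          simp
        rw [this]; ring

end MaximalFunction

lemma exists_disjoint_between {α ι : Type*} [MeasurableSpace α] [Countable ι] {B U : ι → Set α}
    (hB : ∀ i, MeasurableSet (B i)) (hU : ∀ i, MeasurableSet (U i)) (hBU : ∀ i, B i ⊆ U i)
    (hdisj : Pairwise (Function.onFun Disjoint B)) :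
    ∃ Q : ι → Set α, (∀ i, MeasurableSet (Q i)) ∧ Pairwise (Function.onFun Disjoint Q) ∧
      (∀ i, B i ⊆ Q i) ∧ (∀ i, Q i ⊆ U i) ∧ ⋃ i, U i ⊆ ⋃ i, Q i := by
  classical
  have := Encodable.ofCountable ι
  let W := ⋃ i, B i
  let P : ι → Set α := fun i => ⋃ j : {j : ι // Encodable.encode j < Encodable.encode i}, U j
  have hW : MeasurableSet W := MeasurableSet.iUnion hB
  have hP : ∀ i, MeasurableSet (P i) := fun i => MeasurableSet.iUnion fun j => hU j
  refine ⟨fun i => B i ∪ (U i \ (W ∪ P i)), fun i => (hB i).union ((hU i).diff (hW.union (hP i))),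
    ?_, fun i => subset_union_left, fun i => union_subset (hBU i) sdiff_subset, ?_⟩
  · intro i j hij
    rw [Function.onFun, Set.disjoint_left]
    rintro x (hx | ⟨hx, hx'⟩) (hy | ⟨hy, hy'⟩)
    · exact Set.disjoint_left.1 (hdisj hij) hx hy
    · exact hy' (Or.inl (mem_iUnion.2 ⟨i, hx⟩))
    · exact hx' (Or.inl (mem_iUnion.2 ⟨j, hy⟩))
    · rcases lt_trichotomy (Encodable.encode i) (Encodable.encode j) with h | h | h
      · exact hy' (Or.inr (mem_iUnion.2 ⟨⟨i, h⟩, hx⟩))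
      · exact hij (Encodable.encode_injective h)
      · exact hx' (Or.inr (mem_iUnion.2 ⟨⟨j, h⟩, hy⟩))
  · intro x hx
    by_cases hxW : x ∈ W
    · obtain ⟨i, hi⟩ := mem_iUnion.1 hxW
      exact mem_iUnion.2 ⟨i, Or.inl hi⟩
    · have hex : ∃ n, ∃ i, Encodable.encode i = n ∧ x ∈ U i := by
        obtain ⟨i, hi⟩ := mem_iUnion.1 hx
        exact ⟨_, i, rfl, hi⟩
      obtain ⟨i, hi, hxi⟩ := Nat.find_spec hex
      refine mem_iUnion.2 ⟨i, Or.inr ⟨hxi, ?_⟩⟩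
      rintro (h | h)
      · exact hxW h
      · obtain ⟨⟨j, hj⟩, hxj⟩ := mem_iUnion.1 h
        exact Nat.find_min hex (hj.trans_eq hi) ⟨j, rfl, hxj⟩

section Decomposition

variable {V : Type*} [NormedAddCommGroup V] [InnerProductSpace ℝ V] [FiniteDimensional ℝ V]
  [MeasurableSpace V] [BorelSpace V]
  {E : Type*} [NormedAddCommGroup E] [NormedSpace ℝ E] [CompleteSpace E]

/-- The Calderón–Zygmund decomposition at height `t`. -/
lemma exists_calderonZygmund_decomposition [Nontrivial V] {f : V → E} (hf : Integrable f)
    {t : ℝ≥0∞} (ht : t ≠ 0) (ht' : t ≠ ∞) :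
    ∃ (u : Set V) (Q : u → Set V) (r : u → ℝ) (g : V → E), u.Countable ∧ (∀ k, 0 < r k) ∧
      (∀ k, MeasurableSet (Q k)) ∧ Pairwise (Function.onFun Disjoint Q) ∧
      (∀ k, Q k ⊆ closedBall (k : V) (5 * r k)) ∧
      {x | t < maximalFn (fun y => ‖f y‖ₑ) x} ⊆ ⋃ k, Q k ∧
      ∑' k : u, volume (closedBall (k : V) (r k)) ≤
        volume {x | t / ENNReal.ofReal (2 ^ finrank ℝ V) < maximalFn (fun y => ‖f y‖ₑ) x} ∧
      AEStronglyMeasurable g ∧ (∀ y ∉ ⋃ k, Q k, g y = f y) ∧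
      (∀ k, ∀ y ∈ Q k, ‖g y‖ₑ ≤ ENNReal.ofReal (8 ^ finrank ℝ V) * t) ∧
      (∀ k, ∫⁻ y in Q k, ‖g y‖ₑ ≤ ∫⁻ y in Q k, ‖f y‖ₑ) ∧
      (∀ k, ∫ y in Q k, (f y - g y) = 0) ∧
      (∀ k, ∫⁻ y in Q k, ‖f y - g y‖ₑ ≤
        2 * ENNReal.ofReal (8 ^ finrank ℝ V) * t * volume (closedBall (k : V) (r k))) := by
  classical
  set d := finrank ℝ V
  have h'f : ∫⁻ y, ‖f y‖ₑ ≠ ∞ := hf.2.ne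
  obtain ⟨u, n, hu, hdisj, hgt, hle, hcov⟩ := exists_selected_balls h'f ht ht'
  have : Countable u := hu.to_subtype
  obtain ⟨Q, hQm, hQd, hBQ, hQU, hUQ⟩ := exists_disjoint_between
    (B := fun k : u => closedBall (k : V) ((2 : ℝ) ^ n k))
    (U := fun k : u => closedBall (k : V) (5 * (2 : ℝ) ^ n k))
    (fun _ => measurableSet_closedBall) (fun _ => measurableSet_closedBall)
    (fun k => closedBall_subset_closedBall (by have : (0 : ℝ) < 2 ^ n k := by positivity
                                               linarith))
    ((pairwise_subtype_iff_pairwise_set u _).2 hdisj)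
  have hQpos : ∀ k, volume (Q k) ≠ 0 := fun k h =>
    volume_closedBall_pos (k : V) (r := (2 : ℝ) ^ n k) (by positivity) (measure_mono_null (hBQ k) h)
  have hQfin : ∀ k, volume (Q k) ≠ ∞ := fun k =>
    ((measure_mono (hQU k)).trans_lt measure_closedBall_lt_top).ne
  have hfQ : ∀ k, ∫⁻ y in Q k, ‖f y‖ₑ ≤
      ENNReal.ofReal (8 ^ d) * t * volume (closedBall (k : V) ((2 : ℝ) ^ n k)) := by
    intro k
    have h8 : (8 : ℝ) * 2 ^ n k = 2 ^ (n k + 3) := by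
      rw [zpow_add₀ (by norm_num)]; norm_num; ring
    have h := hle k k.2 (n k + 3) (by lia)
    rw [ENNReal.div_le_iff (volume_closedBall_pos _ (by positivity))
      (volume_closedBall_lt_top _ _), ← h8,
      volume_closedBall_mul (k : V) (k : V) (by norm_num) (by positivity)] at h
    calc ∫⁻ y in Q k, ‖f y‖ₑ ≤ ∫⁻ y in closedBall (k : V) (8 * 2 ^ n k), ‖f y‖ₑ := by
          refine lintegral_mono_set ((hQU k).trans (closedBall_subset_closedBall ?_))
          gcongr; norm_num
      _ ≤ _ := h.trans_eq (by ring)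
  let c : u → E := fun k => (volume.real (Q k))⁻¹ • ∫ y in Q k, f y
  let g : V → E := fun y => if h : ∃ k, y ∈ Q k then c h.choose else f y
  have hgQ : ∀ k, ∀ y ∈ Q k, g y = c k := by
    intro k y hy
    have h : ∃ k, y ∈ Q k := ⟨k, hy⟩
    have : h.choose = k := by
      by_contra hne
      exact Set.disjoint_left.1 (hQd hne) h.choose_spec hy
    simp only [g, h, dite_true, this]
  have hgout : ∀ y ∉ ⋃ k, Q k, g y = f y := by
    intro y hy
    have h : ¬ ∃ k, y ∈ Q k := fun ⟨k, hk⟩ => hy (mem_iUnion.2 ⟨k, hk⟩)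
    simp only [g, h, dite_false]
  have hc : ∀ k, volume (Q k) * ‖c k‖ₑ ≤ ∫⁻ y in Q k, ‖f y‖ₑ := by
    intro k
    have h1 : ‖c k‖ₑ = (volume (Q k))⁻¹ * ‖∫ y in Q k, f y‖ₑ := by
      simp only [c, enorm_smul]
      congr 1
      rw [enorm_inv (by simp [Measure.real, ENNReal.toReal_eq_zero_iff, hQpos k, hQfin k]),
        Real.enorm_eq_ofReal measureReal_nonneg, ofReal_measureReal (hQfin k)]
    rw [h1, ← mul_assoc, ENNReal.mul_inv_cancel (hQpos k) (hQfin k), one_mul]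
    exact enorm_integral_le_lintegral_enorm _
  have hgint : ∀ k, ∫⁻ y in Q k, ‖g y‖ₑ ≤ ∫⁻ y in Q k, ‖f y‖ₑ := by
    intro k
    rw [setLIntegral_congr_fun (g := fun _ => ‖c k‖ₑ) (hQm k) (fun y hy => by simp only [hgQ k y hy]),
      setLIntegral_const, mul_comm]
    exact hc k
  have hgm : AEStronglyMeasurable g := by
    have h1 : AEStronglyMeasurable g (volume.restrict ((⋃ k, Q k) ∪ (⋃ k, Q k)ᶜ)) := by
      refine aestronglyMeasurable_union_iff.2 ⟨aestronglyMeasurable_iUnion_iff.2 fun k => ?_, ?_⟩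
      · refine (aestronglyMeasurable_const (b := c k)).congr ?_
        filter_upwards [ae_restrict_mem (hQm k)] with y hy
        exact (hgQ k y hy).symm
      · refine hf.1.restrict.congr ?_
        filter_upwards [ae_restrict_mem (MeasurableSet.iUnion hQm).compl] with y hy
        exact (hgout y hy).symm
    rwa [union_compl_self, Measure.restrict_univ] at h1
  refine ⟨u, Q, fun k => (2 : ℝ) ^ n k, g, hu, fun k => by positivity, hQm, hQd, hQU, ?_, ?_, hgm,
    hgout, ?_, hgint, ?_, ?_⟩
  · refine hcov.trans (Subset.trans ?_ hUQ)
    exact iUnion₂_subset fun x hx => subset_iUnion (fun k : u =>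
      closedBall (k : V) (5 * (2 : ℝ) ^ n k)) ⟨x, hx⟩
  · rw [← measure_iUnion ((pairwise_subtype_iff_pairwise_set u _).2 hdisj)
      (fun k => measurableSet_closedBall)]
    refine measure_mono (iUnion_subset fun k z hz => ?_)
    have hpos : (0 : ℝ) < 2 ^ n k := by positivity
    have h2 : (2 : ℝ) * 2 ^ n k = 2 ^ (n k + 1) := by
      rw [zpow_add₀ (by norm_num)]; norm_num; ring
    have hb := hgt k k.2
    have hsub : closedBall (k : V) (2 ^ n k) ⊆ closedBall z (2 ^ (n k + 1)) := by
      rw [← h2]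
      refine closedBall_subset_closedBall' ?_
      rw [mem_closedBall, dist_comm] at hz
      linarith
    refine lt_of_lt_of_le ?_ (setLIntegral_div_le_maximalFn _ z (n k + 1))
    rw [← h2, volume_closedBall_mul z (k : V) (by norm_num) (by positivity), h2]
    rw [ENNReal.lt_div_iff_mul_lt (Or.inl (volume_closedBall_pos _ hpos))
      (Or.inl (volume_closedBall_lt_top _ _))] at hb
    have hd0 : ENNReal.ofReal (2 ^ d) ≠ 0 := by simp
    rw [ENNReal.lt_div_iff_mul_lt (Or.inl (mul_ne_zero hd0 (volume_closedBall_pos _ hpos)))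
      (Or.inl (ENNReal.mul_ne_top (by simp) (volume_closedBall_lt_top _ _))), ← mul_assoc,
      ENNReal.div_mul_cancel hd0 (by simp)]
    exact hb.trans_le (lintegral_mono_set hsub)
  · intro k y hy
    rw [hgQ k y hy]
    have h1 := (hc k).trans (hfQ k)
    have h2 : volume (Q k) * ‖c k‖ₑ ≤ volume (Q k) * (ENNReal.ofReal (8 ^ d) * t) := by
      refine h1.trans ?_
      rw [mul_comm]
      gcongr
      exact hBQ k
    exact (ENNReal.mul_le_mul_iff_right (hQpos k) (hQfin k)).1 h2
  · intro k
    rw [setIntegral_congr_fun (g := fun y => f y - c k) (hQm k)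
      (fun y hy => by simp only [hgQ k y hy]), integral_sub hf.restrict
      (integrableOn_const (hQfin k)), setIntegral_const, smul_smul, mul_inv_cancel₀, one_smul,
      sub_self]
    simp [Measure.real, ENNReal.toReal_eq_zero_iff, hQpos k, hQfin k]
  · intro k
    calc ∫⁻ y in Q k, ‖f y - g y‖ₑ ≤ ∫⁻ y in Q k, (‖f y‖ₑ + ‖g y‖ₑ) :=
          lintegral_mono fun y => enorm_sub_le
      _ = (∫⁻ y in Q k, ‖f y‖ₑ) + ∫⁻ y in Q k, ‖g y‖ₑ :=
          lintegral_add_left' hf.1.restrict.enorm _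
      _ ≤ (∫⁻ y in Q k, ‖f y‖ₑ) + ∫⁻ y in Q k, ‖f y‖ₑ := add_le_add le_rfl (hgint k)
      _ ≤ _ := by
          refine (add_le_add (hfQ k) (hfQ k)).trans_eq ?_
          ring

end Decomposition

set_option linter.unusedSectionVars false

section CalderonZygmund

variable {V : Type*} [NormedAddCommGroup V] [InnerProductSpace ℝ V] [FiniteDimensional ℝ V]
  [MeasurableSpace V] [BorelSpace V]
  {E : Type*} [NormedAddCommGroup E] [NormedSpace ℂ E] [CompleteSpace E]
  {F : Type*} [NormedAddCommGroup F] [NormedSpace ℂ F] [CompleteSpace F]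

/-- Bounded, integrable, strongly measurable functions. -/
structure IsNice (f : V → E) : Prop where
  stronglyMeasurable : StronglyMeasurable f
  integrable : Integrable f
  bounded : ∃ M : ℝ, ∀ y, ‖f y‖ ≤ M

/-- Convolution with an operator-valued kernel. -/
noncomputable def convOp (K : V → E →L[ℂ] F) (f : V → E) (x : V) : F := ∫ y, K (x - y) (f y)

/-- Qualitatively nice Calderón–Zygmund kernels, with quantitative `L²` bound `A` and
Hörmander constant `B`. -/
structure IsCZKernel (K : V → E →L[ℂ] F) (A B : ℝ≥0∞) : Prop where
  continuous : Continuous K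
  integrable : Integrable K
  bounded : ∃ M : ℝ, ∀ y, ‖K y‖ ≤ M
  l2 : ∀ f : V → E, IsNice f → ∫⁻ x, ‖convOp K f x‖ₑ ^ (2 : ℝ) ≤ A * ∫⁻ x, ‖f x‖ₑ ^ (2 : ℝ)
  hormander : ∀ y, ∫⁻ x in {x | 2 * ‖y‖ ≤ ‖x‖}, ‖K (x - y) - K x‖ₑ ≤ B

lemma integrable_kernel_apply {K : V → E →L[ℂ] F} (hK : Continuous K) (hb : ∃ M : ℝ, ∀ y, ‖K y‖ ≤ M)
    {f : V → E} (hf : Integrable f) (x : V) : Integrable fun y => K (x - y) (f y) := by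
  obtain ⟨M, hM⟩ := hb
  refine (hf.norm.const_mul M).mono' ?_ (.of_forall fun y => ?_)
  · exact (ContinuousLinearMap.id ℂ (E →L[ℂ] F)).aestronglyMeasurable_comp₂
      ((hK.comp (continuous_const.sub continuous_id)).aestronglyMeasurable) hf.1
  · exact (K (x - y)).le_of_opNorm_le (hM _) _

lemma continuous_convOp {K : V → E →L[ℂ] F} (hK : Continuous K) (hb : ∃ M : ℝ, ∀ y, ‖K y‖ ≤ M)
    {f : V → E} (hf : Integrable f) : Continuous (convOp K f) := by
  have hb' := hb
  obtain ⟨M, hM⟩ := hb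
  refine continuous_of_dominated (bound := fun y => M * ‖f y‖)
    (fun x => (integrable_kernel_apply hK hb' hf x).1) (fun x => .of_forall fun y => ?_)
    (hf.norm.const_mul M) (.of_forall fun y => ?_)
  · exact (K (x - y)).le_of_opNorm_le (hM _) _
  · exact (hK.comp (continuous_id.sub continuous_const)).clm_apply continuous_const

lemma lintegral_hormander {K : V → E →L[ℂ] F} {A B : ℝ≥0∞} (hK : IsCZKernel K A B) {c y : V} {r : ℝ}
    (hy : y ∈ closedBall c (5 * r)) :
    ∫⁻ x in (closedBall c (10 * r))ᶜ, ‖K (x - y) - K (x - c)‖ₑ ≤ B := by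
  have hm : MeasurableSet {x : V | 2 * ‖y - c‖ ≤ ‖x‖} :=
    measurableSet_le measurable_const measurable_norm
  calc ∫⁻ x in (closedBall c (10 * r))ᶜ, ‖K (x - y) - K (x - c)‖ₑ
      = ∫⁻ x, (closedBall c (10 * r))ᶜ.indicator (fun x => ‖K (x - y) - K (x - c)‖ₑ) x :=
        (lintegral_indicator measurableSet_closedBall.compl _).symm
    _ ≤ ∫⁻ x, {x : V | 2 * ‖y - c‖ ≤ ‖x‖}.indicator
          (fun x => ‖K (x - (y - c)) - K x‖ₑ) (x - c) := by
        refine lintegral_mono fun x => ?_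
        by_cases hx : x ∈ closedBall c (10 * r)
        · simp [hx]
        · rw [indicator_of_mem (show x ∈ (closedBall c (10 * r))ᶜ from hx), indicator_of_mem]
          · simp
          · rw [mem_closedBall, dist_eq_norm] at hx hy
            simp only [mem_ofPred_eq]
            linarith
    _ = ∫⁻ x, {x : V | 2 * ‖y - c‖ ≤ ‖x‖}.indicator (fun x => ‖K (x - (y - c)) - K x‖ₑ) x :=
        lintegral_sub_right_eq_self _ c
    _ ≤ B := by
        rw [lintegral_indicator hm]
        exact hK.hormander _

/-- Off the enlarged balls, the image of the bad part is integrable. -/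
lemma lintegral_convOp_bad {K : V → E →L[ℂ] F} {A B : ℝ≥0∞} (hK : IsCZKernel K A B)
    {u : Set V} [Countable u] {Q : u → Set V} {r : u → ℝ} {b : V → E} (hb : Integrable b)
    (hQm : ∀ k, MeasurableSet (Q k)) (hQd : Pairwise (Function.onFun Disjoint Q))
    (hQr : ∀ k, Q k ⊆ closedBall (k : V) (5 * r k)) (hb0 : ∀ y ∉ ⋃ k, Q k, b y = 0)
    (hint : ∀ k, ∫ y in Q k, b y = 0) :
    ∫⁻ x in (⋃ k : u, closedBall (k : V) (10 * r k))ᶜ, ‖convOp K b x‖ₑ ≤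
      B * ∑' k, ∫⁻ y in Q k, ‖b y‖ₑ := by
  have hpt : ∀ x, ‖convOp K b x‖ₑ ≤
      ∑' k : u, ∫⁻ y in Q k, ‖K (x - y) - K (x - (k : V))‖ₑ * ‖b y‖ₑ := by
    intro x
    have hi := integrable_kernel_apply hK.continuous hK.bounded hb x
    have h1 : convOp K b x = ∫ y in ⋃ k, Q k, K (x - y) (b y) := by
      rw [convOp, setIntegral_eq_integral_of_forall_compl_eq_zero]
      intro y hy
      rw [hb0 y hy, map_zero]
    rw [h1, integral_iUnion hQm hQd hi.integrableOn]
    have h2 : ∀ k : u, ∫ y in Q k, K (x - y) (b y) =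
        ∫ y in Q k, (K (x - y) - K (x - (k : V))) (b y) := by
      intro k
      simp_rw [sub_apply]
      rw [integral_sub hi.integrableOn
        (((K (x - (k : V))).integrable_comp hb).integrableOn),
        ContinuousLinearMap.integral_comp_comm _ hb.integrableOn, hint k, map_zero, sub_zero]
    calc ‖∑' k, ∫ y in Q k, K (x - y) (b y)‖ₑ ≤ ∑' k, ‖∫ y in Q k, K (x - y) (b y)‖ₑ :=
          enorm_tsum_le_tsum_enorm
      _ ≤ _ := by
          refine ENNReal.tsum_le_tsum fun k => ?_
          rw [h2 k]
          refine (enorm_integral_le_lintegral_enorm _).trans (lintegral_mono fun y => ?_)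
          exact ContinuousLinearMap.le_opENorm _ _
  have hmeas : ∀ k : u, AEMeasurable (Function.uncurry fun (x y : V) =>
      ‖K (x - y) - K (x - (k : V))‖ₑ * ‖b y‖ₑ)
      ((volume.restrict (⋃ k : u, closedBall (k : V) (10 * r k))ᶜ).prod (volume.restrict (Q k))) := by
    intro k
    refine AEMeasurable.mul (f := fun z : V × V => ‖K (z.1 - z.2) - K (z.1 - (k : V))‖ₑ)
      (g := fun z : V × V => ‖b z.2‖ₑ) ?_ ?_
    · have : Continuous fun z : V × V => ‖K (z.1 - z.2) - K (z.1 - (k : V))‖ₑ := by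
        have := hK.continuous
        fun_prop
      exact this.measurable.aemeasurable
    · exact (hb.1.restrict (s := Q k)).enorm.comp_snd
  calc ∫⁻ x in (⋃ k : u, closedBall (k : V) (10 * r k))ᶜ, ‖convOp K b x‖ₑ
      ≤ ∫⁻ x in (⋃ k : u, closedBall (k : V) (10 * r k))ᶜ,
          ∑' k : u, ∫⁻ y in Q k, ‖K (x - y) - K (x - (k : V))‖ₑ * ‖b y‖ₑ := lintegral_mono hpt
    _ = ∑' k : u, ∫⁻ x in (⋃ k : u, closedBall (k : V) (10 * r k))ᶜ,
          ∫⁻ y in Q k, ‖K (x - y) - K (x - (k : V))‖ₑ * ‖b y‖ₑ :=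
        lintegral_tsum fun k => (hmeas k).lintegral_prod_right'
    _ = ∑' k : u, ∫⁻ y in Q k, ∫⁻ x in (⋃ k : u, closedBall (k : V) (10 * r k))ᶜ,
          ‖K (x - y) - K (x - (k : V))‖ₑ * ‖b y‖ₑ := by
        refine tsum_congr fun k => ?_
        exact lintegral_lintegral_swap (hmeas k)
    _ ≤ ∑' k : u, ∫⁻ y in Q k, B * ‖b y‖ₑ := by
        refine ENNReal.tsum_le_tsum fun k => ?_
        refine setLIntegral_mono' (hQm k) fun y hy => ?_
        rw [lintegral_mul_const' _ _ enorm_ne_top]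
        refine mul_le_mul_left ?_ _
        refine le_trans ?_ (lintegral_hormander hK (hQr k hy))
        refine lintegral_mono' (Measure.restrict_mono ?_ le_rfl) le_rfl
        exact compl_subset_compl.2 (subset_iUnion (fun k : u => closedBall (k : V) (10 * r k)) k)
    _ = B * ∑' k, ∫⁻ y in Q k, ‖b y‖ₑ := by
        rw [← ENNReal.tsum_mul_left]
        refine tsum_congr fun k => ?_
        exact lintegral_const_mul'' _ hb.1.restrict.enorm

end CalderonZygmund

section CalderonZygmund

variable {V : Type*} [NormedAddCommGroup V] [InnerProductSpace ℝ V] [FiniteDimensional ℝ V]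
  [MeasurableSpace V] [BorelSpace V]
  {E : Type*} [NormedAddCommGroup E] [NormedSpace ℂ E] [CompleteSpace E]
  {F : Type*} [NormedAddCommGroup F] [NormedSpace ℂ F] [CompleteSpace F]

lemma volume_iUnion_closedBall_le {u : Set V} [Countable u] {r : u → ℝ} (hr : ∀ k, 0 < r k)
    {a : ℝ} (ha : 0 ≤ a) :
    volume (⋃ k : u, closedBall (k : V) (a * r k)) ≤
      ENNReal.ofReal (a ^ finrank ℝ V) * ∑' k : u, volume (closedBall (k : V) (r k)) := by
  rw [← ENNReal.tsum_mul_left]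
  refine (measure_iUnion_le _).trans (ENNReal.tsum_le_tsum fun k => ?_)
  rw [volume_closedBall_mul (k : V) (k : V) ha (hr k).le]

lemma cz_distribution [Nontrivial V] {K : V → E →L[ℂ] F} {A B : ℝ≥0∞} (hK : IsCZKernel K A B)
    {f : V → E} (hf : IsNice f) {τ : ℝ≥0∞} (hτ : τ ≠ 0) (hτ' : τ ≠ ∞) :
    volume {x | τ < ‖convOp K f x‖ₑ} ≤
      4 * A / τ ^ (2 : ℝ) *
        (∫⁻ x in {x | maximalFn (fun y => ‖f y‖ₑ) x ≤ τ}, ‖f x‖ₑ ^ (2 : ℝ)) +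
      (4 * ENNReal.ofReal (8 ^ finrank ℝ V) ^ (2 : ℝ) * ENNReal.ofReal (5 ^ finrank ℝ V) +
        ENNReal.ofReal (10 ^ finrank ℝ V) + 4 * ENNReal.ofReal (8 ^ finrank ℝ V)) * (A + B + 1) *
        volume {x | τ / ENNReal.ofReal (2 ^ finrank ℝ V) < maximalFn (fun y => ‖f y‖ₑ) x} := by
  obtain ⟨u, Q, r, g, hu, hr, hQm, hQd, hQr, hcov, hsum, hgm, hgf, hgb, hgint, hint0, hbint⟩ :=
    exists_calderonZygmund_decomposition hf.integrable hτ hτ'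
  have : Countable u := hu.to_subtype
  set c8 := ENNReal.ofReal (8 ^ finrank ℝ V)
  set c5 := ENNReal.ofReal (5 ^ finrank ℝ V)
  set c10 := ENNReal.ofReal (10 ^ finrank ℝ V)
  set m := volume {x | τ / ENNReal.ofReal (2 ^ finrank ℝ V) < maximalFn (fun y => ‖f y‖ₑ) x}
  set N := ∑' k : u, volume (closedBall (k : V) (r k))
  set b : V → E := fun y => f y - g y
  have hUm : MeasurableSet (⋃ k, Q k) := MeasurableSet.iUnion hQm
  have hb0 : ∀ y ∉ ⋃ k, Q k, b y = 0 := fun y hy => by simp [b, hgf y hy]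
  -- the bad part is integrable
  have hgI : Integrable g := by
    refine ⟨hgm, ?_⟩
    rw [HasFiniteIntegral, ← lintegral_add_compl _ hUm, ENNReal.add_lt_top]
    constructor
    · rw [lintegral_iUnion hQm hQd]
      calc ∑' k, ∫⁻ y in Q k, ‖g y‖ₑ ≤ ∑' k, ∫⁻ y in Q k, ‖f y‖ₑ := ENNReal.tsum_le_tsum hgint
        _ = ∫⁻ y in ⋃ k, Q k, ‖f y‖ₑ := (lintegral_iUnion hQm hQd _).symm
        _ ≤ ∫⁻ y, ‖f y‖ₑ := setLIntegral_le_lintegral _ _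
        _ < ∞ := hf.integrable.2
    · calc ∫⁻ y in (⋃ k, Q k)ᶜ, ‖g y‖ₑ = ∫⁻ y in (⋃ k, Q k)ᶜ, ‖f y‖ₑ :=
            setLIntegral_congr_fun hUm.compl fun y hy => by simp only [hgf y hy]
        _ ≤ ∫⁻ y, ‖f y‖ₑ := setLIntegral_le_lintegral _ _
        _ < ∞ := hf.integrable.2
  have hbI : Integrable b := hf.integrable.sub hgI
  obtain ⟨M, hM⟩ := hf.bounded
  obtain ⟨g', hg'm, hg'⟩ : ∃ g' : V → E, IsNice g' ∧ g =ᵐ[volume] g' := by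
    refine ⟨fun x => if ‖hgm.mk g x‖ ≤ max M (c8 * τ).toReal then hgm.mk g x else 0, ⟨?_, ?_, ?_⟩, ?_⟩
    · refine StronglyMeasurable.ite ?_ hgm.stronglyMeasurable_mk stronglyMeasurable_const
      exact (hgm.stronglyMeasurable_mk.norm.measurable measurableSet_Iic)
    · refine (hgI.congr hgm.ae_eq_mk).norm.mono' ?_ (.of_forall fun x => ?_)
      · refine (StronglyMeasurable.ite ?_ hgm.stronglyMeasurable_mk
          stronglyMeasurable_const).aestronglyMeasurable
        exact (hgm.stronglyMeasurable_mk.norm.measurable measurableSet_Iic)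
      · split_ifs <;> simp
    · refine ⟨max M (c8 * τ).toReal, fun y => ?_⟩
      split_ifs with h
      · exact h
      · rw [norm_zero]
        exact le_max_of_le_right ENNReal.toReal_nonneg
    · filter_upwards [hgm.ae_eq_mk] with x hx
      rw [← hx, if_pos]
      by_cases h : x ∈ ⋃ k, Q k
      · obtain ⟨k, hk⟩ := mem_iUnion.1 h
        refine le_max_of_le_right ?_
        rw [← toReal_enorm]
        exact ENNReal.toReal_mono (ENNReal.mul_ne_top (by simp [c8]) hτ') (hgb k x hk)
      · rw [hgf x h]
        exact le_max_of_le_left (hM x)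
  have hTg : convOp K g = convOp K g' := by
    ext x
    exact integral_congr_ae (hg'.mono fun y hy => by simp only [hy])
  have hT : ∀ x, convOp K f x = convOp K g x + convOp K b x := by
    intro x
    rw [convOp, convOp, convOp, ← integral_add (integrable_kernel_apply hK.continuous hK.bounded hgI x)
      (integrable_kernel_apply hK.continuous hK.bounded hbI x)]
    simp [b]
  have hτ2 : τ / 2 ≠ 0 := by simp [hτ]
  have hτ2' : τ / 2 ≠ ∞ := ENNReal.div_ne_top hτ' (by simp)
  -- the good part
  have hvolQ : volume (⋃ k, Q k) ≤ c5 * N :=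
    (measure_mono (iUnion_mono hQr)).trans (volume_iUnion_closedBall_le hr (by norm_num))
  have hg2 : ∫⁻ x, ‖g x‖ₑ ^ (2 : ℝ) ≤
      (∫⁻ x in {x | maximalFn (fun y => ‖f y‖ₑ) x ≤ τ}, ‖f x‖ₑ ^ (2 : ℝ)) +
        (c8 * τ) ^ (2 : ℝ) * (c5 * N) := by
    rw [← lintegral_add_compl _ hUm, add_comm]
    refine add_le_add ?_ ?_
    · calc ∫⁻ x in (⋃ k, Q k)ᶜ, ‖g x‖ₑ ^ (2 : ℝ) = ∫⁻ x in (⋃ k, Q k)ᶜ, ‖f x‖ₑ ^ (2 : ℝ) :=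
            setLIntegral_congr_fun hUm.compl fun y hy => by simp only [hgf y hy]
        _ ≤ _ := by
            refine lintegral_mono' (Measure.restrict_mono ?_ le_rfl) le_rfl
            intro x hx
            by_contra h
            exact hx (hcov (by simpa using h))
    · calc ∫⁻ x in ⋃ k, Q k, ‖g x‖ₑ ^ (2 : ℝ) ≤ ∫⁻ x in ⋃ k, Q k, (c8 * τ) ^ (2 : ℝ) := by
            refine setLIntegral_mono' hUm fun x hx => ?_
            obtain ⟨k, hk⟩ := mem_iUnion.1 hx
            exact ENNReal.rpow_le_rpow (hgb k x hk) (by norm_num)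
        _ ≤ _ := by
            rw [setLIntegral_const]
            exact mul_le_mul_right hvolQ _
  have hgood : volume {x | τ / 2 < ‖convOp K g x‖ₑ} ≤ 4 * A / τ ^ (2 : ℝ) *
      ((∫⁻ x in {x | maximalFn (fun y => ‖f y‖ₑ) x ≤ τ}, ‖f x‖ₑ ^ (2 : ℝ)) +
        (c8 * τ) ^ (2 : ℝ) * (c5 * N)) := by
    have hcont := continuous_convOp hK.continuous hK.bounded hgI
    calc volume {x | τ / 2 < ‖convOp K g x‖ₑ}
        ≤ volume {x | (τ / 2) ^ (2 : ℝ) ≤ ‖convOp K g x‖ₑ ^ (2 : ℝ)} :=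
          measure_mono fun x hx => ENNReal.rpow_le_rpow (le_of_lt hx) (by norm_num)
      _ ≤ (∫⁻ x, ‖convOp K g x‖ₑ ^ (2 : ℝ)) / (τ / 2) ^ (2 : ℝ) :=
          meas_ge_le_lintegral_div (by fun_prop) (by simp [hτ])
            (ENNReal.rpow_ne_top_of_nonneg (by norm_num) hτ2')
      _ ≤ A * ((∫⁻ x in {x | maximalFn (fun y => ‖f y‖ₑ) x ≤ τ}, ‖f x‖ₑ ^ (2 : ℝ)) +
        (c8 * τ) ^ (2 : ℝ) * (c5 * N)) / (τ / 2) ^ (2 : ℝ) := by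
          refine ENNReal.div_le_div_right ?_ _
          rw [hTg]
          refine (hK.l2 g' hg'm).trans (mul_le_mul_right ?_ _)
          refine le_trans (le_of_eq ?_) hg2
          exact lintegral_congr_ae (hg'.mono fun y hy => by simp only [hy])
      _ = _ := by
          rw [ENNReal.div_rpow_of_nonneg _ _ (by norm_num : (0 : ℝ) ≤ 2)]
          have : (2 : ℝ≥0∞) ^ (2 : ℝ) = 4 := by
            rw [ENNReal.rpow_two]; norm_num
          rw [this, div_eq_mul_inv, div_eq_mul_inv, div_eq_mul_inv, ENNReal.mul_inv (by simp) (by simp), inv_inv]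
          ring
  -- the bad part
  have hbad : volume {x | τ / 2 < ‖convOp K b x‖ₑ} ≤ c10 * N + 4 * c8 * B * N := by
    have hcont := continuous_convOp hK.continuous hK.bounded hbI
    set W := ⋃ k : u, closedBall (k : V) (10 * r k)
    have hW : MeasurableSet W := MeasurableSet.iUnion fun k => measurableSet_closedBall
    have hbsum : ∑' k, ∫⁻ y in Q k, ‖b y‖ₑ ≤ 2 * c8 * τ * N := by
      rw [← ENNReal.tsum_mul_left]
      exact ENNReal.tsum_le_tsum hbint
    calc volume {x | τ / 2 < ‖convOp K b x‖ₑ}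
        ≤ volume W + volume.restrict Wᶜ {x | τ / 2 ≤ ‖convOp K b x‖ₑ} := by
          rw [Measure.restrict_apply' hW.compl]
          refine (measure_mono ?_).trans (measure_union_le _ _)
          intro x hx
          by_cases h : x ∈ W
          · exact Or.inl h
          · exact Or.inr ⟨le_of_lt (by simpa using hx), h⟩
      _ ≤ c10 * N + (∫⁻ x in Wᶜ, ‖convOp K b x‖ₑ) / (τ / 2) := by
          refine add_le_add (volume_iUnion_closedBall_le hr (by norm_num)) ?_
          exact meas_ge_le_lintegral_div (by fun_prop) hτ2 hτ2'
      _ ≤ c10 * N + B * (2 * c8 * τ * N) / (τ / 2) := by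
          refine add_le_add le_rfl (ENNReal.div_le_div_right ?_ _)
          exact (lintegral_convOp_bad hK hbI hQm hQd hQr hb0 hint0).trans (mul_le_mul_right hbsum _)
      _ = _ := by
          congr 1
          rw [div_eq_mul_inv, div_eq_mul_inv, ENNReal.mul_inv (by simp) (by simp), inv_inv]
          calc B * (2 * c8 * τ * N) * (τ⁻¹ * 2) = (2 * 2 * c8 * B * N) * (τ * τ⁻¹) := by ring
            _ = _ := by
              rw [ENNReal.mul_inv_cancel hτ hτ']
              ring
  calc volume {x | τ < ‖convOp K f x‖ₑ}
      ≤ volume ({x | τ / 2 < ‖convOp K g x‖ₑ} ∪ {x | τ / 2 < ‖convOp K b x‖ₑ}) := by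
        refine measure_mono fun x hx => ?_
        by_contra h
        simp only [mem_union, mem_ofPred_eq, not_or, not_lt] at h hx
        refine absurd hx (not_lt.2 ?_)
        rw [hT x]
        refine (enorm_add_le _ _).trans ((add_le_add h.1 h.2).trans_eq (ENNReal.add_halves τ))
    _ ≤ _ := measure_union_le _ _
    _ ≤ 4 * A / τ ^ (2 : ℝ) *
      ((∫⁻ x in {x | maximalFn (fun y => ‖f y‖ₑ) x ≤ τ}, ‖f x‖ₑ ^ (2 : ℝ)) +
        (c8 * τ) ^ (2 : ℝ) * (c5 * N)) + (c10 * N + 4 * c8 * B * N) := add_le_add hgood hbad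
    _ = 4 * A / τ ^ (2 : ℝ) *
      (∫⁻ x in {x | maximalFn (fun y => ‖f y‖ₑ) x ≤ τ}, ‖f x‖ₑ ^ (2 : ℝ)) +
        (4 * c8 ^ (2 : ℝ) * c5 * A + c10 * 1 + 4 * c8 * B) * N := by
        rw [ENNReal.mul_rpow_of_nonneg _ _ (by norm_num : (0 : ℝ) ≤ 2)]
        have h1 : τ ^ (2 : ℝ) * (τ ^ (2 : ℝ))⁻¹ = 1 :=
          ENNReal.mul_inv_cancel (by simp [hτ]) (ENNReal.rpow_ne_top_of_nonneg (by norm_num) hτ')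
        rw [mul_add, add_assoc]
        congr 1
        calc 4 * A / τ ^ (2 : ℝ) * (c8 ^ (2 : ℝ) * τ ^ (2 : ℝ) * (c5 * N)) +
            (c10 * N + 4 * c8 * B * N) = 4 * A * c8 ^ (2 : ℝ) * c5 * N *
              (τ ^ (2 : ℝ) * (τ ^ (2 : ℝ))⁻¹) + (c10 * N + 4 * c8 * B * N) := by
              rw [div_eq_mul_inv]; ring
          _ = _ := by rw [h1]; ring
    _ ≤ _ := by
        refine add_le_add le_rfl (mul_le_mul' ?_ hsum)
        rw [add_mul, add_mul]
        refine add_le_add (add_le_add ?_ ?_) ?_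
        · exact mul_le_mul_right (le_add_right le_self_add) _
        · exact mul_le_mul_right le_add_self _
        · exact mul_le_mul_right (le_add_right le_add_self) _

end CalderonZygmund

section CalderonZygmund

variable {V : Type*} [NormedAddCommGroup V] [InnerProductSpace ℝ V] [FiniteDimensional ℝ V]
  [MeasurableSpace V] [BorelSpace V]

section Weak

variable {E : Type*} [NormedAddCommGroup E] [NormedSpace ℂ E] [CompleteSpace E]
  {F : Type*} [NormedAddCommGroup F] [NormedSpace ℂ F] [CompleteSpace F]

lemma cz_strong_lt_two [Nontrivial V] {p : ℝ} (hp : 1 < p) (hp2 : p < 2) {c : ℝ≥0∞}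
    (hc : ∀ f : V → ℝ≥0∞, Measurable f → ∫⁻ x, maximalFn f x ^ p ≤ c * ∫⁻ x, f x ^ p)
    {K : V → E →L[ℂ] F} {A B : ℝ≥0∞} (hK : IsCZKernel K A B)
    {f : V → E} (hf : IsNice f) :
    ∫⁻ x, ‖convOp K f x‖ₑ ^ p ≤ (4 * ENNReal.ofReal p * ENNReal.ofReal (1 / (2 - p)) +
      (4 * ENNReal.ofReal (8 ^ finrank ℝ V) ^ (2 : ℝ) * ENNReal.ofReal (5 ^ finrank ℝ V) +
        ENNReal.ofReal (10 ^ finrank ℝ V) + 4 * ENNReal.ofReal (8 ^ finrank ℝ V)) *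
        ENNReal.ofReal (2 ^ finrank ℝ V) ^ p) * c * (A + B + 1) * ∫⁻ x, ‖f x‖ₑ ^ p := by
  have hp0 : 0 < p := by linarith
  set D := 4 * ENNReal.ofReal (8 ^ finrank ℝ V) ^ (2 : ℝ) * ENNReal.ofReal (5 ^ finrank ℝ V) +
        ENNReal.ofReal (10 ^ finrank ℝ V) + 4 * ENNReal.ofReal (8 ^ finrank ℝ V)
  set c2 := ENNReal.ofReal (2 ^ finrank ℝ V) with hc2
  have hc20 : c2 ≠ 0 := by simp [hc2]
  have hc2t : c2 ≠ ∞ := by simp [hc2]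
  set M := maximalFn fun y => ‖f y‖ₑ with hMdef
  have hfm : Measurable fun y => ‖f y‖ₑ := hf.stronglyMeasurable.enorm
  have hM : Measurable M := measurable_maximalFn hfm
  have hcont := continuous_convOp hK.continuous hK.bounded hf.integrable
  have hMf : ∀ᵐ x, ‖f x‖ₑ ≤ M x := ae_le_maximalFn hfm hf.integrable.2.ne
  have hset : MeasurableSet {z : ℝ × V | M z.2 ≤ ENNReal.ofReal z.1} :=
    measurableSet_le (hM.comp measurable_snd) (ENNReal.measurable_ofReal.comp measurable_fst)
  rw [lintegral_rpow_eq_layercake volume hcont.enorm.measurable hp0]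
  calc ∫⁻ t in Ioi (0 : ℝ), ENNReal.ofReal (p * t ^ (p - 1)) *
          volume {x | ENNReal.ofReal t < ‖convOp K f x‖ₑ}
      ≤ ∫⁻ t in Ioi (0 : ℝ), (4 * ENNReal.ofReal p * A * (∫⁻ x, {z : ℝ × V | M z.2 ≤
            ENNReal.ofReal z.1}.indicator
            (fun z => ENNReal.ofReal (z.1 ^ (p - 3)) * ‖f z.2‖ₑ ^ (2 : ℝ)) (t, x)) +
          D * (A + B + 1) * (ENNReal.ofReal (p * t ^ (p - 1)) *
            volume {x | ENNReal.ofReal t < c2 * M x})) := by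
        refine setLIntegral_mono' measurableSet_Ioi fun t ht => ?_
        have ht0 : (0 : ℝ) < t := ht
        refine (mul_le_mul_right (cz_distribution hK hf (τ := ENNReal.ofReal t) (by simpa using ht0)
          (by simp)) _).trans ?_
        rw [mul_add]
        refine add_le_add (le_of_eq ?_) (le_of_eq ?_)
        · have h1 : ∫⁻ x in {x | M x ≤ ENNReal.ofReal t}, ‖f x‖ₑ ^ (2 : ℝ) =
              ∫⁻ x, {x | M x ≤ ENNReal.ofReal t}.indicator (fun x => ‖f x‖ₑ ^ (2 : ℝ)) x :=
            (lintegral_indicator (measurableSet_le hM measurable_const) _).symm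
          have h2 : ∀ x, {z : ℝ × V | M z.2 ≤ ENNReal.ofReal z.1}.indicator
              (fun z => ENNReal.ofReal (z.1 ^ (p - 3)) * ‖f z.2‖ₑ ^ (2 : ℝ)) (t, x) =
              ENNReal.ofReal (t ^ (p - 3)) *
                {x | M x ≤ ENNReal.ofReal t}.indicator (fun x => ‖f x‖ₑ ^ (2 : ℝ)) x := by
            intro x
            by_cases h : M x ≤ ENNReal.ofReal t <;> simp [indicator, h]
          simp_rw [h2]
          rw [h1, lintegral_const_mul' _ _ (by simp)]
          have h3 : ENNReal.ofReal (p * t ^ (p - 1)) / ENNReal.ofReal t ^ (2 : ℝ) =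
              ENNReal.ofReal p * ENNReal.ofReal (t ^ (p - 3)) := by
            rw [ENNReal.ofReal_rpow_of_pos ht0, ← ENNReal.ofReal_div_of_pos (by positivity),
              ← ENNReal.ofReal_mul hp0.le, mul_div_assoc, ← Real.rpow_sub ht0]
            ring_nf
          rw [div_eq_mul_inv] at h3 ⊢
          calc _ = (ENNReal.ofReal (p * t ^ (p - 1)) * (ENNReal.ofReal t ^ (2 : ℝ))⁻¹) *
                (4 * A * ∫⁻ x, {x | M x ≤ ENNReal.ofReal t}.indicator
                  (fun x => ‖f x‖ₑ ^ (2 : ℝ)) x) := by ring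
            _ = _ := by
              rw [h3]
              ring
        · have h4 : ∀ x, ENNReal.ofReal t / c2 < M x ↔ ENNReal.ofReal t < c2 * M x := by
            intro x
            rw [ENNReal.div_lt_iff (Or.inl hc20) (Or.inl hc2t), mul_comm]
          simp only [← h4]
          ring
    _ = 4 * ENNReal.ofReal p * A * (∫⁻ x, ∫⁻ t in Ioi (0 : ℝ), {z : ℝ × V | M z.2 ≤
            ENNReal.ofReal z.1}.indicator
            (fun z => ENNReal.ofReal (z.1 ^ (p - 3)) * ‖f z.2‖ₑ ^ (2 : ℝ)) (t, x)) +
          D * (A + B + 1) * ∫⁻ x, (c2 * M x) ^ p := by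
        have hm : Measurable ({z : ℝ × V | M z.2 ≤ ENNReal.ofReal z.1}.indicator
            (fun z => ENNReal.ofReal (z.1 ^ (p - 3)) * ‖f z.2‖ₑ ^ (2 : ℝ))) := by
          refine Measurable.indicator ?_ hset
          have : Measurable fun z : ℝ × V => ‖f z.2‖ₑ := hfm.comp measurable_snd
          refine Measurable.mul (by fun_prop) (this.pow_const _)
        rw [lintegral_add_left (by exact hm.lintegral_prod_right'.const_mul _),
          lintegral_const_mul _ hm.lintegral_prod_right', lintegral_const_mul'',
          lintegral_lintegral_swap (f := fun t x => {z : ℝ × V | M z.2 ≤ ENNReal.ofReal z.1}.indicator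
            (fun z => ENNReal.ofReal (z.1 ^ (p - 3)) * ‖f z.2‖ₑ ^ (2 : ℝ)) (t, x)) hm.aemeasurable,
          ← lintegral_rpow_eq_layercake volume (hM.const_mul c2) hp0]
        · refine Measurable.aemeasurable (Measurable.mul (by fun_prop) ?_)
          have : Antitone fun t : ℝ => volume {x | ENNReal.ofReal t < c2 * M x} :=
            fun s t hst => measure_mono fun x hx => lt_of_le_of_lt (ENNReal.ofReal_le_ofReal hst) hx
          exact this.measurable
    _ ≤ 4 * ENNReal.ofReal p * A * (∫⁻ x, ENNReal.ofReal (1 / (2 - p)) * M x ^ p) +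
          D * (A + B + 1) * ∫⁻ x, (c2 * M x) ^ p := by
        refine add_le_add (mul_le_mul_right (lintegral_mono_ae ?_) _) le_rfl
        filter_upwards [hMf] with x hx
        have h5 : ∀ t : ℝ, {z : ℝ × V | M z.2 ≤ ENNReal.ofReal z.1}.indicator
              (fun z => ENNReal.ofReal (z.1 ^ (p - 3)) * ‖f z.2‖ₑ ^ (2 : ℝ)) (t, x) =
              {t : ℝ | M x ≤ ENNReal.ofReal t}.indicator
                (fun t => ENNReal.ofReal (t ^ (p - 3))) t * ‖f x‖ₑ ^ (2 : ℝ) := by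
          intro t
          by_cases h : M x ≤ ENNReal.ofReal t <;> simp [indicator, h]
        simp_rw [h5]
        rw [lintegral_mul_const' _ _ (by simp)]
        by_cases hM0 : M x = 0
        · have : ‖f x‖ₑ = 0 := le_antisymm (hx.trans_eq hM0) zero_le
          simp [this]
        · refine (mul_le_mul_left (lintegral_Ioi_rpow_le hp2 hM0) _).trans ?_
          rw [mul_assoc]
          refine mul_le_mul_right ?_ _
          by_cases hMt : M x = ∞
          · rw [hMt, ENNReal.top_rpow_of_pos hp0]
            exact le_top
          calc M x ^ (p - 2) * ‖f x‖ₑ ^ (2 : ℝ) ≤ M x ^ (p - 2) * M x ^ (2 : ℝ) :=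
                mul_le_mul_right (ENNReal.rpow_le_rpow hx (by norm_num)) _
            _ = M x ^ p := by
                rw [← ENNReal.rpow_add _ _ hM0 hMt]
                ring_nf
    _ = (4 * ENNReal.ofReal p * ENNReal.ofReal (1 / (2 - p)) * A + D * c2 ^ p * (A + B + 1)) *
          ∫⁻ x, M x ^ p := by
        simp_rw [ENNReal.mul_rpow_of_nonneg _ _ hp0.le]
        rw [lintegral_const_mul _ (hM.pow_const p), lintegral_const_mul _ (hM.pow_const p)]
        ring
    _ ≤ ((4 * ENNReal.ofReal p * ENNReal.ofReal (1 / (2 - p)) + D * c2 ^ p) * (A + B + 1)) *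
          (c * ∫⁻ x, ‖f x‖ₑ ^ p) := by
        refine mul_le_mul' ?_ (hc _ hfm)
        rw [add_mul _ _ (A + B + 1)]
        exact add_le_add (mul_le_mul_right (le_add_right le_self_add) _) le_rfl
    _ = _ := by ring

end Weak

section Duality

variable {E : Type*} [NormedAddCommGroup E] [InnerProductSpace ℂ E] [CompleteSpace E]
  {F : Type*} [NormedAddCommGroup F] [InnerProductSpace ℂ F] [CompleteSpace F]

/-- The kernel of the adjoint convolution operator. -/
noncomputable def adjKernel (K : V → E →L[ℂ] F) (x : V) : F →L[ℂ] E :=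
  ContinuousLinearMap.adjoint (K (-x))

lemma adjKernel_adjKernel (K : V → E →L[ℂ] F) : adjKernel (adjKernel K) = K := by
  ext x : 1
  simp [adjKernel]

lemma norm_adjKernel (K : V → E →L[ℂ] F) (x : V) : ‖adjKernel K x‖ = ‖K (-x)‖ :=
  LinearIsometryEquiv.norm_map _ _

lemma continuous_adjKernel {K : V → E →L[ℂ] F} (hK : Continuous K) : Continuous (adjKernel K) :=
  (LinearIsometryEquiv.continuous ContinuousLinearMap.adjoint).comp (hK.comp continuous_neg)

lemma bounded_adjKernel {K : V → E →L[ℂ] F} (hb : ∃ M : ℝ, ∀ y, ‖K y‖ ≤ M) :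
    ∃ M : ℝ, ∀ y, ‖adjKernel K y‖ ≤ M := by
  obtain ⟨M, hM⟩ := hb
  exact ⟨M, fun y => (norm_adjKernel K y).trans_le (hM _)⟩

lemma integrable_adjKernel {K : V → E →L[ℂ] F} (hK : Continuous K) (hi : Integrable K) :
    Integrable (adjKernel K) :=
  (hi.comp_neg.norm).mono' (continuous_adjKernel hK).aestronglyMeasurable
    (.of_forall fun x => (norm_adjKernel K x).le)

lemma integrable_convOp {K : V → E →L[ℂ] F} (hi : Integrable K)
    {f : V → E} (hf : Integrable f) : Integrable (convOp K f) :=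
  hf.integrable_convolution (ContinuousLinearMap.id ℂ (E →L[ℂ] F)).flip hi

lemma inner_adj_convOp {K : V → E →L[ℂ] F} (hK : Continuous K) (hb : ∃ M : ℝ, ∀ y, ‖K y‖ ≤ M)
    {f : V → E} (hf : Integrable f) {g : V → F} (hg : Integrable g) :
    ∫ x, ⟪convOp (adjKernel K) g x, f x⟫_ℂ = ∫ y, ⟪g y, convOp K f y⟫_ℂ := by
  have h1 : ∀ x, ⟪convOp (adjKernel K) g x, f x⟫_ℂ = ∫ y, ⟪g y, K (y - x) (f x)⟫_ℂ := by
    intro x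
    rw [← inner_conj_symm, convOp, ← integral_inner (integrable_kernel_apply
      (continuous_adjKernel hK) (bounded_adjKernel hb) hg x), ← integral_conj]
    refine integral_congr_ae (.of_forall fun y => ?_)
    simp only [inner_conj_symm, adjKernel, ContinuousLinearMap.adjoint_inner_left, neg_sub]
  have h2 : ∀ y, ⟪g y, convOp K f y⟫_ℂ = ∫ x, ⟪g y, K (y - x) (f x)⟫_ℂ := by
    intro y
    rw [convOp, ← integral_inner (integrable_kernel_apply hK hb hf y)]
  simp_rw [h1, h2]
  refine integral_integral_swap ?_
  obtain ⟨M, hM⟩ := hb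
  refine ((hf.norm.mul_prod hg.norm).const_mul M).mono' ?_ (.of_forall fun z => ?_)
  · have h3 : AEStronglyMeasurable (fun z : V × V => K (z.2 - z.1) (f z.1)) (volume.prod volume) :=
      (ContinuousLinearMap.id ℂ (E →L[ℂ] F)).aestronglyMeasurable_comp₂
        ((hK.comp (continuous_snd.sub continuous_fst)).aestronglyMeasurable) hf.1.comp_fst
    exact (hg.1.comp_snd).inner h3
  · calc ‖⟪g z.2, K (z.2 - z.1) (f z.1)⟫_ℂ‖ ≤ ‖g z.2‖ * ‖K (z.2 - z.1) (f z.1)‖ :=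
          norm_inner_le_norm _ _
      _ ≤ ‖g z.2‖ * (M * ‖f z.1‖) := by
          gcongr
          exact (K (z.2 - z.1)).le_of_opNorm_le (hM _) _
      _ = _ := by ring

lemma dual_bound {K : V → E →L[ℂ] F} (hK : Continuous K) (hb : ∃ M : ℝ, ∀ y, ‖K y‖ ≤ M)
    (hi : Integrable K) {p q : ℝ} (hpq : p.HolderConjugate q) (hp : 2 ≤ p) {C : ℝ≥0∞}
    (hC : ∀ f : V → E, IsNice f → ∫⁻ x, ‖convOp K f x‖ₑ ^ q ≤ C * ∫⁻ x, ‖f x‖ₑ ^ q)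
    {g : V → F} (hg : IsNice g) :
    ∫⁻ x, ‖convOp (adjKernel K) g x‖ₑ ^ p ≤ C ^ (p - 1) * ∫⁻ x, ‖g x‖ₑ ^ p := by
  have hp0 : 0 < p := by linarith
  set h := convOp (adjKernel K) g with hh
  have hcont : Continuous h :=
    continuous_convOp (continuous_adjKernel hK) (bounded_adjKernel hb) hg.integrable
  have hint : Integrable h :=
    integrable_convOp (integrable_adjKernel hK hi) hg.integrable
  obtain ⟨N, hN⟩ : ∃ N : ℝ, ∀ x, ‖h x‖ ≤ N := by
    obtain ⟨M, hM⟩ := bounded_adjKernel hb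
    refine ⟨M * ∫ y, ‖g y‖, fun x => ?_⟩
    rw [← integral_const_mul]
    refine norm_integral_le_of_norm_le (hg.integrable.norm.const_mul M) (.of_forall fun y => ?_)
    exact (adjKernel K (x - y)).le_of_opNorm_le (hM _) _
  have hN0 : 0 ≤ N := (norm_nonneg _).trans (hN 0)
  set f : V → E := fun x => ((‖h x‖ ^ (p - 2) : ℝ) : ℂ) • h x
  have hfn : ∀ x, ‖f x‖ = ‖h x‖ ^ (p - 1) := by
    intro x
    have h0 := norm_nonneg (h x)
    rw [norm_smul, Complex.norm_real, Real.norm_of_nonneg (by positivity)]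
    by_cases hz : h x = 0
    · rw [hz, norm_zero, mul_zero, Real.zero_rpow (by linarith)]
    · have h0 : 0 < ‖h x‖ := norm_pos_iff.2 hz
      nth_rw 2 [← Real.rpow_one ‖h x‖]
      rw [← Real.rpow_add h0]
      ring_nf
  have hfm : StronglyMeasurable f := by
    refine StronglyMeasurable.smul (Complex.measurable_ofReal.comp
      (hcont.norm.measurable.pow_const _)).stronglyMeasurable hcont.stronglyMeasurable
  have hnice : IsNice f := by
    refine ⟨hfm, (hint.norm.const_mul (N ^ (p - 2))).mono' hfm.aestronglyMeasurable
      (.of_forall fun x => ?_), N ^ (p - 1), fun x => ?_⟩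
    · rw [norm_smul, Complex.norm_real, Real.norm_of_nonneg (by positivity)]
      exact mul_le_mul_of_nonneg_right (Real.rpow_le_rpow (norm_nonneg _) (hN x) (by linarith))
        (norm_nonneg _)
    · rw [hfn]
      exact Real.rpow_le_rpow (norm_nonneg _) (hN x) (by linarith)
  set I := ∫⁻ x, ‖h x‖ₑ ^ p with hI
  have hinner : ∀ x, ⟪h x, f x⟫_ℂ = ((‖h x‖ ^ p : ℝ) : ℂ) := by
    intro x
    by_cases hz : h x = 0
    · simp [hz, Real.zero_rpow hp0.ne']
    · have h0 : 0 < ‖h x‖ := norm_pos_iff.2 hz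
      rw [inner_smul_right, inner_self_eq_norm_sq_to_K]
      have : ‖h x‖ ^ p = ‖h x‖ ^ (p - 2) * ‖h x‖ ^ 2 := by
        rw [← Real.rpow_natCast, ← Real.rpow_add h0]
        norm_num
      rw [this]
      push_cast
      rfl
  have hItop : I ≠ ∞ := by
    refine ne_of_lt ?_
    calc I ≤ ∫⁻ x, ENNReal.ofReal (N ^ (p - 1)) * ‖h x‖ₑ := by
          refine lintegral_mono fun x => ?_
          rw [← ofReal_norm, ENNReal.ofReal_rpow_of_nonneg (norm_nonneg _) hp0.le,
            ← ENNReal.ofReal_mul (by positivity)]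
          refine ENNReal.ofReal_le_ofReal ?_
          calc ‖h x‖ ^ p = ‖h x‖ ^ (p - 1) * ‖h x‖ := by
                rw [← hfn]
                by_cases hz : h x = 0
                · simp [hz, Real.zero_rpow hp0.ne']
                · have h0 : 0 < ‖h x‖ := norm_pos_iff.2 hz
                  rw [hfn]
                  nth_rw 3 [← Real.rpow_one ‖h x‖]
                  rw [← Real.rpow_add h0]
                  ring_nf
            _ ≤ _ := mul_le_mul_of_nonneg_right
                (Real.rpow_le_rpow (norm_nonneg _) (hN x) (by linarith)) (norm_nonneg _)
      _ = ENNReal.ofReal (N ^ (p - 1)) * ∫⁻ x, ‖h x‖ₑ := lintegral_const_mul' _ _ (by simp)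
      _ < ∞ := ENNReal.mul_lt_top (by simp) hint.2
  have hfI : ∫⁻ x, ‖f x‖ₑ ^ q = I := by
    refine lintegral_congr fun x => ?_
    have : ‖f x‖ₑ = ‖h x‖ₑ ^ (p - 1) := by
      rw [← ofReal_norm, hfn, ← ENNReal.ofReal_rpow_of_nonneg (norm_nonneg _) (by linarith),
        ofReal_norm]
    rw [this, ← ENNReal.rpow_mul, hpq.sub_one_mul_conj]
  have hcf := continuous_convOp hK hb hnice.integrable
  have key : I ≤ (∫⁻ x, ‖g x‖ₑ ^ p) ^ (1 / p) * (C * I) ^ (1 / q) := by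
    have e1 : I = ‖∫ x, ⟪h x, f x⟫_ℂ‖ₑ := by
      simp_rw [hinner]
      rw [integral_complex_ofReal, ← ofReal_norm, Complex.norm_real,
        Real.norm_of_nonneg (integral_nonneg fun x => by positivity),
        ofReal_integral_eq_lintegral_ofReal]
      · refine lintegral_congr fun x => ?_
        rw [← ofReal_norm, ENNReal.ofReal_rpow_of_nonneg (norm_nonneg _) hp0.le]
      · refine ⟨(hcont.norm.measurable.pow_const _).aestronglyMeasurable, ?_⟩
        rw [HasFiniteIntegral]
        refine lt_of_eq_of_lt (lintegral_congr fun x => ?_) hItop.lt_top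
        rw [Real.enorm_eq_ofReal (by positivity), ← ofReal_norm,
          ENNReal.ofReal_rpow_of_nonneg (norm_nonneg _) hp0.le]
      · exact .of_forall fun x => by positivity
    calc I = ‖∫ y, ⟪g y, convOp K f y⟫_ℂ‖ₑ := by
          rw [← inner_adj_convOp hK hb hnice.integrable hg.integrable, ← hh, ← e1]
      _ ≤ ∫⁻ y, ‖⟪g y, convOp K f y⟫_ℂ‖ₑ := enorm_integral_le_lintegral_enorm _
      _ ≤ ∫⁻ y, ‖g y‖ₑ * ‖convOp K f y‖ₑ := by
          refine lintegral_mono fun y => ?_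
          rw [← ofReal_norm, ← ofReal_norm, ← ofReal_norm, ← ENNReal.ofReal_mul (norm_nonneg _)]
          exact ENNReal.ofReal_le_ofReal (norm_inner_le_norm _ _)
      _ ≤ (∫⁻ x, ‖g x‖ₑ ^ p) ^ (1 / p) * (∫⁻ x, ‖convOp K f x‖ₑ ^ q) ^ (1 / q) :=
          ENNReal.lintegral_mul_le_Lp_mul_Lq volume hpq hg.stronglyMeasurable.enorm.aemeasurable
            (by fun_prop)
      _ ≤ _ := by
          refine mul_le_mul_right (ENNReal.rpow_le_rpow ?_ (by simpa using hpq.symm.nonneg)) _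
          exact (hC f hnice).trans_eq (by rw [hfI])
  by_cases hI0 : I = 0
  · simp [hI0]
  have hq0 : 0 < q := hpq.symm.pos
  have e2 : I ^ (1 / p) ≤ (∫⁻ x, ‖g x‖ₑ ^ p) ^ (1 / p) * C ^ (1 / q) := by
    have h3 : I = I ^ (1 / p) * I ^ (1 / q) := by
      rw [← ENNReal.rpow_add _ _ hI0 hItop]
      simp [hpq.inv_add_inv_eq_one]
    rw [ENNReal.mul_rpow_of_nonneg _ _ (by positivity), ← mul_assoc] at key
    nth_rw 1 [h3] at key
    refine (ENNReal.mul_le_mul_iff_left ?_ ?_).1 key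
    · simp [hI0, hItop]
    · exact ENNReal.rpow_ne_top_of_nonneg (by positivity) hItop
  calc I = (I ^ (1 / p)) ^ p := by
        rw [← ENNReal.rpow_mul, one_div, inv_mul_cancel₀ hp0.ne', ENNReal.rpow_one]
    _ ≤ ((∫⁻ x, ‖g x‖ₑ ^ p) ^ (1 / p) * C ^ (1 / q)) ^ p := ENNReal.rpow_le_rpow e2 hp0.le
    _ = _ := by
        rw [ENNReal.mul_rpow_of_nonneg _ _ hp0.le, ← ENNReal.rpow_mul, ← ENNReal.rpow_mul, one_div,
          inv_mul_cancel₀ hp0.ne', ENNReal.rpow_one, mul_comm]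
        congr 2
        have := hpq.sub_one_mul_conj
        field_simp
        linarith

lemma IsCZKernel.adj {K : V → E →L[ℂ] F} {A B : ℝ≥0∞} (hK : IsCZKernel K A B) :
    IsCZKernel (adjKernel K) A B where
  continuous := continuous_adjKernel hK.continuous
  integrable := integrable_adjKernel hK.continuous hK.integrable
  bounded := bounded_adjKernel hK.bounded
  l2 f hf := by
    have := dual_bound hK.continuous hK.bounded hK.integrable
      (p := 2) (q := 2) (by constructor <;> norm_num) le_rfl hK.l2 hf
    norm_num at this ⊢
    exact this
  hormander y := by
    refine le_trans (le_of_eq ?_) (hK.hormander (-y))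
    have hm : MeasurableSet {x : V | 2 * ‖y‖ ≤ ‖x‖} :=
      measurableSet_le measurable_const measurable_norm
    rw [norm_neg, ← lintegral_indicator hm, ← lintegral_indicator hm, ← lintegral_neg_eq_self]
    refine lintegral_congr fun x => ?_
    by_cases h : 2 * ‖y‖ ≤ ‖x‖
    · rw [indicator_of_mem (by simpa using h), indicator_of_mem (by simpa using h), adjKernel,
        adjKernel, ← map_sub, ← ofReal_norm, LinearIsometryEquiv.norm_map, ofReal_norm]
      congr 3
      · abel_nf
      · abel_nf
    · rw [indicator_of_notMem (by simpa using h), indicator_of_notMem (by simpa using h)]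

end Duality

/-- `L^p` boundedness of Calderón–Zygmund operators, with explicit dependence on the kernel. -/
theorem exists_cz_bound (V : Type*) [NormedAddCommGroup V] [InnerProductSpace ℝ V]
    [FiniteDimensional ℝ V] [MeasurableSpace V] [BorelSpace V] [Nontrivial V] {p : ℝ} (hp : 1 < p) :
    ∃ C : ℝ≥0∞, C ≠ ∞ ∧ ∀ (E F : Type) [NormedAddCommGroup E] [InnerProductSpace ℂ E]
      [CompleteSpace E] [NormedAddCommGroup F] [InnerProductSpace ℂ F] [CompleteSpace F]
      (K : V → E →L[ℂ] F) (A B : ℝ≥0∞), IsCZKernel K A B → ∀ f : V → E, IsNice f →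
      eLpNorm (convOp K f) (ENNReal.ofReal p) volume ≤
        C * (A + B + 1) * eLpNorm f (ENNReal.ofReal p) volume := by
  have hp0 : 0 < p := by linarith
  -- it suffices to bound the `p`-th powers
  suffices h : ∃ C : ℝ≥0∞, C ≠ ∞ ∧ ∃ s : ℝ, 0 ≤ s ∧ s ≤ p ∧
      ∀ (E F : Type) [NormedAddCommGroup E] [InnerProductSpace ℂ E]
      [CompleteSpace E] [NormedAddCommGroup F] [InnerProductSpace ℂ F] [CompleteSpace F]
      (K : V → E →L[ℂ] F) (A B : ℝ≥0∞), IsCZKernel K A B → ∀ f : V → E, IsNice f →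
      ∫⁻ x, ‖convOp K f x‖ₑ ^ p ≤ (C * (A + B + 1)) ^ s * ∫⁻ x, ‖f x‖ₑ ^ p by
    obtain ⟨C, hC, s, hs0, hs, h⟩ := h
    refine ⟨C + 1, by simp [hC], ?_⟩
    intro E F _ _ _ _ _ _ K A B hK f hf
    rw [eLpNorm_eq_lintegral_rpow_enorm_toReal (by simpa using hp0) (by simp),
      eLpNorm_eq_lintegral_rpow_enorm_toReal (by simpa using hp0) (by simp),
      ENNReal.toReal_ofReal hp0.le]
    calc (∫⁻ x, ‖convOp K f x‖ₑ ^ p) ^ (1 / p)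
        ≤ ((C * (A + B + 1)) ^ s * ∫⁻ x, ‖f x‖ₑ ^ p) ^ (1 / p) :=
          ENNReal.rpow_le_rpow (h E F K A B hK f hf) (by positivity)
      _ = (C * (A + B + 1)) ^ (s * (1 / p)) * (∫⁻ x, ‖f x‖ₑ ^ p) ^ (1 / p) := by
          rw [ENNReal.mul_rpow_of_nonneg _ _ (by positivity), ← ENNReal.rpow_mul]
      _ ≤ ((C + 1) * (A + B + 1)) ^ (1 : ℝ) * (∫⁻ x, ‖f x‖ₑ ^ p) ^ (1 / p) := by
          refine mul_le_mul_left ?_ _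
          refine (ENNReal.rpow_le_rpow (z := s * (1 / p)) (mul_le_mul_left (le_self_add (b := 1)) _)
            (by positivity)).trans ?_
          refine ENNReal.rpow_le_rpow_of_exponent_le ?_ ?_
          · exact one_le_mul le_add_self le_add_self
          · rw [mul_one_div, div_le_one hp0]
            exact hs
      _ = _ := by rw [ENNReal.rpow_one]
  have hlt : ∀ q : ℝ, 1 < q → q < 2 → ∃ C : ℝ≥0∞, C ≠ ∞ ∧
      ∀ (E F : Type) [NormedAddCommGroup E] [InnerProductSpace ℂ E]
      [CompleteSpace E] [NormedAddCommGroup F] [InnerProductSpace ℂ F] [CompleteSpace F]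
      (K : V → E →L[ℂ] F) (A B : ℝ≥0∞), IsCZKernel K A B → ∀ f : V → E, IsNice f →
      ∫⁻ x, ‖convOp K f x‖ₑ ^ q ≤ (C * (A + B + 1)) * ∫⁻ x, ‖f x‖ₑ ^ q := by
    intro q hq hq2
    obtain ⟨c, hc, hc'⟩ := exists_lintegral_maximalFn_rpow_le (V := V) hq
    refine ⟨_, ?_, fun E F _ _ _ _ _ _ K A B hK f hf => cz_strong_lt_two hq hq2 hc' hK hf⟩
    refine ENNReal.mul_ne_top ?_ hc
    finiteness
  rcases lt_trichotomy p 2 with h2 | h2 | h2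
  · obtain ⟨C, hC, h⟩ := hlt p hp h2
    refine ⟨C, hC, 1, by norm_num, hp.le, fun E F _ _ _ _ _ _ K A B hK f hf => ?_⟩
    rw [ENNReal.rpow_one]
    exact h E F K A B hK f hf
  · refine ⟨1, by simp, 1, by norm_num, hp.le, fun E F _ _ _ _ _ _ K A B hK f hf => ?_⟩
    rw [ENNReal.rpow_one, one_mul, h2]
    exact (hK.l2 f hf).trans (mul_le_mul_left (le_add_right le_self_add) _)
  · have hpq := Real.HolderConjugate.conjExponent hp
    obtain ⟨C, hC, h⟩ := hlt p.conjExponent hpq.symm.lt (by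
      rw [Real.conjExponent, div_lt_iff₀ (by linarith)]
      linarith)
    refine ⟨C, hC, p - 1, by linarith, by linarith, fun E F _ _ _ _ _ _ K A B hK f hf => ?_⟩
    have := dual_bound hK.adj.continuous hK.adj.bounded hK.adj.integrable hpq h2.le
      (h F E _ A B hK.adj) hf
    rwa [adjKernel_adjKernel] at this

end CalderonZygmund

open scoped SchwartzMap

section SchwartzConvolution

variable {V : Type*} [NormedAddCommGroup V] [InnerProductSpace ℝ V] [FiniteDimensional ℝ V]
  [MeasurableSpace V] [BorelSpace V]

/-- Convolution of scalar Schwartz functions. -/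
noncomputable def sconv (k f : 𝓢(V, ℂ)) : 𝓢(V, ℂ) :=
  SchwartzMap.convolution (ContinuousLinearMap.mul ℂ ℂ) k f

lemma fourier_sconv (k f : 𝓢(V, ℂ)) (ξ : V) :
    (𝓕 (sconv k f) : 𝓢(V, ℂ)) ξ = (𝓕 k : 𝓢(V, ℂ)) ξ * (𝓕 f : 𝓢(V, ℂ)) ξ := by
  simp [sconv, SchwartzMap.fourier_convolution]

lemma sconv_apply (k f : 𝓢(V, ℂ)) (x : V) : sconv k f x = ∫ y, k (x - y) * f y := by
  rw [sconv, SchwartzMap.convolution_apply, convolution_def, ← integral_sub_left_eq_self _ _ x]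
  simp

lemma lintegral_fourier_sq (f : 𝓢(V, ℂ)) :
    ∫⁻ ξ, ‖(𝓕 f : 𝓢(V, ℂ)) ξ‖ₑ ^ 2 = ∫⁻ x, ‖f x‖ₑ ^ 2 := by
  have h : ∀ g : 𝓢(V, ℂ), ∫⁻ x, ‖g x‖ₑ ^ 2 = ENNReal.ofReal (∫ x, ‖g x‖ ^ 2) := by
    intro g
    rw [ofReal_integral_eq_lintegral_ofReal]
    · refine lintegral_congr fun x => ?_
      rw [← ofReal_norm, ENNReal.ofReal_pow (norm_nonneg _)]
    · exact (g.memLp 2).integrable_norm_pow (by norm_num)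
    · exact .of_forall fun x => by positivity
  rw [h, h, SchwartzMap.integral_norm_sq_fourier]

variable {ι : Type*} [Fintype ι]

lemma lintegral_sconv_family_sq {k : ι → 𝓢(V, ℂ)} {A : ℝ≥0∞}
    (hA : ∀ ξ, ∑ i, ‖(𝓕 (k i) : 𝓢(V, ℂ)) ξ‖ₑ ^ 2 ≤ A) (f : 𝓢(V, ℂ)) :
    ∫⁻ x, ∑ i, ‖sconv (k i) f x‖ₑ ^ 2 ≤ A * ∫⁻ x, ‖f x‖ₑ ^ 2 := by
  have hm : ∀ g : 𝓢(V, ℂ), Measurable fun x => ‖g x‖ₑ ^ 2 := fun g =>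
    (g.continuous.enorm.measurable.pow_const 2)
  rw [lintegral_finsetSum _ fun i _ => hm _]
  simp_rw [← lintegral_fourier_sq (sconv _ f)]
  rw [← lintegral_finsetSum _ fun i _ => hm _, ← lintegral_fourier_sq f,
    ← lintegral_const_mul _ (hm _)]
  refine lintegral_mono fun ξ => ?_
  simp_rw [fourier_sconv, enorm_mul, mul_pow]
  rw [← Finset.sum_mul]
  exact mul_le_mul_left (hA ξ) _

/-- The kernel of the vector-valued convolution operator with components `k i`. -/
noncomputable def familyKernel (k : ι → 𝓢(V, ℂ)) (x : V) : ℂ →L[ℂ] EuclideanSpace ℂ ι :=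
  ContinuousLinearMap.toSpanSingleton ℂ (WithLp.toLp 2 fun i => k i x)

lemma norm_toLp_le_sum (a : ι → ℂ) : ‖(WithLp.toLp 2 a : EuclideanSpace ℂ ι)‖ ≤ ∑ i, ‖a i‖ := by
  rw [EuclideanSpace.norm_eq]
  refine Real.sqrt_le_iff.2 ⟨Finset.sum_nonneg fun i _ => norm_nonneg _, ?_⟩
  exact Finset.sum_sq_le_sq_sum_of_nonneg fun i _ => norm_nonneg _

lemma familyKernel_sub (k : ι → 𝓢(V, ℂ)) (x y : V) :
    ‖familyKernel k x - familyKernel k y‖ ≤ ∑ i, ‖k i x - k i y‖ := by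
  have : familyKernel k x - familyKernel k y =
      ContinuousLinearMap.toSpanSingleton ℂ (WithLp.toLp 2 fun i => k i x - k i y) := by
    ext : 1
    simp only [familyKernel, sub_apply, ContinuousLinearMap.toSpanSingleton_apply, one_smul]
    rfl
  rw [this, ContinuousLinearMap.norm_toSpanSingleton]
  exact norm_toLp_le_sum _

lemma norm_familyKernel_le (k : ι → 𝓢(V, ℂ)) (x : V) : ‖familyKernel k x‖ ≤ ∑ i, ‖k i x‖ := by
  rw [familyKernel, ContinuousLinearMap.norm_toSpanSingleton]
  exact norm_toLp_le_sum _

lemma continuous_familyKernel (k : ι → 𝓢(V, ℂ)) : Continuous (familyKernel k) := by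
  refine (ContinuousLinearMap.toSpanSingletonCLE (𝕜 := ℂ)).continuous.comp ?_
  refine (PiLp.continuous_toLp 2 _).comp (continuous_pi fun i => (k i).continuous)

lemma bounded_familyKernel (k : ι → 𝓢(V, ℂ)) : ∃ M : ℝ, ∀ y, ‖familyKernel k y‖ ≤ M := by
  refine ⟨∑ i, SchwartzMap.seminorm ℝ 0 0 (k i), fun y => (norm_familyKernel_le k y).trans ?_⟩
  exact Finset.sum_le_sum fun i _ => SchwartzMap.norm_le_seminorm ℝ _ _

lemma convOp_familyKernel (k : ι → 𝓢(V, ℂ)) {f : V → ℂ} (hf : Integrable f) (x : V) (i : ι) :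
    convOp (familyKernel k) f x i = ∫ y, k i (x - y) * f y := by
  have h := integrable_kernel_apply (continuous_familyKernel k) (bounded_familyKernel k) hf x
  have := (EuclideanSpace.proj (𝕜 := ℂ) i).integral_comp_comm h
  rw [convOp]
  refine this.symm.trans (integral_congr_ae (.of_forall fun y => ?_))
  simp [familyKernel, mul_comm]

lemma enorm_sq_eq_sum (a : EuclideanSpace ℂ ι) : ‖a‖ₑ ^ 2 = ∑ i, ‖a i‖ₑ ^ 2 := by
  rw [← ofReal_norm, ← ENNReal.ofReal_pow (norm_nonneg _), EuclideanSpace.norm_sq_eq,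
    ENNReal.ofReal_sum_of_nonneg fun i _ => by positivity]
  simp_rw [ENNReal.ofReal_pow (norm_nonneg _), ofReal_norm]

lemma lintegral_convOp_familyKernel {k : ι → 𝓢(V, ℂ)} {A : ℝ≥0∞}
    (hA : ∀ ξ, ∑ i, ‖(𝓕 (k i) : 𝓢(V, ℂ)) ξ‖ₑ ^ 2 ≤ A) (hA' : A ≠ ∞) {f : V → ℂ}
    (hf : IsNice f) :
    ∫⁻ x, ‖convOp (familyKernel k) f x‖ₑ ^ 2 ≤ A * ∫⁻ x, ‖f x‖ₑ ^ 2 := by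
  have hsq : ∀ g : V → ℂ, ∫⁻ x, ‖g x‖ₑ ^ 2 = eLpNorm g 2 volume ^ 2 := by
    intro g
    rw [eLpNorm_eq_lintegral_rpow_enorm_toReal (by norm_num) (by norm_num), ← ENNReal.rpow_two,
      ← ENNReal.rpow_mul]
    simp
  have hf2 : MemLp f 2 := by
    obtain ⟨M, hM⟩ := hf.bounded
    refine (memLp_two_iff_integrable_sq_norm hf.stronglyMeasurable.aestronglyMeasurable).2 ?_
    refine (hf.integrable.norm.const_mul M).mono'
      (hf.stronglyMeasurable.norm.pow 2).aestronglyMeasurable (.of_forall fun x => ?_)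
    rw [Real.norm_of_nonneg (by positivity), pow_two]
    exact mul_le_mul_of_nonneg_right (hM x) (norm_nonneg _)
  have happ : ∀ n : ℕ, ∃ g : 𝓢(V, ℂ),
      eLpNorm (f - ⇑g) 2 volume ≤ ENNReal.ofReal (1 / (n + 1)) := by
    intro n
    obtain ⟨g, hg1, hg2, hg3⟩ := MemLp.exist_eLpNorm_sub_le (p := 2) (by norm_num) (by norm_num) hf2
      (ε := 1 / ((n : ℝ) + 1)) (by positivity)
    exact ⟨hg1.toSchwartzMap hg2, hg3⟩
  choose g hg using happ
  have hlim0 : Tendsto (fun n : ℕ => ENNReal.ofReal (1 / ((n : ℝ) + 1))) atTop (𝓝 0) := by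
    rw [← ENNReal.ofReal_zero]
    exact ENNReal.tendsto_ofReal tendsto_one_div_add_atTop_nhds_zero_nat
  have hpt : ∀ x i, Tendsto (fun n => sconv (k i) (g n) x) atTop
      (𝓝 (convOp (familyKernel k) f x i)) := by
    intro x i
    rw [tendsto_iff_edist_tendsto_0]
    have hk2 : eLpNorm (fun y => k i (x - y)) 2 volume ≠ ∞ := by
      have := ((k i).memLp 2 volume).comp_measurePreserving
        (Measure.measurePreserving_sub_left volume x)
      exact this.2.ne
    refine tendsto_of_tendsto_of_tendsto_of_le_of_le tendsto_const_nhds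
      (h := fun n : ℕ => eLpNorm (fun y => k i (x - y)) 2 volume * ENNReal.ofReal (1 / ((n : ℝ) + 1)))
      ?_ (fun _ => zero_le) (fun n => ?_)
    · simpa using ENNReal.Tendsto.const_mul hlim0 (Or.inr hk2)
    · have hkb : ∀ {h : V → ℂ}, Integrable h → Integrable fun y => k i (x - y) * h y := by
        intro h hh
        refine hh.bdd_mul (c := SchwartzMap.seminorm ℝ 0 0 (k i)) ?_ (.of_forall fun y => ?_)
        · exact ((k i).continuous.comp (continuous_const.sub continuous_id)).aestronglyMeasurable
        · exact SchwartzMap.norm_le_seminorm ℝ _ _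
      rw [edist_comm, convOp_familyKernel k hf.integrable, sconv_apply, edist_eq_enorm_sub,
        ← integral_sub (hkb hf.integrable) (hkb (g n).integrable)]
      simp_rw [← mul_sub]
      calc ‖∫ y, k i (x - y) * (f y - g n y)‖ₑ ≤ ∫⁻ y, ‖k i (x - y) * (f y - g n y)‖ₑ :=
            enorm_integral_le_lintegral_enorm _
        _ = eLpNorm ((fun y => k i (x - y)) • (f - ⇑(g n))) 1 volume := by
            rw [eLpNorm_one_eq_lintegral_enorm]
            rfl
        _ ≤ eLpNorm (fun y => k i (x - y)) 2 volume * eLpNorm (f - ⇑(g n)) 2 volume := by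
            refine eLpNorm_smul_le_mul_eLpNorm (hf2.1.sub (g n).continuous.aestronglyMeasurable)
              ((k i).continuous.comp (continuous_const.sub continuous_id)).aestronglyMeasurable
        _ ≤ _ := mul_le_mul_right (hg n) _
  calc ∫⁻ x, ‖convOp (familyKernel k) f x‖ₑ ^ 2
      = ∫⁻ x, liminf (fun n => ∑ i, ‖sconv (k i) (g n) x‖ₑ ^ 2) atTop := by
        refine lintegral_congr fun x => ?_
        rw [enorm_sq_eq_sum]
        refine (Tendsto.liminf_eq (tendsto_finsetSum _ fun i _ => ?_)).symm
        exact ((ENNReal.continuous_pow 2).tendsto _).comp (hpt x i).enorm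
    _ ≤ liminf (fun n => ∫⁻ x, ∑ i, ‖sconv (k i) (g n) x‖ₑ ^ 2) atTop :=
        lintegral_liminf_le fun n => Finset.measurable_sum _ fun i _ =>
          ((sconv (k i) (g n)).continuous.enorm.measurable.pow_const 2)
    _ ≤ liminf (fun n : ℕ => A * (eLpNorm f 2 volume + ENNReal.ofReal (1 / ((n : ℝ) + 1))) ^ 2)
          atTop := by
        refine liminf_le_liminf (.of_forall fun n => ?_)
        refine (lintegral_sconv_family_sq hA (g n)).trans (mul_le_mul_right ?_ _)
        rw [hsq]
        refine pow_le_pow_left' ?_ 2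
        have : (⇑(g n) : V → ℂ) = f - (f - ⇑(g n)) := by simp
        rw [this]
        refine (eLpNorm_sub_le hf2.1 (hf2.1.sub (g n).continuous.aestronglyMeasurable)
          (by norm_num)).trans (add_le_add le_rfl ?_)
        exact hg n
    _ = A * ∫⁻ x, ‖f x‖ₑ ^ 2 := by
        rw [hsq]
        refine Tendsto.liminf_eq ?_
        refine ENNReal.Tendsto.const_mul ?_ (Or.inr hA')
        refine ((ENNReal.continuous_pow 2).tendsto _).comp ?_
        simpa using tendsto_const_nhds.add hlim0

lemma isCZKernel_familyKernel {k : ι → 𝓢(V, ℂ)} {A B : ℝ≥0∞}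
    (hA : ∀ ξ, ∑ i, ‖(𝓕 (k i) : 𝓢(V, ℂ)) ξ‖ₑ ^ 2 ≤ A)
    (hA' : A ≠ ∞)
    (hB : ∀ y, ∫⁻ x in {x | 2 * ‖y‖ ≤ ‖x‖}, ∑ i, ‖k i (x - y) - k i x‖ₑ ≤ B) :
    IsCZKernel (familyKernel k) A B where
  continuous := continuous_familyKernel k
  integrable := (integrable_finsetSum _ fun i _ => (k i).integrable.norm).mono'
    (continuous_familyKernel k).aestronglyMeasurable (.of_forall (norm_familyKernel_le k))
  bounded := bounded_familyKernel k
  l2 f hf := by simpa using lintegral_convOp_familyKernel hA hA' hf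
  hormander y := by
    refine (lintegral_mono fun x => ?_).trans (hB y)
    simp_rw [← ofReal_norm]
    rw [← ENNReal.ofReal_sum_of_nonneg fun i _ => norm_nonneg _]
    exact ENNReal.ofReal_le_ofReal (familyKernel_sub k _ _)

lemma isNice_schwartz (f : 𝓢(V, ℂ)) : IsNice (f : V → ℂ) :=
  ⟨f.continuous.stronglyMeasurable, f.integrable, _, SchwartzMap.norm_le_seminorm ℝ f⟩

/-- Square function estimate for families of Schwartz kernels. -/
theorem exists_family_bound (V : Type*) [NormedAddCommGroup V] [InnerProductSpace ℝ V]
    [FiniteDimensional ℝ V] [MeasurableSpace V] [BorelSpace V] [Nontrivial V] {p : ℝ} (hp : 1 < p) :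
    ∃ C : ℝ≥0∞, C ≠ ∞ ∧ ∀ (ι : Type) [Fintype ι] (k : ι → 𝓢(V, ℂ)) (A B : ℝ≥0∞),
      (∀ ξ, ∑ i, ‖(𝓕 (k i) : 𝓢(V, ℂ)) ξ‖ₑ ^ 2 ≤ A) → A ≠ ∞ →
      (∀ y, ∫⁻ x in {x | 2 * ‖y‖ ≤ ‖x‖}, ∑ i, ‖k i (x - y) - k i x‖ₑ ≤ B) → ∀ f : 𝓢(V, ℂ),
      eLpNorm (fun x => √(∑ i, ‖sconv (k i) f x‖ ^ 2)) (ENNReal.ofReal p) volume ≤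
        C * (A + B + 1) * eLpNorm f (ENNReal.ofReal p) volume := by
  obtain ⟨C, hC, h⟩ := exists_cz_bound V hp
  refine ⟨C, hC, fun ι _ k A B hA hA' hB f => ?_⟩
  refine le_trans (le_of_eq ?_) (h _ _ _ A B (isCZKernel_familyKernel hA hA' hB) f (isNice_schwartz f))
  refine eLpNorm_congr_norm_ae (.of_forall fun x => ?_)
  rw [Real.norm_of_nonneg (Real.sqrt_nonneg _), EuclideanSpace.norm_eq]
  simp_rw [convOp_familyKernel k f.integrable, sconv_apply]

end SchwartzConvolution

/-- Dyadic sums of `min t t⁻¹` are uniformly bounded. -/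
lemma exists_sum_min_le : ∃ C : ℝ, 0 < C ∧ ∀ (J : Finset ℤ) (t : ℝ), 0 ≤ t →
    ∑ j ∈ J, min ((2 : ℝ) ^ j * t) ((2 : ℝ) ^ j * t)⁻¹ ≤ C := by
  have hs : Summable fun j : ℤ => ((1 : ℝ) / 2) ^ j.natAbs := by
    refine Summable.of_nat_of_neg ?_ ?_ <;>
    simpa using summable_geometric_of_lt_one (r := (2 : ℝ)⁻¹) (by norm_num) (by norm_num)
  refine ⟨2 * ∑' j : ℤ, ((1 : ℝ) / 2) ^ j.natAbs + 1, ?_, fun J t ht => ?_⟩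
  · have : 0 ≤ ∑' j : ℤ, ((1 : ℝ) / 2) ^ j.natAbs := tsum_nonneg fun j => by positivity
    positivity
  have hs0 : 0 ≤ ∑' j : ℤ, ((1 : ℝ) / 2) ^ j.natAbs := tsum_nonneg fun j => by positivity
  rcases ht.eq_or_lt with rfl | ht
  · simp only [mul_zero, inv_zero, min_self, Finset.sum_const_zero]; positivity
  obtain ⟨n, hn1, hn2⟩ := exists_mem_Ico_zpow ht (one_lt_two)
  have key : ∀ j : ℤ, min ((2 : ℝ) ^ j * t) ((2 : ℝ) ^ j * t)⁻¹ ≤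
      2 * ((1 : ℝ) / 2) ^ (j + n).natAbs := by
    intro j
    rcases le_or_gt 0 (j + n) with h | h
    · refine (min_le_right _ _).trans ?_
      have e : ((1 : ℝ) / 2) ^ (j + n).natAbs = ((2 : ℝ) ^ (j + n))⁻¹ := by
        rw [one_div, inv_pow, ← zpow_natCast, Int.natAbs_of_nonneg h]
      rw [e]
      have h3 : (2 : ℝ) ^ (j + n) ≤ 2 ^ j * t := by
        rw [zpow_add₀ two_ne_zero]
        exact mul_le_mul_of_nonneg_left hn1 (by positivity)
      have h4 := inv_anti₀ (by positivity) h3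
      have : 0 ≤ ((2 : ℝ) ^ (j + n))⁻¹ := by positivity
      linarith
    · refine (min_le_left _ _).trans ?_
      have e : ((1 : ℝ) / 2) ^ (j + n).natAbs = (2 : ℝ) ^ (j + n) := by
        rw [one_div, inv_pow, ← zpow_natCast, Int.ofNat_natAbs_of_nonpos h.le, zpow_neg, inv_inv]
      rw [e]
      calc (2 : ℝ) ^ j * t ≤ 2 ^ j * 2 ^ (n + 1) := by gcongr
        _ = _ := by rw [zpow_add₀ two_ne_zero, zpow_add₀ two_ne_zero]; ring
  have hs' : Summable fun j : ℤ => ((1 : ℝ) / 2) ^ (j + n).natAbs :=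
    hs.comp_injective (add_left_injective n)
  calc ∑ j ∈ J, min ((2 : ℝ) ^ j * t) ((2 : ℝ) ^ j * t)⁻¹
      ≤ ∑ j ∈ J, 2 * ((1 : ℝ) / 2) ^ (j + n).natAbs := Finset.sum_le_sum fun j _ => key j
    _ = 2 * ∑ j ∈ J, ((1 : ℝ) / 2) ^ (j + n).natAbs := (Finset.mul_sum _ _ _).symm
    _ ≤ 2 * ∑' j : ℤ, ((1 : ℝ) / 2) ^ (j + n).natAbs := by
        gcongr
        exact hs'.sum_le_tsum J fun _ _ => by positivity
    _ = 2 * ∑' j : ℤ, ((1 : ℝ) / 2) ^ j.natAbs := by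
        rw [← (Equiv.addRight n).tsum_eq fun j : ℤ => ((1 : ℝ) / 2) ^ j.natAbs]
        simp only [Equiv.coe_addRight]
    _ ≤ _ := by linarith

section DyadicKernel

variable {V : Type*} [NormedAddCommGroup V] [InnerProductSpace ℝ V] [FiniteDimensional ℝ V]
  [MeasurableSpace V] [BorelSpace V]

/-- The kernel `x ↦ 2 ^ (j d) κ (2 ^ j x + u)`. -/
noncomputable def lpKernel (κ : 𝓢(V, ℂ)) (j : ℤ) (u : V) : 𝓢(V, ℂ) :=
  (((2 : ℝ) ^ j) ^ finrank ℝ V : ℝ) •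
    SchwartzMap.compCLMOfContinuousLinearEquiv ℂ
      (ContinuousLinearEquiv.smulLeft (R₁ := ℝ) (Units.mk0 ((2 : ℝ) ^ j) (by positivity)))
      (SchwartzMap.compSubConstCLM ℂ (-u) κ)

lemma lpKernel_apply (κ : 𝓢(V, ℂ)) (j : ℤ) (u x : V) :
    lpKernel κ j u x = (((2 : ℝ) ^ j) ^ finrank ℝ V : ℝ) • κ ((2 : ℝ) ^ j • x + u) := by
  simp [lpKernel, Units.smul_def]

lemma fourier_lpKernel (κ : 𝓢(V, ℂ)) (j : ℤ) (u ξ : V) :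
    (𝓕 (lpKernel κ j u) : 𝓢(V, ℂ)) ξ =
      Real.fourierChar ⟪u, (2 : ℝ) ^ (-j) • ξ⟫_ℝ * (𝓕 κ : 𝓢(V, ℂ)) ((2 : ℝ) ^ (-j) • ξ) := by
  have h2 : (0 : ℝ) < 2 ^ j := by positivity
  rw [SchwartzMap.fourier_coe, SchwartzMap.fourier_coe, Real.fourier_eq, Real.fourier_eq]
  simp_rw [lpKernel_apply]
  set ζ := (2 : ℝ) ^ (-j) • ξ with hζ
  have e1 : ∀ x : V, ⟪x, ξ⟫_ℝ = ⟪(2 : ℝ) ^ j • x, ζ⟫_ℝ := by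
    intro x
    rw [hζ, inner_smul_left, inner_smul_right, zpow_neg]
    simp only [conj_trivial]
    field_simp
  simp_rw [e1]
  have e2 := Measure.integral_comp_smul (volume : Measure V)
    (fun x => Real.fourierChar (-⟪x, ζ⟫_ℝ) • (((2 : ℝ) ^ j) ^ finrank ℝ V : ℝ) • κ (x + u)) (2 ^ j)
  rw [e2, abs_of_pos (by positivity)]
  have e3 : ∀ x : V, Real.fourierChar (-⟪x, ζ⟫_ℝ) • (((2 : ℝ) ^ j) ^ finrank ℝ V : ℝ) • κ (x + u) =
    (((2 : ℝ) ^ j) ^ finrank ℝ V : ℝ) • (Real.fourierChar ⟪u, ζ⟫_ℝ *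
      (fun y => Real.fourierChar (-⟪y, ζ⟫_ℝ) • κ y) (x + u)) := by
    intro x
    simp only [inner_add_left, neg_add, AddChar.map_add_eq_mul, Circle.smul_def, Circle.coe_mul,
      AddChar.map_neg_eq_inv, Circle.coe_inv, smul_eq_mul, Complex.real_smul]
    have := Circle.coe_ne_zero (Real.fourierChar ⟪u, ζ⟫_ℝ)
    field_simp
  simp_rw [e3]
  rw [integral_smul, integral_const_mul, integral_add_right_eq_self
    (fun y => Real.fourierChar (-⟪y, ζ⟫_ℝ) • κ y), smul_smul, inv_mul_cancel₀ (by positivity),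
    one_smul]

end DyadicKernel

section Hormander

variable {V : Type*} [NormedAddCommGroup V] [InnerProductSpace ℝ V] [FiniteDimensional ℝ V]
  [MeasurableSpace V] [BorelSpace V]

lemma exists_one_add_norm_pow_mul_le (κ : 𝓢(V, ℂ)) (k n : ℕ) :
    ∃ C : ℝ, 0 ≤ C ∧ ∀ x, (1 + ‖x‖) ^ k * ‖iteratedFDeriv ℝ n κ x‖ ≤ C :=
  ⟨_, by positivity, fun x => SchwartzMap.one_add_le_sup_seminorm_apply (𝕜 := ℝ) (m := (k, n))
    le_rfl le_rfl κ x⟩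

lemma exists_norm_sub_le (κ : 𝓢(V, ℂ)) (k : ℕ) :
    ∃ C : ℝ, 0 ≤ C ∧ ∀ w z, ‖z‖ ≤ 1 → ‖κ (w - z) - κ w‖ ≤ C * ((1 + ‖w‖) ^ k)⁻¹ * ‖z‖ := by
  obtain ⟨D, hD0, hD⟩ := exists_one_add_norm_pow_mul_le κ k 1
  refine ⟨2 ^ k * D, by positivity, fun w z hz => ?_⟩
  have hb : ∀ v ∈ closedBall w 1, ‖fderiv ℝ κ v‖ ≤ 2 ^ k * D * ((1 + ‖w‖) ^ k)⁻¹ := by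
    intro v hv
    have h1 := hD v
    rw [norm_iteratedFDeriv_one] at h1
    rw [← div_eq_mul_inv, le_div_iff₀ (by positivity)]
    have h2 : 1 + ‖w‖ ≤ 2 * (1 + ‖v‖) := by
      have : ‖w‖ ≤ ‖v‖ + ‖v - w‖ := by
        have := norm_sub_le v (v - w); simpa using this
      have h3 : ‖v - w‖ ≤ 1 := by simpa [dist_eq_norm] using hv
      have := norm_nonneg v
      linarith
    calc ‖fderiv ℝ κ v‖ * (1 + ‖w‖) ^ k ≤ ‖fderiv ℝ κ v‖ * (2 * (1 + ‖v‖)) ^ k := by gcongr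
      _ = 2 ^ k * ((1 + ‖v‖) ^ k * ‖fderiv ℝ κ v‖) := by rw [mul_pow]; ring
      _ ≤ _ := by gcongr
  have := (convex_closedBall w 1).norm_image_sub_le_of_norm_fderiv_le (𝕜 := ℝ) (f := κ)
    (fun x _ => κ.differentiableAt) hb (mem_closedBall_self zero_le_one)
    (show w - z ∈ closedBall w 1 by simpa [dist_eq_norm] using hz)
  simpa using this

lemma exists_lintegral_sub_le (κ : 𝓢(V, ℂ)) : ∃ C : ℝ≥0∞, C ≠ ∞ ∧ ∀ z,
    ∫⁻ w, ‖κ (w - z) - κ w‖ₑ ≤ C * ‖z‖ₑ := by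
  obtain ⟨D, hD0, hD⟩ := exists_norm_sub_le κ (finrank ℝ V + 1)
  have hint : Integrable fun w : V => ((1 + ‖w‖) ^ (finrank ℝ V + 1))⁻¹ := by
    have := integrable_one_add_norm (E := V) (μ := volume) (r := (finrank ℝ V + 1 : ℕ))
      (by push_cast; linarith)
    refine this.congr (.of_forall fun w => ?_)
    simp only
    rw [Real.rpow_neg (by positivity), Real.rpow_natCast]
  set I := ∫⁻ w : V, ‖D * ((1 + ‖w‖) ^ (finrank ℝ V + 1))⁻¹‖ₑ with hI
  have hIt : I ≠ ∞ := (hint.const_mul D).2.ne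
  set N := ∫⁻ w, ‖κ w‖ₑ with hN
  have hNt : N ≠ ∞ := κ.integrable.2.ne
  refine ⟨I + 2 * N, by finiteness, fun z => ?_⟩
  rcases le_or_gt ‖z‖ 1 with hz | hz
  · calc ∫⁻ w, ‖κ (w - z) - κ w‖ₑ ≤ ∫⁻ w, ‖D * ((1 + ‖w‖) ^ (finrank ℝ V + 1))⁻¹‖ₑ * ‖z‖ₑ := by
          refine lintegral_mono fun w => ?_
          rw [← enorm_norm z, ← enorm_mul]
          refine enorm_le_iff_norm_le.2 ((hD w z hz).trans (Real.le_norm_self _))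
      _ = I * ‖z‖ₑ := lintegral_mul_const _ (by fun_prop)
      _ ≤ _ := mul_le_mul_left le_self_add _
  · have hz' : 1 ≤ ‖z‖ₑ := by
      rw [← ofReal_norm]; exact ENNReal.one_le_ofReal.2 hz.le
    calc ∫⁻ w, ‖κ (w - z) - κ w‖ₑ ≤ ∫⁻ w, (‖κ (w - z)‖ₑ + ‖κ w‖ₑ) :=
          lintegral_mono fun w => enorm_sub_le
      _ = N + N := by
          rw [lintegral_add_right _ κ.continuous.enorm.measurable,
            lintegral_sub_right_eq_self (fun w => ‖κ w‖ₑ)]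
      _ = 2 * N := (two_mul _).symm
      _ ≤ (I + 2 * N) * 1 := by rw [mul_one]; exact le_add_self
      _ ≤ _ := mul_le_mul_right hz' _

lemma setLIntegral_sub_le_decay (κ : 𝓢(V, ℂ)) (u z : V) :
    ∫⁻ x in {x | 2 * ‖z‖ ≤ ‖x‖}, ‖κ (x - z + u) - κ (x + u)‖ₑ ≤
      2 * ((∫⁻ w, ‖κ w‖ₑ) + (∫⁻ w, ‖w‖ₑ * ‖κ w‖ₑ)) * (1 + ‖u‖ₑ) * ‖‖z‖⁻¹‖ₑ := by
  rcases eq_or_ne z 0 with rfl | hz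
  · simp
  have hz' : 0 < ‖z‖ := norm_pos_iff.2 hz
  set G : V → ℝ≥0∞ := fun w => ‖‖z‖⁻¹‖ₑ * ((‖w‖ₑ + ‖u‖ₑ) * ‖κ w‖ₑ) with hG
  have hGm : Measurable G := by fun_prop
  have hpt : ∀ v : V, ‖z‖ ≤ ‖v‖ → ‖κ (v + u)‖ₑ ≤ G (v + u) := by
    intro v hv
    have h1 : 1 ≤ ‖‖z‖⁻¹‖ₑ * ‖v‖ₑ := by
      rw [← enorm_norm v, ← enorm_mul, ← ofReal_norm]
      refine ENNReal.one_le_ofReal.2 ?_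
      rw [norm_mul, norm_inv, norm_norm, norm_norm, ← div_eq_inv_mul]
      exact (one_le_div hz').2 hv
    have h2 : ‖v‖ₑ ≤ ‖v + u‖ₑ + ‖u‖ₑ := by
      have := enorm_sub_le (a := v + u) (b := u)
      simpa using this
    calc ‖κ (v + u)‖ₑ = 1 * ‖κ (v + u)‖ₑ := (one_mul _).symm
      _ ≤ (‖‖z‖⁻¹‖ₑ * (‖v + u‖ₑ + ‖u‖ₑ)) * ‖κ (v + u)‖ₑ := by
          refine mul_le_mul_left (h1.trans (mul_le_mul_right h2 _)) _
      _ = _ := by rw [hG, mul_assoc]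
  calc ∫⁻ x in {x | 2 * ‖z‖ ≤ ‖x‖}, ‖κ (x - z + u) - κ (x + u)‖ₑ
      ≤ ∫⁻ x in {x | 2 * ‖z‖ ≤ ‖x‖}, (G (x - z + u) + G (x + u)) := by
        refine setLIntegral_mono (by fun_prop) fun x hx => ?_
        have hx : 2 * ‖z‖ ≤ ‖x‖ := by simpa using hx
        refine enorm_sub_le.trans (add_le_add (hpt _ ?_) (hpt _ ?_))
        · have := norm_sub_norm_le x z
          linarith
        · linarith
    _ ≤ ∫⁻ x, (G (x - z + u) + G (x + u)) := setLIntegral_le_lintegral _ _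
    _ = (∫⁻ x, G x) + ∫⁻ x, G x := by
        rw [lintegral_add_right _ (by fun_prop), lintegral_add_right_eq_self G]
        simp_rw [sub_add]
        rw [lintegral_sub_right_eq_self G]
    _ = 2 * ∫⁻ x, G x := (two_mul _).symm
    _ = 2 * (‖‖z‖⁻¹‖ₑ * ((∫⁻ w, ‖w‖ₑ * ‖κ w‖ₑ) + ‖u‖ₑ * ∫⁻ w, ‖κ w‖ₑ)) := by
        rw [hG, lintegral_const_mul _ (by fun_prop)]
        simp_rw [add_mul]
        rw [lintegral_add_right _ (by fun_prop), lintegral_const_mul _ (by fun_prop)]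
    _ ≤ 2 * (‖‖z‖⁻¹‖ₑ * (((∫⁻ w, ‖κ w‖ₑ) + (∫⁻ w, ‖w‖ₑ * ‖κ w‖ₑ)) * (1 + ‖u‖ₑ))) := by
        refine mul_le_mul_right (mul_le_mul_right ?_ _) _
        set N0 := ∫⁻ w, ‖κ w‖ₑ
        set N1 := ∫⁻ w, ‖w‖ₑ * ‖κ w‖ₑ
        have : (N0 + N1) * (1 + ‖u‖ₑ) = (N1 + ‖u‖ₑ * N0) + (N0 + N1 * ‖u‖ₑ) := by ring
        rw [this]
        exact le_self_add
    _ = _ := by ring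

lemma exists_hormander_scale (κ : 𝓢(V, ℂ)) : ∃ C : ℝ≥0∞, C ≠ ∞ ∧ ∀ u z,
    ∫⁻ x in {x | 2 * ‖z‖ ≤ ‖x‖}, ‖κ (x - z + u) - κ (x + u)‖ₑ ≤
      C * (1 + ‖u‖ₑ) * ENNReal.ofReal (min ‖z‖ ‖z‖⁻¹) := by
  obtain ⟨C, hC, h⟩ := exists_lintegral_sub_le κ
  have h0 : ∫⁻ w, ‖κ w‖ₑ ≠ ∞ := κ.integrable.2.ne
  have h1 : ∫⁻ w, ‖w‖ₑ * ‖κ w‖ₑ ≠ ∞ := by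
    have := (SchwartzMap.integrable_pow_mul volume κ 1).2.ne
    simpa [enorm_mul] using this
  refine ⟨C + 2 * ((∫⁻ w, ‖κ w‖ₑ) + (∫⁻ w, ‖w‖ₑ * ‖κ w‖ₑ)), by finiteness, fun u z => ?_⟩
  rcases min_choice ‖z‖ ‖z‖⁻¹ with e | e
  · rw [e, ofReal_norm]
    calc _ ≤ ∫⁻ x, ‖κ (x - z + u) - κ (x + u)‖ₑ := setLIntegral_le_lintegral _ _
      _ = ∫⁻ w, ‖κ (w - z) - κ w‖ₑ := by
          rw [← lintegral_add_right_eq_self (fun w => ‖κ (w - z) - κ w‖ₑ) u]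
          refine lintegral_congr fun x => ?_
          rw [add_sub_right_comm]
      _ ≤ C * 1 * ‖z‖ₑ := by simpa using h z
      _ ≤ _ := mul_le_mul_left (mul_le_mul' le_self_add le_self_add) _
  · rw [e]
    refine (setLIntegral_sub_le_decay κ u z).trans ?_
    rw [Real.enorm_of_nonneg (by positivity)]
    exact mul_le_mul_left (mul_le_mul_left le_add_self _) _

lemma lintegral_comp_smul_pos (F : V → ℝ≥0∞) {R : ℝ} (hR : 0 < R) :
    ∫⁻ x, F (R • x) = ENNReal.ofReal ((R ^ finrank ℝ V)⁻¹) * ∫⁻ x, F x := by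
  have e := Measure.map_addHaar_smul (volume : Measure V) hR.ne'
  rw [abs_of_pos (by positivity)] at e
  rw [← smul_eq_mul, ← lintegral_smul_measure, ← e, MeasurableEmbedding.lintegral_map]
  exact (Homeomorph.smulOfNeZero R hR.ne').measurableEmbedding

lemma exists_hormander_sum (κ : 𝓢(V, ℂ)) : ∃ C : ℝ≥0∞, C ≠ ∞ ∧ ∀ (u : V) (J : Finset ℤ) (y : V),
    ∫⁻ x in {x | 2 * ‖y‖ ≤ ‖x‖}, ∑ j ∈ J, ‖lpKernel κ j u (x - y) - lpKernel κ j u x‖ₑ ≤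
      C * (1 + ‖u‖ₑ) := by
  obtain ⟨C, hC, h⟩ := exists_hormander_scale κ
  obtain ⟨S, hS0, hS⟩ := exists_sum_min_le
  refine ⟨C * ENNReal.ofReal S, by finiteness, fun u J y => ?_⟩
  have hms : ∀ y : V, MeasurableSet {x : V | 2 * ‖y‖ ≤ ‖x‖} := fun y =>
    measurableSet_le (by fun_prop) (by fun_prop)
  have hterm : ∀ j : ℤ, ∫⁻ x in {x | 2 * ‖y‖ ≤ ‖x‖}, ‖lpKernel κ j u (x - y) - lpKernel κ j u x‖ₑ ≤
      C * (1 + ‖u‖ₑ) * ENNReal.ofReal (min ((2 : ℝ) ^ j * ‖y‖) ((2 : ℝ) ^ j * ‖y‖)⁻¹) := by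
    intro j
    have h2 : (0 : ℝ) < 2 ^ j := by positivity
    have h3 := h u ((2 : ℝ) ^ j • y)
    rw [norm_smul, Real.norm_of_nonneg h2.le] at h3
    refine le_trans (le_of_eq ?_) h3
    rw [← lintegral_indicator (hms _), ← lintegral_indicator]
    swap
    · exact measurableSet_le (by fun_prop) (by fun_prop)
    set F := ({x : V | 2 * ((2 : ℝ) ^ j * ‖y‖) ≤ ‖x‖}).indicator
      fun x => ‖κ (x - (2 : ℝ) ^ j • y + u) - κ (x + u)‖ₑ with hF
    have h4 : ∀ x, ({x : V | 2 * ‖y‖ ≤ ‖x‖}).indicator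
        (fun x => ‖lpKernel κ j u (x - y) - lpKernel κ j u x‖ₑ) x =
        ENNReal.ofReal (((2 : ℝ) ^ j) ^ finrank ℝ V) * F ((2 : ℝ) ^ j • x) := by
      intro x
      have hiff : x ∈ {x : V | 2 * ‖y‖ ≤ ‖x‖} ↔
          (2 : ℝ) ^ j • x ∈ {x : V | 2 * ((2 : ℝ) ^ j * ‖y‖) ≤ ‖x‖} := by
        simp only [mem_ofPred_eq, norm_smul, Real.norm_of_nonneg h2.le]
        rw [show 2 * ((2 : ℝ) ^ j * ‖y‖) = 2 ^ j * (2 * ‖y‖) by ring, mul_le_mul_iff_right₀ h2]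
      by_cases hx : x ∈ {x : V | 2 * ‖y‖ ≤ ‖x‖}
      · rw [indicator_of_mem hx, hF, indicator_of_mem (hiff.1 hx), lpKernel_apply, lpKernel_apply,
          ← smul_sub, enorm_smul, Real.enorm_of_nonneg (by positivity), smul_sub]
      · rw [indicator_of_notMem hx, hF, indicator_of_notMem (hiff.not.1 hx), mul_zero]
    simp_rw [h4]
    rw [lintegral_const_mul' _ _ ENNReal.ofReal_ne_top, lintegral_comp_smul_pos F h2, ← mul_assoc,
      ← ENNReal.ofReal_mul (by positivity), mul_inv_cancel₀ (by positivity), ENNReal.ofReal_one,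
      one_mul]
  rw [lintegral_finsetSum]
  swap
  · intro j _
    exact (((lpKernel κ j u).continuous.comp (by fun_prop)).sub
      (lpKernel κ j u).continuous).enorm.measurable
  calc _ ≤ ∑ j ∈ J, C * (1 + ‖u‖ₑ) *
        ENNReal.ofReal (min ((2 : ℝ) ^ j * ‖y‖) ((2 : ℝ) ^ j * ‖y‖)⁻¹) :=
        Finset.sum_le_sum fun j _ => hterm j
    _ = C * (1 + ‖u‖ₑ) * ENNReal.ofReal
        (∑ j ∈ J, min ((2 : ℝ) ^ j * ‖y‖) ((2 : ℝ) ^ j * ‖y‖)⁻¹) := by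
        rw [← Finset.mul_sum, ENNReal.ofReal_sum_of_nonneg fun j _ => by positivity]
    _ ≤ C * (1 + ‖u‖ₑ) * ENNReal.ofReal S :=
        mul_le_mul_right (ENNReal.ofReal_le_ofReal (hS J _ (norm_nonneg _))) _
    _ = _ := by ring

end Hormander

section LittlewoodPaley

variable {V : Type*} [NormedAddCommGroup V] [InnerProductSpace ℝ V] [FiniteDimensional ℝ V]
  [MeasurableSpace V] [BorelSpace V]

lemma exists_norm_le_min (ψ : 𝓢(V, ℂ)) (h0 : ψ 0 = 0) :
    ∃ C : ℝ, 0 ≤ C ∧ ∀ z, ‖ψ z‖ ≤ C * min ‖z‖ ‖z‖⁻¹ := by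
  obtain ⟨D, hD0, hD⟩ := exists_norm_sub_le ψ 0
  set C0 := SchwartzMap.seminorm ℝ 0 0 ψ
  set C1 := SchwartzMap.seminorm ℝ 1 0 ψ
  have hC0 : 0 ≤ C0 := apply_nonneg _ _
  have hC1 : 0 ≤ C1 := apply_nonneg _ _
  refine ⟨D + C0 + C1, by positivity, fun z => ?_⟩
  rcases eq_or_ne z 0 with rfl | hz
  · simp [h0]
  have hz' : 0 < ‖z‖ := norm_pos_iff.2 hz
  rcases min_choice ‖z‖ ‖z‖⁻¹ with e | e
  · rw [e]
    rcases le_or_gt ‖z‖ 1 with h | h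
    · have := hD z z h
      rw [sub_self, h0, zero_sub, norm_neg, pow_zero, inv_one, mul_one] at this
      exact this.trans (by gcongr; linarith)
    · calc ‖ψ z‖ ≤ C0 * 1 := by rw [mul_one]; exact SchwartzMap.norm_le_seminorm ℝ ψ z
        _ ≤ (D + C0 + C1) * ‖z‖ := by gcongr; linarith
  · rw [e, ← div_eq_mul_inv, le_div_iff₀ hz', mul_comm]
    have := SchwartzMap.norm_pow_mul_le_seminorm ℝ ψ 1 z
    rw [pow_one] at this
    exact this.trans (by linarith)

lemma norm_fourier_lpKernel (κ : 𝓢(V, ℂ)) (j : ℤ) (u ξ : V) :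
    ‖(𝓕 (lpKernel κ j u) : 𝓢(V, ℂ)) ξ‖ = ‖(𝓕 κ : 𝓢(V, ℂ)) ((2 : ℝ) ^ (-j) • ξ)‖ := by
  rw [fourier_lpKernel, norm_mul, Circle.norm_coe, one_mul]

lemma exists_sum_norm_fourier_le (κ : 𝓢(V, ℂ)) (h0 : (𝓕 κ : 𝓢(V, ℂ)) 0 = 0) :
    ∃ C : ℝ, 0 ≤ C ∧ ∀ (J : Finset ℤ) (u ξ : V),
      ∑ j ∈ J, ‖(𝓕 (lpKernel κ j u) : 𝓢(V, ℂ)) ξ‖ ≤ C := by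
  obtain ⟨D, hD0, hD⟩ := exists_norm_le_min _ h0
  obtain ⟨S, hS0, hS⟩ := exists_sum_min_le
  refine ⟨D * S, by positivity, fun J u ξ => ?_⟩
  calc ∑ j ∈ J, ‖(𝓕 (lpKernel κ j u) : 𝓢(V, ℂ)) ξ‖
      ≤ ∑ j ∈ J, D * min ((2 : ℝ) ^ j * ‖ξ‖⁻¹) ((2 : ℝ) ^ j * ‖ξ‖⁻¹)⁻¹ := by
        refine Finset.sum_le_sum fun j _ => ?_
        rw [norm_fourier_lpKernel]
        refine (hD _).trans (le_of_eq ?_)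
        rw [norm_smul, Real.norm_of_nonneg (by positivity), min_comm, zpow_neg, mul_inv, inv_inv,
          mul_inv, inv_inv]
    _ = D * ∑ j ∈ J, min ((2 : ℝ) ^ j * ‖ξ‖⁻¹) ((2 : ℝ) ^ j * ‖ξ‖⁻¹)⁻¹ := by rw [Finset.mul_sum]
    _ ≤ D * S := by gcongr; exact hS J _ (by positivity)

variable [Nontrivial V]

/-- Littlewood–Paley square function estimate, with translation parameter `u`. -/
theorem exists_square_bound (κ : 𝓢(V, ℂ)) (h0 : (𝓕 κ : 𝓢(V, ℂ)) 0 = 0) {p : ℝ} (hp : 1 < p) :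
    ∃ C : ℝ≥0∞, C ≠ ∞ ∧ ∀ (u : V) (J : Finset ℤ) (f : 𝓢(V, ℂ)),
      eLpNorm (fun x => √(∑ j ∈ J, ‖sconv (lpKernel κ j u) f x‖ ^ 2)) (ENNReal.ofReal p) volume ≤
        C * (1 + ‖u‖ₑ) * eLpNorm f (ENNReal.ofReal p) volume := by
  obtain ⟨C, hC, h⟩ := exists_family_bound V hp
  obtain ⟨A, hA0, hA⟩ := exists_sum_norm_fourier_le κ h0
  obtain ⟨B, hB, hB'⟩ := exists_hormander_sum κ
  refine ⟨C * (ENNReal.ofReal (A ^ 2) + B + 1), by finiteness, fun u J f => ?_⟩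
  have := h J (fun j => lpKernel κ j u) (ENNReal.ofReal (A ^ 2)) (B * (1 + ‖u‖ₑ)) ?_
    ENNReal.ofReal_ne_top ?_ f
  · rw [show (fun x => √(∑ j ∈ J, ‖sconv (lpKernel κ j u) f x‖ ^ 2)) = fun x =>
      √(∑ j : J, ‖sconv (lpKernel κ j u) f x‖ ^ 2) from funext fun x => by
        rw [Finset.sum_coe_sort J fun j => ‖sconv (lpKernel κ j u) f x‖ ^ 2]]
    refine this.trans (mul_le_mul_left ?_ _)
    rw [mul_assoc]
    refine mul_le_mul_right ?_ _
    calc ENNReal.ofReal (A ^ 2) + B * (1 + ‖u‖ₑ) + 1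
        ≤ ENNReal.ofReal (A ^ 2) * (1 + ‖u‖ₑ) + B * (1 + ‖u‖ₑ) + 1 * (1 + ‖u‖ₑ) := by
          gcongr
          · exact le_mul_of_one_le_right' le_self_add
          · simp
      _ = _ := by ring
  · intro ξ
    rw [Finset.sum_coe_sort J fun j => ‖(𝓕 (lpKernel κ j u) : 𝓢(V, ℂ)) ξ‖ₑ ^ 2]
    simp_rw [← ofReal_norm, ← ENNReal.ofReal_pow (norm_nonneg _)]
    rw [← ENNReal.ofReal_sum_of_nonneg fun j _ => by positivity]
    refine ENNReal.ofReal_le_ofReal ?_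
    refine (Finset.sum_sq_le_sq_sum_of_nonneg fun j _ => norm_nonneg _).trans ?_
    exact pow_le_pow_left₀ (Finset.sum_nonneg fun j _ => norm_nonneg _) (hA J u ξ) 2
  · intro y
    refine (lintegral_mono fun x => ?_).trans (hB' u J y)
    exact (Finset.sum_coe_sort J fun j => ‖lpKernel κ j u (x - y) - lpKernel κ j u x‖ₑ).le

lemma sconv_sum {ι : Type*} (J : Finset ι) (k : ι → 𝓢(V, ℂ)) (f : 𝓢(V, ℂ)) (x : V) :
    sconv (∑ j ∈ J, k j) f x = ∑ j ∈ J, sconv (k j) f x := by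
  simp_rw [sconv_apply]
  rw [← integral_finsetSum]
  · refine integral_congr_ae (.of_forall fun y => ?_)
    simp only [sum_apply, Finset.sum_mul]
  · intro j _
    refine f.integrable.bdd_mul (c := SchwartzMap.seminorm ℝ 0 0 (k j)) ?_ (.of_forall fun y => ?_)
    · exact ((k j).continuous.comp (continuous_const.sub continuous_id)).aestronglyMeasurable
    · exact SchwartzMap.norm_le_seminorm ℝ _ _

theorem exists_sum_bound (κ : 𝓢(V, ℂ)) (h0 : (𝓕 κ : 𝓢(V, ℂ)) 0 = 0) {p : ℝ} (hp : 1 < p) :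
    ∃ C : ℝ≥0∞, C ≠ ∞ ∧ ∀ (u : V) (J : Finset ℤ) (f : 𝓢(V, ℂ)),
      eLpNorm (fun x => ∑ j ∈ J, sconv (lpKernel κ j u) f x) (ENNReal.ofReal p) volume ≤
        C * (1 + ‖u‖ₑ) * eLpNorm f (ENNReal.ofReal p) volume := by
  obtain ⟨C, hC, h⟩ := exists_family_bound V hp
  obtain ⟨A, hA0, hA⟩ := exists_sum_norm_fourier_le κ h0
  obtain ⟨B, hB, hB'⟩ := exists_hormander_sum κ
  refine ⟨C * (ENNReal.ofReal (A ^ 2) + B + 1), by finiteness, fun u J f => ?_⟩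
  have := h Unit (fun _ => ∑ j ∈ J, lpKernel κ j u) (ENNReal.ofReal (A ^ 2)) (B * (1 + ‖u‖ₑ)) ?_
    ENNReal.ofReal_ne_top ?_ f
  · refine le_trans (le_of_eq ?_) (this.trans (mul_le_mul_left ?_ _))
    · refine eLpNorm_congr_norm_ae (.of_forall fun x => ?_)
      simp only [Finset.univ_unique, Finset.sum_const, Finset.card_singleton, one_smul,
        Real.sqrt_sq (norm_nonneg _), sconv_sum, norm_norm]
    rw [mul_assoc]
    refine mul_le_mul_right ?_ _
    calc ENNReal.ofReal (A ^ 2) + B * (1 + ‖u‖ₑ) + 1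
        ≤ ENNReal.ofReal (A ^ 2) * (1 + ‖u‖ₑ) + B * (1 + ‖u‖ₑ) + 1 * (1 + ‖u‖ₑ) := by
          gcongr
          · exact le_mul_of_one_le_right' le_self_add
          · simp
      _ = _ := by ring
  · intro ξ
    simp only [Finset.univ_unique, Finset.sum_const, Finset.card_singleton, one_smul]
    rw [← ofReal_norm, ← ENNReal.ofReal_pow (norm_nonneg _)]
    refine ENNReal.ofReal_le_ofReal (pow_le_pow_left₀ (norm_nonneg _) ?_ 2)
    have e : (𝓕 (∑ j ∈ J, lpKernel κ j u) : 𝓢(V, ℂ)) = ∑ j ∈ J, 𝓕 (lpKernel κ j u) :=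
      FourierTransform.fourier_sum _ _
    rw [e, sum_apply]
    exact (norm_sum_le _ _).trans (hA J u ξ)
  · intro y
    refine (lintegral_mono fun x => ?_).trans (hB' u J y)
    simp only [Finset.univ_unique, Finset.sum_const, Finset.card_singleton, one_smul,
      sum_apply, ← Finset.sum_sub_distrib]
    exact enorm_sum_le _ _

end LittlewoodPaley

section Lowpass

variable {V : Type*} [NormedAddCommGroup V] [InnerProductSpace ℝ V] [FiniteDimensional ℝ V]
  [MeasurableSpace V] [BorelSpace V] [Nontrivial V]

lemma exists_enorm_le_tsum_indicator (κ : 𝓢(V, ℂ)) : ∃ D : ℝ, 0 ≤ D ∧ ∀ z,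
    ‖κ z‖ₑ ≤ ∑' n : ℕ, (closedBall (0 : V) (2 ^ n)).indicator
      (fun _ => ENNReal.ofReal (D * (((2 : ℝ) ^ n) ^ (finrank ℝ V + 1))⁻¹)) z := by
  obtain ⟨D, hD0, hD⟩ := exists_one_add_norm_pow_mul_le κ (finrank ℝ V + 1) 0
  refine ⟨D * 2 ^ (finrank ℝ V + 1), by positivity, fun z => ?_⟩
  have hex : ∃ n : ℕ, ‖z‖ ≤ 2 ^ n := (pow_unbounded_of_one_lt ‖z‖ one_lt_two).imp fun _ h => h.le
  classical
  set n := Nat.find hex with hn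
  have h1 : ‖z‖ ≤ 2 ^ n := Nat.find_spec hex
  refine le_trans ?_ (ENNReal.le_tsum n)
  rw [indicator_of_mem (by simpa using h1), ← ofReal_norm]
  refine ENNReal.ofReal_le_ofReal ?_
  have h2 := hD z
  rw [norm_iteratedFDeriv_zero] at h2
  have h3 : (2 : ℝ) ^ n ≤ 2 * (1 + ‖z‖) := by
    rcases Nat.eq_zero_or_pos n with h0 | h0
    · rw [h0, pow_zero]; have := norm_nonneg z; linarith
    · have := Nat.find_min hex (m := n - 1) (by omega)
      push Not at this
      obtain ⟨k, hk⟩ : ∃ k, n = k + 1 := ⟨n - 1, by omega⟩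
      rw [hk, Nat.add_sub_cancel] at this
      rw [hk, pow_succ]; linarith
  rw [← div_eq_mul_inv, le_div_iff₀ (by positivity)]
  calc ‖κ z‖ * ((2 : ℝ) ^ n) ^ (finrank ℝ V + 1)
      ≤ ‖κ z‖ * (2 * (1 + ‖z‖)) ^ (finrank ℝ V + 1) := by gcongr
    _ = ((1 + ‖z‖) ^ (finrank ℝ V + 1) * ‖κ z‖) * 2 ^ (finrank ℝ V + 1) := by rw [mul_pow]; ring
    _ ≤ _ := by gcongr

/-- Dilated Schwartz kernels are controlled by the maximal function. -/
lemma exists_lowpass_le_maximalFn (κ : 𝓢(V, ℂ)) : ∃ C : ℝ≥0∞, C ≠ ∞ ∧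
    ∀ (j : ℤ) (f : 𝓢(V, ℂ)) (x : V),
      ‖sconv (lpKernel κ j 0) f x‖ₑ ≤ C * maximalFn (fun y => ‖f y‖ₑ) x := by
  obtain ⟨D, hD0, hD⟩ := exists_enorm_le_tsum_indicator κ
  set v := volume (closedBall (0 : V) 1) with hv
  have hvt : v ≠ ∞ := volume_closedBall_lt_top _ _
  set d := finrank ℝ V with hd
  refine ⟨ENNReal.ofReal (D * 2) * v, by finiteness, fun j f x => ?_⟩
  set m := maximalFn (fun y => ‖f y‖ₑ) x with hm
  set c : ℕ → ℝ≥0∞ := fun n => ENNReal.ofReal (((2 : ℝ) ^ j) ^ d) *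
    ENNReal.ofReal (D * (((2 : ℝ) ^ n) ^ (d + 1))⁻¹) with hc
  have hj : (0 : ℝ) < 2 ^ j := by positivity
  have hker : ∀ y, ‖lpKernel κ j 0 (x - y) * f y‖ₑ ≤
      ∑' n : ℕ, c n * (closedBall x ((2 : ℝ) ^ ((n : ℤ) - j))).indicator (fun y => ‖f y‖ₑ) y := by
    intro y
    rw [enorm_mul, lpKernel_apply, add_zero, enorm_smul, Real.enorm_of_nonneg (by positivity)]
    calc _ ≤ ENNReal.ofReal (((2 : ℝ) ^ j) ^ d) * (∑' n : ℕ, (closedBall (0 : V) (2 ^ n)).indicator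
            (fun _ => ENNReal.ofReal (D * (((2 : ℝ) ^ n) ^ (d + 1))⁻¹))
              ((2 : ℝ) ^ j • (x - y))) * ‖f y‖ₑ :=
          mul_le_mul_left (mul_le_mul_right (hD _) _) _
      _ = _ := by
          rw [← ENNReal.tsum_mul_left, ← ENNReal.tsum_mul_right]
          refine tsum_congr fun n => ?_
          have hiff : (2 : ℝ) ^ j • (x - y) ∈ closedBall (0 : V) (2 ^ n) ↔
              y ∈ closedBall x ((2 : ℝ) ^ ((n : ℤ) - j)) := by
            rw [mem_closedBall_zero_iff, norm_smul, Real.norm_of_nonneg hj.le, mem_closedBall',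
              dist_eq_norm, zpow_sub₀ two_ne_zero, zpow_natCast, le_div_iff₀ hj, mul_comm]
          by_cases hy : y ∈ closedBall x ((2 : ℝ) ^ ((n : ℤ) - j))
          · rw [indicator_of_mem hy, indicator_of_mem (hiff.2 hy)]
          · rw [indicator_of_notMem hy, indicator_of_notMem (hiff.not.2 hy), mul_zero, mul_zero,
              zero_mul]
  have hterm : ∀ n : ℕ, c n * (m * volume (closedBall x ((2 : ℝ) ^ ((n : ℤ) - j)))) =
      m * v * ENNReal.ofReal (D * (1 / 2) ^ n) := by
    intro n
    rw [Measure.addHaar_closedBall volume x (by positivity)]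
    have e : volume (ball (0 : V) 1) = v := by
      rw [hv, Measure.addHaar_closedBall_eq_addHaar_ball]
    rw [e, hc]
    simp only
    rw [show ENNReal.ofReal (((2 : ℝ) ^ j) ^ d) * ENNReal.ofReal (D * (((2 : ℝ) ^ n) ^ (d + 1))⁻¹) *
      (m * (ENNReal.ofReal (((2 : ℝ) ^ ((n : ℤ) - j)) ^ d) * v)) = m * v *
      (ENNReal.ofReal (((2 : ℝ) ^ j) ^ d) * ENNReal.ofReal (D * (((2 : ℝ) ^ n) ^ (d + 1))⁻¹) *
        ENNReal.ofReal (((2 : ℝ) ^ ((n : ℤ) - j)) ^ d)) by ring,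
      ← ENNReal.ofReal_mul (by positivity), ← ENNReal.ofReal_mul (by positivity)]
    congr 2
    rw [zpow_sub₀ two_ne_zero, zpow_natCast, div_pow, pow_succ, one_div, inv_pow]
    field_simp
  rw [sconv_apply]
  calc _ ≤ ∫⁻ y, ‖lpKernel κ j 0 (x - y) * f y‖ₑ := enorm_integral_le_lintegral_enorm _
    _ ≤ ∫⁻ y, ∑' n : ℕ,
          c n * (closedBall x ((2 : ℝ) ^ ((n : ℤ) - j))).indicator (fun y => ‖f y‖ₑ) y :=
        lintegral_mono hker
    _ = ∑' n : ℕ, c n * ∫⁻ y in closedBall x ((2 : ℝ) ^ ((n : ℤ) - j)), ‖f y‖ₑ := by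
        have hmeas : ∀ n : ℕ, Measurable
            ((closedBall x ((2 : ℝ) ^ ((n : ℤ) - j))).indicator (fun y => ‖f y‖ₑ)) := fun n =>
          f.continuous.enorm.measurable.indicator isClosed_closedBall.measurableSet
        rw [lintegral_tsum fun n => ((hmeas n).const_mul _).aemeasurable]
        refine tsum_congr fun n => ?_
        rw [lintegral_const_mul _ (hmeas n), lintegral_indicator isClosed_closedBall.measurableSet]
    _ ≤ ∑' n : ℕ, c n * (m * volume (closedBall x ((2 : ℝ) ^ ((n : ℤ) - j)))) :=
        ENNReal.tsum_le_tsum fun n =>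
          mul_le_mul_right (setLIntegral_closedBall_le_maximalFn _ x _) _
    _ = ∑' n : ℕ, m * v * ENNReal.ofReal (D * (1 / 2) ^ n) := tsum_congr hterm
    _ = m * v * ENNReal.ofReal (D * 2) := by
        rw [ENNReal.tsum_mul_left, ← ENNReal.ofReal_tsum_of_nonneg (fun n => by positivity)
          (summable_geometric_two.mul_left D), tsum_mul_left, tsum_geometric_two]
    _ = _ := by ring

end Lowpass

section Cutoffs

variable {V : Type*} [NormedAddCommGroup V] [InnerProductSpace ℝ V] [FiniteDimensional ℝ V]

/-- A smooth radial-type cutoff, equal to `1` on the unit ball and `0` outside the ball of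
radius `2`. -/
noncomputable def lowBump (V : Type*) [NormedAddCommGroup V] [InnerProductSpace ℝ V] :
    ContDiffBump (0 : V) := ⟨1, 2, one_pos, one_lt_two⟩

lemma lowBump_eq_one {x : V} (h : ‖x‖ ≤ 1) : lowBump V x = 1 :=
  (lowBump V).one_of_mem_closedBall (by simpa [lowBump] using h)

lemma lowBump_eq_zero {x : V} (h : 2 ≤ ‖x‖) : lowBump V x = 0 :=
  (lowBump V).zero_of_le_dist (by simpa [lowBump] using h)

lemma abs_lowBump_le (x : V) : |lowBump V x| ≤ 1 := by
  rw [abs_of_nonneg (lowBump V).nonneg]; exact (lowBump V).le_one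

/-- A smooth cutoff to the annulus `2 ^ (-c) ≤ ‖ξ‖ ≤ 2 ^ c`. -/
noncomputable def annFn (c : ℕ) (ξ : V) : ℝ :=
  lowBump V ((2 : ℝ) ^ (-(c : ℤ)) • ξ) - lowBump V ((2 : ℝ) ^ ((c : ℤ) + 1) • ξ)

lemma contDiff_annFn (c : ℕ) : ContDiff ℝ (⊤ : ℕ∞) (annFn c : V → ℝ) :=
  ((lowBump V).contDiff.comp (contDiff_const_smul _)).sub
    ((lowBump V).contDiff.comp (contDiff_const_smul _))

lemma norm_zpow_smul (j : ℤ) (x : V) : ‖(2 : ℝ) ^ j • x‖ = 2 ^ j * ‖x‖ := by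
  rw [norm_smul, Real.norm_of_nonneg (by positivity)]

lemma annFn_eq_one {c : ℕ} {x : V} (h1 : (2 : ℝ) ^ (-(c : ℤ)) ≤ ‖x‖) (h2 : ‖x‖ ≤ 2 ^ (c : ℤ)) :
    annFn c x = 1 := by
  rw [annFn, lowBump_eq_one, lowBump_eq_zero, sub_zero]
  · rw [norm_zpow_smul, zpow_add₀ two_ne_zero]
    rw [zpow_neg, inv_le_iff_one_le_mul₀ (by positivity)] at h1
    linarith
  · rw [norm_zpow_smul, zpow_neg, inv_mul_le_iff₀ (by positivity)]
    linarith

lemma annFn_eq_zero_of_le {c : ℕ} {x : V} (h : ‖x‖ ≤ 2 ^ (-(c : ℤ) - 1)) : annFn c x = 0 := by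
  have hc : (1 : ℝ) ≤ 2 ^ (c : ℤ) := one_le_zpow₀ one_le_two (by positivity)
  have h1 : ‖(2 : ℝ) ^ ((c : ℤ) + 1) • x‖ ≤ 1 := by
    rw [norm_zpow_smul]
    calc (2 : ℝ) ^ ((c : ℤ) + 1) * ‖x‖ ≤ 2 ^ ((c : ℤ) + 1) * 2 ^ (-(c : ℤ) - 1) := by gcongr
      _ = 1 := by rw [← zpow_add₀ two_ne_zero]; simp
  have h2 : ‖(2 : ℝ) ^ (-(c : ℤ)) • x‖ ≤ 1 := by
    refine le_trans ?_ h1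
    rw [norm_zpow_smul, norm_zpow_smul]
    gcongr
    · norm_num
    · omega
  rw [annFn, lowBump_eq_one h1, lowBump_eq_one h2, sub_self]

lemma annFn_eq_zero_of_ge {c : ℕ} {x : V} (h : 2 ^ ((c : ℤ) + 1) ≤ ‖x‖) : annFn c x = 0 := by
  have h1 : 2 ≤ ‖(2 : ℝ) ^ (-(c : ℤ)) • x‖ := by
    rw [norm_zpow_smul]
    calc (2 : ℝ) = 2 ^ (-(c : ℤ)) * 2 ^ ((c : ℤ) + 1) := by rw [← zpow_add₀ two_ne_zero]; simp
      _ ≤ _ := by gcongr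
  have h2 : 2 ≤ ‖(2 : ℝ) ^ ((c : ℤ) + 1) • x‖ := by
    refine h1.trans ?_
    rw [norm_zpow_smul, norm_zpow_smul]
    gcongr
    · norm_num
    · omega
  rw [annFn, lowBump_eq_zero h1, lowBump_eq_zero h2, sub_self]

lemma hasCompactSupport_annFn (c : ℕ) : HasCompactSupport (annFn c : V → ℝ) := by
  refine HasCompactSupport.of_support_subset_isCompact
    (isCompact_closedBall (0 : V) (2 ^ ((c : ℤ) + 1))) fun x hx => ?_
  by_contra h
  rw [mem_closedBall_zero_iff, not_le] at h
  exact hx (annFn_eq_zero_of_ge h.le)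

/-- The low-pass cutoff as a Schwartz function. -/
noncomputable def lowS (V : Type*) [NormedAddCommGroup V] [InnerProductSpace ℝ V]
    [FiniteDimensional ℝ V] : 𝓢(V, ℂ) :=
  ((lowBump V).hasCompactSupport.comp_left (g := ((↑) : ℝ → ℂ)) Complex.ofReal_zero).toSchwartzMap
    (Complex.ofRealCLM.contDiff.comp (lowBump V).contDiff)

/-- The annular cutoff as a Schwartz function. -/
noncomputable def annS (V : Type*) [NormedAddCommGroup V] [InnerProductSpace ℝ V]
    [FiniteDimensional ℝ V] (c : ℕ) : 𝓢(V, ℂ) :=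
  ((hasCompactSupport_annFn (V := V) c).comp_left (g := ((↑) : ℝ → ℂ))
    Complex.ofReal_zero).toSchwartzMap (Complex.ofRealCLM.contDiff.comp (contDiff_annFn c))

lemma lowS_apply (x : V) : lowS V x = (lowBump V x : ℂ) := rfl

lemma annS_apply (c : ℕ) (x : V) : annS V c x = (annFn c x : ℂ) := rfl

end Cutoffs

section Truncation

variable {V : Type*} [NormedAddCommGroup V] [InnerProductSpace ℝ V] [FiniteDimensional ℝ V]
  [MeasurableSpace V] [BorelSpace V]

lemma schwartz_ext_fourier {f g : 𝓢(V, ℂ)}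
    (h : ∀ ξ, (𝓕 f : 𝓢(V, ℂ)) ξ = (𝓕 g : 𝓢(V, ℂ)) ξ) : f = g := by
  have : (𝓕 f : 𝓢(V, ℂ)) = 𝓕 g := SchwartzMap.ext h
  rw [← FourierTransform.fourierInv_fourier_eq (F := 𝓢(V, ℂ)) f, this,
    FourierTransform.fourierInv_fourier_eq]

/-- The translated Littlewood–Paley piece of frequency `2 ^ j`. -/
noncomputable def lpP (c : ℕ) (j : ℤ) (u : V) (f : 𝓢(V, ℂ)) : 𝓢(V, ℂ) :=
  sconv (lpKernel (𝓕⁻ (annS V c) : 𝓢(V, ℂ)) j u) f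

/-- The smooth low-frequency cutoff at frequency `2 ^ j`. -/
noncomputable def lowP (j : ℤ) (f : 𝓢(V, ℂ)) : 𝓢(V, ℂ) :=
  sconv (lpKernel (𝓕⁻ (lowS V) : 𝓢(V, ℂ)) j 0) f

lemma fourier_lpP (c : ℕ) (j : ℤ) (u : V) (f : 𝓢(V, ℂ)) (ξ : V) :
    (𝓕 (lpP c j u f) : 𝓢(V, ℂ)) ξ = Real.fourierChar ⟪u, (2 : ℝ) ^ (-j) • ξ⟫_ℝ *
      annFn c ((2 : ℝ) ^ (-j) • ξ) * (𝓕 f : 𝓢(V, ℂ)) ξ := by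
  rw [lpP, fourier_sconv, fourier_lpKernel, FourierTransform.fourier_fourierInv_eq, annS_apply]

lemma fourier_lowP (j : ℤ) (f : 𝓢(V, ℂ)) (ξ : V) :
    (𝓕 (lowP j f) : 𝓢(V, ℂ)) ξ =
      lowBump V ((2 : ℝ) ^ (-j) • ξ) * (𝓕 f : 𝓢(V, ℂ)) ξ := by
  rw [lowP, fourier_sconv, fourier_lpKernel, FourierTransform.fourier_fourierInv_eq, lowS_apply]
  simp

lemma annFn_zero_ne_zero {x : V} (h : annFn 0 x ≠ 0) : 1 / 2 < ‖x‖ ∧ ‖x‖ < 2 := by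
  constructor <;> by_contra h' <;> push Not at h' <;> apply h
  · exact annFn_eq_zero_of_le (by simpa using h')
  · exact annFn_eq_zero_of_ge (by simpa using h')

lemma lowP_lpP_of_lt {i j : ℤ} (hij : i < j) (u : V) (f : 𝓢(V, ℂ)) :
    lowP j (lpP 0 i u f) = lpP 0 i u f := by
  refine schwartz_ext_fourier fun ξ => ?_
  rw [fourier_lowP, fourier_lpP]
  by_cases h : annFn 0 ((2 : ℝ) ^ (-i) • ξ) = 0
  · rw [h]; simp
  · have := (annFn_zero_ne_zero h).2
    rw [lowBump_eq_one, Complex.ofReal_one, one_mul]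
    rw [norm_zpow_smul] at this ⊢
    have e : (2 : ℝ) ^ (-j) ≤ 2 ^ (-i) * 2 ^ (-1 : ℤ) := by
      rw [← zpow_add₀ two_ne_zero]
      exact zpow_le_zpow_right₀ one_le_two (by omega)
    calc (2 : ℝ) ^ (-j) * ‖ξ‖ ≤ 2 ^ (-i) * 2 ^ (-1 : ℤ) * ‖ξ‖ := by gcongr
      _ = 2 ^ (-i) * ‖ξ‖ * 2 ^ (-1 : ℤ) := by ring
      _ ≤ 2 * 2 ^ (-1 : ℤ) := by gcongr
      _ = 1 := by norm_num

lemma lowP_lpP_of_gt {i j : ℤ} (hij : j + 1 < i) (u : V) (f : 𝓢(V, ℂ)) :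
    lowP j (lpP 0 i u f) = 0 := by
  refine schwartz_ext_fourier fun ξ => ?_
  rw [fourier_lowP, fourier_lpP, FourierTransform.fourier_zero, zero_apply]
  by_cases h : annFn 0 ((2 : ℝ) ^ (-i) • ξ) = 0
  · rw [h]; simp
  · have := (annFn_zero_ne_zero h).1
    rw [lowBump_eq_zero, Complex.ofReal_zero, zero_mul]
    rw [norm_zpow_smul] at this ⊢
    have e : 2 ^ (-i) * 2 ^ (2 : ℤ) ≤ (2 : ℝ) ^ (-j) := by
      rw [← zpow_add₀ two_ne_zero]
      exact zpow_le_zpow_right₀ one_le_two (by omega)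
    calc (2 : ℝ) = 1 / 2 * 2 ^ (2 : ℤ) := by norm_num
      _ ≤ 2 ^ (-i) * ‖ξ‖ * 2 ^ (2 : ℤ) := by gcongr
      _ = 2 ^ (-i) * 2 ^ (2 : ℤ) * ‖ξ‖ := by ring
      _ ≤ _ := by gcongr

lemma lowP_sum {ι : Type*} (J : Finset ι) (j : ℤ) (F : ι → 𝓢(V, ℂ)) :
    lowP j (∑ i ∈ J, F i) = ∑ i ∈ J, lowP j (F i) := by
  refine schwartz_ext_fourier fun ξ => ?_
  simp_rw [fourier_lowP, FourierTransform.fourier_sum, sum_apply, fourier_lowP, Finset.mul_sum]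

lemma lowP_sum_lpP (J : Finset ℤ) (b : ℤ) (u : V) (f : 𝓢(V, ℂ)) (x : V) :
    ∑ i ∈ J with i ≤ b, lpP 0 i u f x = lowP (b + 1) (∑ i ∈ J, lpP 0 i u f) x -
      ∑ i ∈ J with i = b + 1 ∨ i = b + 2, lowP (b + 1) (lpP 0 i u f) x := by
  rw [lowP_sum, sum_apply, eq_sub_iff_add_eq, Finset.sum_filter, Finset.sum_filter,
    ← Finset.sum_add_distrib]
  refine Finset.sum_congr rfl fun i _ => ?_
  rcases le_or_gt i b with h | h
  · rw [if_pos h, if_neg (by omega), add_zero, lowP_lpP_of_lt (by omega)]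
  · rw [if_neg (by omega), zero_add]
    split_ifs with h'
    · rfl
    · rw [lowP_lpP_of_gt (by omega), zero_apply]

/-- The square function of the pieces `lpP c j u f`, `j ∈ J`. -/
noncomputable def lpSq (c : ℕ) (J : Finset ℤ) (u : V) (f : 𝓢(V, ℂ)) (x : V) : ℝ :=
  √(∑ j ∈ J, ‖lpP c j u f x‖ ^ 2)

lemma lpSq_nonneg (c : ℕ) (J : Finset ℤ) (u : V) (f : 𝓢(V, ℂ)) (x : V) :
    0 ≤ lpSq c J u f x := Real.sqrt_nonneg _

lemma norm_lpP_le_lpSq (c : ℕ) {J : Finset ℤ} {j : ℤ} (hj : j ∈ J) (u : V) (f : 𝓢(V, ℂ)) (x : V) :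
    ‖lpP c j u f x‖ ≤ lpSq c J u f x := by
  refine Real.le_sqrt_of_sq_le ?_
  exact Finset.single_le_sum (f := fun j => ‖lpP c j u f x‖ ^ 2) (fun _ _ => by positivity) hj

lemma continuous_lpSq (c : ℕ) (J : Finset ℤ) (u : V) (f : 𝓢(V, ℂ)) :
    Continuous (lpSq c J u f) := by
  refine Real.continuous_sqrt.comp (continuous_finsetSum _ fun j _ => ?_)
  exact (lpP c j u f).continuous.norm.pow 2

variable [Nontrivial V]

lemma exists_lpSq_bound (V : Type*) [NormedAddCommGroup V] [InnerProductSpace ℝ V]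
    [FiniteDimensional ℝ V] [MeasurableSpace V] [BorelSpace V] [Nontrivial V]
    (c : ℕ) {p : ℝ} (hp : 1 < p) : ∃ C : ℝ≥0∞, C ≠ ∞ ∧
    ∀ (u : V) (J : Finset ℤ) (f : 𝓢(V, ℂ)), eLpNorm (lpSq c J u f) (ENNReal.ofReal p) volume ≤
      C * (1 + ‖u‖ₑ) * eLpNorm f (ENNReal.ofReal p) volume := by
  refine exists_square_bound _ ?_ hp
  rw [FourierTransform.fourier_fourierInv_eq, annS_apply, annFn_eq_zero_of_le (by simp; positivity),
    Complex.ofReal_zero]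

lemma exists_eLpNorm_maximalFn_le (V : Type*) [NormedAddCommGroup V] [InnerProductSpace ℝ V]
    [FiniteDimensional ℝ V] [MeasurableSpace V] [BorelSpace V] [Nontrivial V]
    {p : ℝ} (hp : 1 < p) : ∃ C : ℝ≥0∞, C ≠ ∞ ∧ ∀ f : V → ℝ≥0∞, Measurable f →
      eLpNorm (maximalFn f) (ENNReal.ofReal p) volume ≤
        C * eLpNorm f (ENNReal.ofReal p) volume := by
  obtain ⟨C, hC, h⟩ := exists_lintegral_maximalFn_rpow_le (V := V) hp
  have hp0 : 0 < p := by linarith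
  refine ⟨C ^ (1 / p), by finiteness, fun f hf => ?_⟩
  have e : ∀ g : V → ℝ≥0∞, eLpNorm g (ENNReal.ofReal p) volume = (∫⁻ x, g x ^ p) ^ (1 / p) := by
    intro g
    rw [eLpNorm_eq_lintegral_rpow_enorm_toReal (by simpa using hp0) ENNReal.ofReal_ne_top,
      ENNReal.toReal_ofReal hp0.le]
    simp
  rw [e, e, ← ENNReal.mul_rpow_of_nonneg _ _ (by positivity)]
  exact ENNReal.rpow_le_rpow (h f hf) (by positivity)

/-- The maximal function of the truncated sums of the pieces `lpP 0 i u f`. -/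
noncomputable def maxTrunc (J : Finset ℤ) (u : V) (f : 𝓢(V, ℂ)) (x : V) : ℝ≥0∞ :=
  ⨆ b : ℤ, ‖∑ i ∈ J with i ≤ b, lpP 0 i u f x‖ₑ

lemma measurable_maxTrunc (J : Finset ℤ) (u : V) (f : 𝓢(V, ℂ)) : Measurable (maxTrunc J u f) :=
  Measurable.iSup fun _ => (continuous_finsetSum _ fun _ _ =>
    SchwartzMap.continuous _).enorm.measurable

lemma exists_maxTrunc_bound (V : Type*) [NormedAddCommGroup V] [InnerProductSpace ℝ V]
    [FiniteDimensional ℝ V] [MeasurableSpace V] [BorelSpace V] [Nontrivial V]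
    {p : ℝ} (hp : 1 < p) : ∃ C : ℝ≥0∞, C ≠ ∞ ∧
    ∀ (u : V) (J : Finset ℤ) (f : 𝓢(V, ℂ)), eLpNorm (maxTrunc J u f) (ENNReal.ofReal p) volume ≤
      C * (1 + ‖u‖ₑ) * eLpNorm f (ENNReal.ofReal p) volume := by
  obtain ⟨C₁, hC₁, h₁⟩ := exists_lpSq_bound V 0 hp
  obtain ⟨C₂, hC₂, h₂⟩ := exists_sum_bound (𝓕⁻ (annS V 0) : 𝓢(V, ℂ)) (by
    rw [FourierTransform.fourier_fourierInv_eq, annS_apply,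
      annFn_eq_zero_of_le (by simp), Complex.ofReal_zero]) hp
  obtain ⟨C₃, hC₃, h₃⟩ := exists_lowpass_le_maximalFn (𝓕⁻ (lowS V) : 𝓢(V, ℂ))
  obtain ⟨C₄, hC₄, h₄⟩ := exists_eLpNorm_maximalFn_le V hp
  have hp1 : 1 ≤ ENNReal.ofReal p := by simpa using hp.le
  refine ⟨C₃ * C₄ * C₂ + 2 * C₃ * C₄ * C₁, by finiteness, fun u J f => ?_⟩
  set T : 𝓢(V, ℂ) := ∑ i ∈ J, lpP 0 i u f with hT
  set F : V → ℝ≥0∞ := maximalFn fun y => ‖T y‖ₑ with hF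
  set G : V → ℝ≥0∞ := maximalFn fun y => ‖lpSq 0 J u f y‖ₑ with hG
  have hSm : Measurable fun y => ‖lpSq 0 J u f y‖ₑ := (continuous_lpSq _ _ _ _).enorm.measurable
  have hFm : Measurable F := measurable_maximalFn T.continuous.enorm.measurable
  have hGm : Measurable G := measurable_maximalFn hSm
  have hpt : ∀ x, maxTrunc J u f x ≤ C₃ * F x + 2 * C₃ * G x := by
    intro x
    refine iSup_le fun b => ?_
    rw [lowP_sum_lpP]
    refine enorm_sub_le.trans (add_le_add (h₃ _ _ _) ?_)
    refine (enorm_sum_le _ _).trans ?_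
    have hcard : (J.filter fun i => i = b + 1 ∨ i = b + 2).card ≤ 2 := by
      refine (Finset.card_le_card (t := {b + 1, b + 2}) fun i hi => ?_).trans
        (Finset.card_insert_le _ _)
      simpa using (Finset.mem_filter.1 hi).2
    calc ∑ i ∈ J with i = b + 1 ∨ i = b + 2, ‖lowP (b + 1) (lpP 0 i u f) x‖ₑ
        ≤ ∑ i ∈ J with i = b + 1 ∨ i = b + 2, C₃ * G x := by
          refine Finset.sum_le_sum fun i hi => (h₃ _ _ _).trans (mul_le_mul_right ?_ _)
          refine maximalFn_mono (fun y => ?_) x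
          refine enorm_le_iff_norm_le.2 ?_
          rw [Real.norm_of_nonneg (lpSq_nonneg _ _ _ _ _)]
          exact norm_lpP_le_lpSq 0 (Finset.mem_filter.1 hi).1 u f y
      _ ≤ 2 * (C₃ * G x) := by
          rw [Finset.sum_const, nsmul_eq_mul]
          exact mul_le_mul_left (by exact_mod_cast hcard) _
      _ = _ := by ring
  calc eLpNorm (maxTrunc J u f) (ENNReal.ofReal p) volume
      ≤ eLpNorm (fun x => C₃ * F x + 2 * C₃ * G x) (ENNReal.ofReal p) volume :=
        eLpNorm_mono_enorm fun x => by simpa using hpt x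
    _ ≤ eLpNorm (fun x => C₃ * F x) (ENNReal.ofReal p) volume +
          eLpNorm (fun x => 2 * C₃ * G x) (ENNReal.ofReal p) volume :=
        eLpNorm_add_le (hFm.const_mul _).aestronglyMeasurable
          (hGm.const_mul _).aestronglyMeasurable hp1
    _ ≤ C₃ * (C₄ * (C₂ * (1 + ‖u‖ₑ) * eLpNorm f (ENNReal.ofReal p) volume)) +
        2 * C₃ * (C₄ * (C₁ * (1 + ‖u‖ₑ) * eLpNorm f (ENNReal.ofReal p) volume)) := by
        have hc : ∀ (c : ℝ≥0∞) (g : V → ℝ≥0∞), c ≠ ∞ →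
            eLpNorm (fun x => c * g x) (ENNReal.ofReal p) volume ≤
              c * eLpNorm g (ENNReal.ofReal p) volume := by
          intro c g hc
          lift c to NNReal using hc
          refine eLpNorm_le_nnreal_smul_eLpNorm_of_ae_le_mul' (.of_forall fun x => ?_) _
          simp
        refine add_le_add ((hc _ _ hC₃).trans (mul_le_mul_right ?_ _))
          ((hc _ _ (by finiteness)).trans (mul_le_mul_right ?_ _))
        · refine (h₄ _ T.continuous.enorm.measurable).trans (mul_le_mul_right ?_ _)
          rw [eLpNorm_enorm]
          refine le_trans (le_of_eq ?_) (h₂ u J f)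
          congr 1 with x
          rw [hT, sum_apply]
          rfl
        · refine (h₄ _ hSm).trans (mul_le_mul_right ?_ _)
          rw [eLpNorm_enorm]
          exact h₁ u J f
    _ = _ := by ring

end Truncation

lemma sum_zpow_two_le (J : Finset ℤ) (m : ℤ) :
    ∑ a ∈ J with a ≤ m, (2 : ℝ) ^ a ≤ 2 ^ (m + 1) := by
  have hinj : Set.InjOn (fun a : ℤ => (m - a).toNat) (J.filter fun a => a ≤ m) := by
    intro a ha b hb h
    have ha' := (Finset.mem_filter.1 ha).2
    have hb' := (Finset.mem_filter.1 hb).2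
    simp only at h
    omega
  calc ∑ a ∈ J with a ≤ m, (2 : ℝ) ^ a
      = ∑ a ∈ J with a ≤ m, (2 : ℝ) ^ m * (1 / 2) ^ (m - a).toNat := by
        refine Finset.sum_congr rfl fun a ha => ?_
        have ha' := (Finset.mem_filter.1 ha).2
        rw [one_div, inv_pow, ← zpow_natCast, Int.toNat_of_nonneg (by omega), ← zpow_neg,
          ← zpow_add₀ two_ne_zero]
        congr 1
        ring
    _ = 2 ^ m * ∑ n ∈ (J.filter fun a => a ≤ m).image (fun a : ℤ => (m - a).toNat),
          (1 / 2 : ℝ) ^ n := by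
        rw [← Finset.mul_sum, Finset.sum_image hinj]
    _ ≤ 2 ^ m * 2 := by
        gcongr
        exact (summable_geometric_two.sum_le_tsum _ fun _ _ => by positivity).trans
          tsum_geometric_two.le
    _ = _ := by rw [zpow_add₀ two_ne_zero, zpow_one]

lemma norm_fourierChar_sub_one_le (t : ℝ) : ‖(Real.fourierChar t : ℂ) - 1‖ ≤ 2 * Real.pi * |t| := by
  rw [Real.fourierChar_apply, mul_comm _ Complex.I]
  refine Real.norm_exp_I_mul_ofReal_sub_one_le.trans (le_of_eq ?_)
  rw [norm_mul, Real.norm_of_nonneg (by positivity), Real.norm_eq_abs]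

section Coefficients

variable {V : Type*} [NormedAddCommGroup V] [InnerProductSpace ℝ V] [FiniteDimensional ℝ V]
  [MeasurableSpace V] [BorelSpace V]

/-- The truncated modulated sum of Littlewood–Paley pieces appearing in the paraproducts. -/
noncomputable def coefSum (c : ℕ) (J : Finset ℤ) (σ : ℝ) (u : V) (f : 𝓢(V, ℂ)) (b : ℤ) (x : V) :
    ℂ :=
  ∑ a ∈ J with a ≤ b + c, (Real.fourierChar (2 ^ (a - b) * σ) : ℂ) * lpP 0 a u f x

variable [Nontrivial V]

/-- A pointwise majorant of the sums `coefSum`. -/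
noncomputable def coefMax (c : ℕ) (J : Finset ℤ) (σ : ℝ) (u : V) (f : 𝓢(V, ℂ)) (x : V) : ℝ≥0∞ :=
  maxTrunc J u f x + ENNReal.ofReal (2 * Real.pi * 2 ^ (c + 1)) * ‖σ‖ₑ * ‖lpSq 0 J u f x‖ₑ

lemma measurable_coefMax (c : ℕ) (J : Finset ℤ) (σ : ℝ) (u : V) (f : 𝓢(V, ℂ)) :
    Measurable (coefMax c J σ u f) :=
  (measurable_maxTrunc J u f).add ((continuous_lpSq _ _ _ _).enorm.measurable.const_mul _)

lemma enorm_coefSum_le (c : ℕ) (J : Finset ℤ) (σ : ℝ) (u : V) (f : 𝓢(V, ℂ)) (b : ℤ) (x : V) :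
    ‖coefSum c J σ u f b x‖ₑ ≤ coefMax c J σ u f x := by
  have e : coefSum c J σ u f b x = ∑ a ∈ J with a ≤ b + c, lpP 0 a u f x +
      ∑ a ∈ J with a ≤ b + c, ((Real.fourierChar (2 ^ (a - b) * σ) : ℂ) - 1) * lpP 0 a u f x := by
    rw [← Finset.sum_add_distrib]
    exact Finset.sum_congr rfl fun a _ => by ring
  rw [e, coefMax]
  refine (enorm_add_le _ _).trans (add_le_add ?_ ?_)
  · exact le_iSup (fun b : ℤ => ‖∑ i ∈ J with i ≤ b, lpP 0 i u f x‖ₑ) (b + c)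
  · rw [Real.enorm_eq_ofReal_abs σ, Real.enorm_of_nonneg (lpSq_nonneg _ _ _ _ _),
      ← ENNReal.ofReal_mul (by positivity), ← ENNReal.ofReal_mul (by positivity), ← ofReal_norm]
    refine ENNReal.ofReal_le_ofReal ?_
    calc _ ≤ ∑ a ∈ J with a ≤ b + c, 2 ^ a * (2 ^ (-b) * (2 * Real.pi * |σ|) * lpSq 0 J u f x) := by
          refine (norm_sum_le _ _).trans (Finset.sum_le_sum fun a ha => ?_)
          rw [norm_mul, ← mul_assoc]
          refine mul_le_mul ((norm_fourierChar_sub_one_le _).trans (le_of_eq ?_))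
            (norm_lpP_le_lpSq 0 (Finset.mem_filter.1 ha).1 u f x) (norm_nonneg _) (by positivity)
          rw [abs_mul, abs_of_pos (by positivity), sub_eq_add_neg, zpow_add₀ two_ne_zero]
          ring
      _ ≤ 2 ^ (b + c + 1) * (2 ^ (-b) * (2 * Real.pi * |σ|) * lpSq 0 J u f x) := by
          rw [← Finset.sum_mul]
          refine mul_le_mul_of_nonneg_right (sum_zpow_two_le J _) ?_
          have := lpSq_nonneg 0 J u f x
          positivity
      _ = _ := by
          rw [add_assoc, zpow_add₀ two_ne_zero, zpow_neg, ← Nat.cast_succ, zpow_natCast,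
            Nat.succ_eq_add_one]
          field_simp

lemma exists_coefMax_bound (V : Type*) [NormedAddCommGroup V] [InnerProductSpace ℝ V]
    [FiniteDimensional ℝ V] [MeasurableSpace V] [BorelSpace V] [Nontrivial V]
    (c : ℕ) {p : ℝ} (hp : 1 < p) : ∃ C : ℝ≥0∞, C ≠ ∞ ∧
    ∀ (σ : ℝ) (u : V) (J : Finset ℤ) (f : 𝓢(V, ℂ)),
      eLpNorm (coefMax c J σ u f) (ENNReal.ofReal p) volume ≤
        C * (1 + ‖σ‖ₑ) * (1 + ‖u‖ₑ) * eLpNorm f (ENNReal.ofReal p) volume := by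
  obtain ⟨C₁, hC₁, h₁⟩ := exists_lpSq_bound V 0 hp
  obtain ⟨C₂, hC₂, h₂⟩ := exists_maxTrunc_bound V hp
  have hp1 : 1 ≤ ENNReal.ofReal p := by simpa using hp.le
  set D := ENNReal.ofReal (2 * Real.pi * 2 ^ (c + 1)) with hD
  refine ⟨C₂ + D * C₁, by finiteness, fun σ u J f => ?_⟩
  have hc : eLpNorm (fun x => D * ‖σ‖ₑ * ‖lpSq 0 J u f x‖ₑ) (ENNReal.ofReal p) volume ≤
      D * ‖σ‖ₑ * eLpNorm (lpSq 0 J u f) (ENNReal.ofReal p) volume := by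
    have hfin : D * ‖σ‖ₑ ≠ ∞ := by finiteness
    generalize D * ‖σ‖ₑ = c at hfin
    lift c to NNReal using hfin
    refine eLpNorm_le_nnreal_smul_eLpNorm_of_ae_le_mul' (.of_forall fun x => ?_) _
    simp
  calc eLpNorm (coefMax c J σ u f) (ENNReal.ofReal p) volume
      ≤ eLpNorm (maxTrunc J u f) (ENNReal.ofReal p) volume +
          eLpNorm (fun x => D * ‖σ‖ₑ * ‖lpSq 0 J u f x‖ₑ) (ENNReal.ofReal p) volume :=
        eLpNorm_add_le (measurable_maxTrunc J u f).aestronglyMeasurable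
          ((continuous_lpSq _ _ _ _).enorm.measurable.const_mul _).aestronglyMeasurable hp1
    _ ≤ C₂ * (1 + ‖u‖ₑ) * eLpNorm f (ENNReal.ofReal p) volume +
          D * ‖σ‖ₑ * (C₁ * (1 + ‖u‖ₑ) * eLpNorm f (ENNReal.ofReal p) volume) :=
        add_le_add (h₂ u J f) (hc.trans (mul_le_mul_right (h₁ u J f) _))
    _ = (C₂ + D * C₁ * ‖σ‖ₑ) * ((1 + ‖u‖ₑ) * eLpNorm f (ENNReal.ofReal p) volume) := by ring
    _ ≤ (C₂ + D * C₁) * (1 + ‖σ‖ₑ) * ((1 + ‖u‖ₑ) * eLpNorm f (ENNReal.ofReal p) volume) := by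
        refine mul_le_mul_left ?_ _
        rw [add_mul]
        refine add_le_add ?_ ?_
        · exact le_mul_of_one_le_right' le_self_add
        · exact mul_le_mul_right le_add_self _
    _ = _ := by ring

lemma lintegral_mul_mul_le {α : Type*} [MeasurableSpace α] {μ : Measure α} {f₁ f₂ f₃ : α → ℝ≥0∞}
    (h₁ : Measurable f₁) (h₂ : Measurable f₂) (h₃ : Measurable f₃) {p₁ p₂ p₃ : ℝ}
    (hp₁ : 1 < p₁) (hp₂ : 1 < p₂) (hp₃ : 1 < p₃) (hp : 1 / p₁ + 1 / p₂ + 1 / p₃ = 1) :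
    ∫⁻ x, f₁ x * f₂ x * f₃ x ∂μ ≤ eLpNorm f₁ (ENNReal.ofReal p₁) μ *
      eLpNorm f₂ (ENNReal.ofReal p₂) μ * eLpNorm f₃ (ENNReal.ofReal p₃) μ := by
  have e : ∀ {p : ℝ} (g : α → ℝ≥0∞), 1 < p →
      eLpNorm g (ENNReal.ofReal p) μ = (∫⁻ x, g x ^ p ∂μ) ^ (1 / p) := by
    intro p g hp
    have hp0 : 0 < p := by linarith
    rw [eLpNorm_eq_lintegral_rpow_enorm_toReal (by simpa using hp0) ENNReal.ofReal_ne_top,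
      ENNReal.toReal_ofReal hp0.le]
    simp
  have h := ENNReal.lintegral_prod_norm_pow_le (μ := μ) (Finset.univ : Finset (Fin 3))
    (f := ![fun x => f₁ x ^ p₁, fun x => f₂ x ^ p₂, fun x => f₃ x ^ p₃])
    (by
      intro i _
      fin_cases i
      · exact (h₁.pow_const _).aemeasurable
      · exact (h₂.pow_const _).aemeasurable
      · exact (h₃.pow_const _).aemeasurable)
    (p := ![1 / p₁, 1 / p₂, 1 / p₃]) (by simpa [Fin.sum_univ_three] using hp)
    (by intro i _; fin_cases i <;> simp <;> linarith)
  have k : ∀ (t : ℝ≥0∞) {p : ℝ}, 1 < p → (t ^ p) ^ (1 / p) = t := by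
    intro t p hp
    rw [← ENNReal.rpow_mul, mul_one_div_cancel (by linarith), ENNReal.rpow_one]
  rw [e f₁ hp₁, e f₂ hp₂, e f₃ hp₃]
  simpa only [Fin.prod_univ_three, Matrix.cons_val_zero, Matrix.cons_val_one, Matrix.cons_val, k _ hp₁,
    k _ hp₂, k _ hp₃] using h

/-- Uniform bounds for the elementary paraproducts. -/
lemma exists_paraproduct_bound (V : Type*) [NormedAddCommGroup V] [InnerProductSpace ℝ V]
    [FiniteDimensional ℝ V] [MeasurableSpace V] [BorelSpace V] [Nontrivial V]
    (c : ℕ) {p₁ p₂ p₃ : ℝ} (hp₁ : 1 < p₁) (hp₂ : 1 < p₂) (hp₃ : 1 < p₃)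
    (hp : 1 / p₁ + 1 / p₂ + 1 / p₃ = 1) : ∃ C : ℝ≥0∞, C ≠ ∞ ∧
    ∀ (σ : ℝ) (u v : V) (J : Finset ℤ) (f₁ f₂ f₃ : 𝓢(V, ℂ)),
      ‖∫ x, ∑ b ∈ J, coefSum c J σ u f₁ b x * lpP 0 b v f₂ x * lpP c b 0 f₃ x‖ₑ ≤
        C * ((1 + ‖σ‖ₑ) * (1 + ‖u‖ₑ) * (1 + ‖v‖ₑ)) * (eLpNorm f₁ (ENNReal.ofReal p₁) volume *
          eLpNorm f₂ (ENNReal.ofReal p₂) volume * eLpNorm f₃ (ENNReal.ofReal p₃) volume) := by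
  obtain ⟨C₁, hC₁, h₁⟩ := exists_coefMax_bound V c hp₁
  obtain ⟨C₂, hC₂, h₂⟩ := exists_lpSq_bound V 0 hp₂
  obtain ⟨C₃, hC₃, h₃⟩ := exists_lpSq_bound V c hp₃
  refine ⟨C₁ * C₂ * C₃, by finiteness, fun σ u v J f₁ f₂ f₃ => ?_⟩
  have hpt : ∀ x, ‖∑ b ∈ J, coefSum c J σ u f₁ b x * lpP 0 b v f₂ x * lpP c b 0 f₃ x‖ₑ ≤
      coefMax c J σ u f₁ x * ‖lpSq 0 J v f₂ x‖ₑ * ‖lpSq c J 0 f₃ x‖ₑ := by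
    intro x
    refine (enorm_sum_le _ _).trans ?_
    calc _ ≤ ∑ b ∈ J, coefMax c J σ u f₁ x *
          ENNReal.ofReal (‖lpP 0 b v f₂ x‖ * ‖lpP c b 0 f₃ x‖) := by
          refine Finset.sum_le_sum fun b _ => ?_
          rw [enorm_mul, enorm_mul, mul_assoc, ENNReal.ofReal_mul (norm_nonneg _), ofReal_norm,
            ofReal_norm]
          exact mul_le_mul_left (enorm_coefSum_le _ _ _ _ _ _ _) _
      _ ≤ _ := by
          rw [← Finset.mul_sum, mul_assoc, ← ENNReal.ofReal_sum_of_nonneg fun _ _ => by positivity,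
            Real.enorm_of_nonneg (lpSq_nonneg _ _ _ _ _),
            Real.enorm_of_nonneg (lpSq_nonneg _ _ _ _ _),
            ← ENNReal.ofReal_mul (lpSq_nonneg _ _ _ _ _)]
          exact mul_le_mul_right (ENNReal.ofReal_le_ofReal (Real.sum_mul_le_sqrt_mul_sqrt _ _ _)) _
  calc _ ≤ ∫⁻ x, ‖∑ b ∈ J, coefSum c J σ u f₁ b x * lpP 0 b v f₂ x * lpP c b 0 f₃ x‖ₑ :=
        enorm_integral_le_lintegral_enorm _
    _ ≤ ∫⁻ x, coefMax c J σ u f₁ x * ‖lpSq 0 J v f₂ x‖ₑ * ‖lpSq c J 0 f₃ x‖ₑ := lintegral_mono hpt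
    _ ≤ _ := lintegral_mul_mul_le (measurable_coefMax _ _ _ _ _)
        (continuous_lpSq _ _ _ _).enorm.measurable (continuous_lpSq _ _ _ _).enorm.measurable
        hp₁ hp₂ hp₃ hp
    _ ≤ (C₁ * (1 + ‖σ‖ₑ) * (1 + ‖u‖ₑ) * eLpNorm f₁ (ENNReal.ofReal p₁) volume) *
        (C₂ * (1 + ‖v‖ₑ) * eLpNorm f₂ (ENNReal.ofReal p₂) volume) *
        (C₃ * (1 + ‖(0 : V)‖ₑ) * eLpNorm f₃ (ENNReal.ofReal p₃) volume) := by
        rw [eLpNorm_enorm, eLpNorm_enorm]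
        exact mul_le_mul' (mul_le_mul' (h₁ _ _ _ _) (h₂ _ _ _)) (h₃ _ _ _)
    _ = _ := by rw [enorm_zero]; ring

end Coefficients

/-- Fubini's theorem for a product of integrable functions against a bounded kernel. -/
lemma integral_mul_integral_swap {X Y : Type*} [MeasurableSpace X] [MeasurableSpace Y]
    {μ : Measure X} {ν : Measure Y} [SFinite μ] [SFinite ν] {G : X → ℂ} {H : Y → ℂ}
    {e : X × Y → ℂ} {K : ℝ} (hG : Integrable G μ) (hH : Integrable H ν)
    (he : AEStronglyMeasurable e (μ.prod ν)) (hK : ∀ z, ‖e z‖ ≤ K) :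
    ∫ x, G x * ∫ y, H y * e (x, y) ∂ν ∂μ = ∫ y, H y * ∫ x, G x * e (x, y) ∂μ ∂ν := by
  have hint : Integrable (fun z : X × Y => G z.1 * H z.2 * e z) (μ.prod ν) :=
    (hG.mul_prod hH).mul_bdd he (.of_forall hK)
  have := integral_integral_swap (f := fun x y => G x * H y * e (x, y)) hint
  simp_rw [← integral_const_mul]
  calc _ = ∫ x, ∫ y, G x * H y * e (x, y) ∂ν ∂μ := by simp_rw [mul_assoc]
    _ = _ := this
    _ = _ := by
      congr 1 with y
      congr 1 with x
      ring

section Trilinear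

variable {V : Type*} [NormedAddCommGroup V] [InnerProductSpace ℝ V] [FiniteDimensional ℝ V]
  [MeasurableSpace V] [BorelSpace V]

lemma eq_integral_fourier (f : 𝓢(V, ℂ)) (x : V) :
    f x = ∫ ξ, (𝓕 f : 𝓢(V, ℂ)) ξ * Real.fourierChar ⟪ξ, x⟫_ℝ := by
  conv_lhs => rw [← FourierTransform.fourierInv_fourier_eq (F := 𝓢(V, ℂ)) f]
  rw [SchwartzMap.fourierInv_coe, Real.fourierInv_eq]
  simp_rw [Circle.smul_def, smul_eq_mul, mul_comm]

lemma fourier_neg_eq_integral (f : 𝓢(V, ℂ)) (ξ : V) :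
    (𝓕 f : 𝓢(V, ℂ)) (-ξ) = ∫ x, f x * Real.fourierChar ⟪ξ, x⟫_ℝ := by
  rw [SchwartzMap.fourier_coe, Real.fourier_eq]
  simp_rw [Circle.smul_def, smul_eq_mul, inner_neg_right, neg_neg, real_inner_comm, mul_comm]

lemma continuous_fourierChar_coe : Continuous fun t : ℝ => (Real.fourierChar t : ℂ) :=
  continuous_subtype_val.comp Real.continuous_fourierChar

lemma integral_mul_mul_eq (f₁ f₂ f₃ : 𝓢(V, ℂ)) :
    ∫ x, f₁ x * f₂ x * f₃ x = ∫ z : V × V, (𝓕 f₁ : 𝓢(V, ℂ)) z.1 * (𝓕 f₂ : 𝓢(V, ℂ)) z.2 *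
      (𝓕 f₃ : 𝓢(V, ℂ)) (-(z.1 + z.2)) := by
  have h : ∀ x, f₁ x * f₂ x = ∫ z : V × V, ((𝓕 f₁ : 𝓢(V, ℂ)) z.1 * (𝓕 f₂ : 𝓢(V, ℂ)) z.2) *
      Real.fourierChar ⟪z.1 + z.2, x⟫_ℝ := by
    intro x
    rw [eq_integral_fourier f₁, eq_integral_fourier f₂, ← integral_prod_mul]
    refine integral_congr_ae (.of_forall fun z => ?_)
    simp only [inner_add_left, AddChar.map_add_eq_mul, Circle.coe_mul]
    ring
  calc ∫ x, f₁ x * f₂ x * f₃ x = ∫ x, f₃ x * ∫ z : V × V,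
        ((𝓕 f₁ : 𝓢(V, ℂ)) z.1 * (𝓕 f₂ : 𝓢(V, ℂ)) z.2) * Real.fourierChar ⟪z.1 + z.2, x⟫_ℝ := by
        simp_rw [← h, mul_comm]
    _ = ∫ z : V × V, ((𝓕 f₁ : 𝓢(V, ℂ)) z.1 * (𝓕 f₂ : 𝓢(V, ℂ)) z.2) *
        ∫ x, f₃ x * Real.fourierChar ⟪z.1 + z.2, x⟫_ℝ :=
        integral_mul_integral_swap (K := 1)
          (e := fun q : V × (V × V) => (Real.fourierChar ⟪q.2.1 + q.2.2, q.1⟫_ℝ : ℂ))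
          f₃.integrable ((SchwartzMap.integrable _).mul_prod (SchwartzMap.integrable _))
          (Continuous.aestronglyMeasurable (continuous_fourierChar_coe.comp (by fun_prop)))
          fun q => (Circle.norm_coe _).le
    _ = _ := by simp_rw [fourier_neg_eq_integral]

/-- Integrability of the basic trilinear expression on the frequency side. -/
lemma integrable_trilinear (f₁ f₂ f₃ : 𝓢(V, ℂ)) :
    Integrable fun z : V × V => f₁ z.1 * f₂ z.2 * f₃ (-(z.1 + z.2)) := by
  refine (f₁.integrable.mul_prod f₂.integrable).mul_bdd
    (c := SchwartzMap.seminorm ℝ 0 0 f₃) ?_ (.of_forall fun z => SchwartzMap.norm_le_seminorm ℝ f₃ _)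
  exact (f₃.continuous.comp (by fun_prop)).aestronglyMeasurable

/-- Fourier expansion of a smooth compactly supported function of `(s, x, y)`. -/
lemma exists_fourier_repr {B : ℝ × V × V → ℂ} (hB : ContDiff ℝ (⊤ : ℕ∞) B)
    (hc : HasCompactSupport B) :
    ∃ (n : ℕ) (H : 𝓢(EuclideanSpace ℝ (Fin n), ℂ)) (σ : EuclideanSpace ℝ (Fin n) →L[ℝ] ℝ)
      (u v : EuclideanSpace ℝ (Fin n) →L[ℝ] V), ∀ s x y, B (s, x, y) =
        ∫ w, H w * (Real.fourierChar (s * σ w) * Real.fourierChar ⟪u w, x⟫_ℝ *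
          Real.fourierChar ⟪v w, y⟫_ℝ) := by
  set L := toEuclidean (E := ℝ × V × V) with hL
  let G : 𝓢(EuclideanSpace ℝ (Fin (finrank ℝ (ℝ × V × V))), ℂ) :=
    (hc.comp_homeomorph L.symm.toHomeomorph).toSchwartzMap (hB.comp L.symm.contDiff)
  let L₁ : V →L[ℝ] EuclideanSpace ℝ (Fin (finrank ℝ (ℝ × V × V))) :=
    (L : (ℝ × V × V) →L[ℝ] _) ∘L (ContinuousLinearMap.inr ℝ ℝ (V × V) ∘L
      ContinuousLinearMap.inl ℝ V V)
  let L₂ : V →L[ℝ] EuclideanSpace ℝ (Fin (finrank ℝ (ℝ × V × V))) :=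
    (L : (ℝ × V × V) →L[ℝ] _) ∘L (ContinuousLinearMap.inr ℝ ℝ (V × V) ∘L
      ContinuousLinearMap.inr ℝ V V)
  refine ⟨_, 𝓕 G, innerSL ℝ (L (1, 0, 0)), ContinuousLinearMap.adjoint L₁,
    ContinuousLinearMap.adjoint L₂, fun s x y => ?_⟩
  have hG : B (s, x, y) = G (L (s, x, y)) := by
    change B (s, x, y) = B (L.symm (L (s, x, y)))
    rw [L.symm_apply_apply]
  have hdec : L (s, x, y) = s • L (1, 0, 0) + L₁ x + L₂ y := by
    change L (s, x, y) = s • L (1, 0, 0) + L (0, x, 0) + L (0, 0, y)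
    rw [← map_smul, ← map_add, ← map_add]
    simp
  rw [hG, eq_integral_fourier]
  refine integral_congr_ae (.of_forall fun w => ?_)
  simp only
  rw [hdec, inner_add_right, inner_add_right, inner_smul_right,
    ContinuousLinearMap.adjoint_inner_left, ContinuousLinearMap.adjoint_inner_left, innerSL_apply_apply,
    AddChar.map_add_eq_mul, AddChar.map_add_eq_mul, Circle.coe_mul, Circle.coe_mul,
    real_inner_comm w (L (1, 0, 0))]

lemma one_add_enorm_le {W E : Type*} [NormedAddCommGroup W] [NormedSpace ℝ W]
    [NormedAddCommGroup E] [NormedSpace ℝ E] (T : W →L[ℝ] E) (w : W) :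
    1 + ‖T w‖ₑ ≤ ENNReal.ofReal (1 + ‖T‖) * ENNReal.ofReal (1 + ‖w‖) := by
  rw [← ENNReal.ofReal_mul (by positivity), ← ofReal_norm, ← ENNReal.ofReal_one,
    ← ENNReal.ofReal_add zero_le_one (norm_nonneg _)]
  refine ENNReal.ofReal_le_ofReal ?_
  nlinarith [T.le_opNorm w, norm_nonneg T, norm_nonneg w]

/-- Moments of Schwartz functions against products of three linear growths are finite. -/
lemma lintegral_schwartz_growth {W : Type*} [NormedAddCommGroup W] [InnerProductSpace ℝ W]
    [FiniteDimensional ℝ W] [MeasurableSpace W] [BorelSpace W] (H : 𝓢(W, ℂ)) (σ : W →L[ℝ] ℝ)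
    (u v : W →L[ℝ] V) :
    ∫⁻ w, ‖H w‖ₑ * ((1 + ‖σ w‖ₑ) * (1 + ‖u w‖ₑ) * (1 + ‖v w‖ₑ)) ≠ ∞ := by
  have hint : Integrable fun w => ‖H w‖ * (1 + ‖w‖) ^ 3 := by
    have h := (((H.integrable_pow_mul volume 0).add ((H.integrable_pow_mul volume 1).const_mul 3)).add
      ((H.integrable_pow_mul volume 2).const_mul 3)).add (H.integrable_pow_mul volume 3)
    refine h.congr (.of_forall fun w => ?_)
    simp only [Pi.add_apply]
    ring
  have hfin : ∫⁻ w, ‖H w‖ₑ * ENNReal.ofReal (1 + ‖w‖) ^ 3 ≠ ∞ := by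
    refine ne_of_eq_of_ne (lintegral_congr fun w => ?_) hint.lintegral_lt_top.ne
    rw [ENNReal.ofReal_mul (norm_nonneg _), ENNReal.ofReal_pow (by positivity), ofReal_norm]
  set D := ENNReal.ofReal (1 + ‖σ‖) * ENNReal.ofReal (1 + ‖u‖) * ENNReal.ofReal (1 + ‖v‖) with hD
  have hD' : D ≠ ∞ := by finiteness
  refine ne_top_of_le_ne_top (b := D * ∫⁻ w, ‖H w‖ₑ * ENNReal.ofReal (1 + ‖w‖) ^ 3)
    (by finiteness) ?_
  rw [← lintegral_const_mul' _ _ hD']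
  refine lintegral_mono fun w => ?_
  calc _ ≤ ‖H w‖ₑ * ((ENNReal.ofReal (1 + ‖σ‖) * ENNReal.ofReal (1 + ‖w‖)) *
        (ENNReal.ofReal (1 + ‖u‖) * ENNReal.ofReal (1 + ‖w‖)) *
        (ENNReal.ofReal (1 + ‖v‖) * ENNReal.ofReal (1 + ‖w‖))) :=
        mul_le_mul_right (mul_le_mul' (mul_le_mul' (one_add_enorm_le σ w) (one_add_enorm_le u w))
          (one_add_enorm_le v w)) _
    _ = _ := by rw [hD]; ring

end Trilinear

section TruncatedForm

variable {V : Type*} [NormedAddCommGroup V] [InnerProductSpace ℝ V] [FiniteDimensional ℝ V]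
  [MeasurableSpace V] [BorelSpace V]

/-- The frequency-localised trilinear integrand. -/
noncomputable def locForm (c : ℕ) (a b : ℤ) (f₁ f₂ f₃ : 𝓢(V, ℂ)) (z : V × V) : ℂ :=
  (𝓕 (lpP 0 a 0 f₁) : 𝓢(V, ℂ)) z.1 * (𝓕 (lpP 0 b 0 f₂) : 𝓢(V, ℂ)) z.2 *
    (𝓕 (lpP c b 0 f₃) : 𝓢(V, ℂ)) (-(z.1 + z.2))

lemma locForm_eq (c : ℕ) (a b : ℤ) (f₁ f₂ f₃ : 𝓢(V, ℂ)) (z : V × V) :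
    locForm c a b f₁ f₂ f₃ z = annFn 0 ((2 : ℝ) ^ (-a) • z.1) * annFn 0 ((2 : ℝ) ^ (-b) • z.2) *
      annFn c ((2 : ℝ) ^ (-b) • (-(z.1 + z.2))) * ((𝓕 f₁ : 𝓢(V, ℂ)) z.1 * (𝓕 f₂ : 𝓢(V, ℂ)) z.2 *
        (𝓕 f₃ : 𝓢(V, ℂ)) (-(z.1 + z.2))) := by
  simp only [locForm, fourier_lpP, inner_zero_left, AddChar.map_zero_eq_one, Circle.coe_one, one_mul]
  ring

lemma integrable_mul_mul (f₁ f₂ f₃ : 𝓢(V, ℂ)) : Integrable fun x => f₁ x * f₂ x * f₃ x :=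
  ((f₁.integrable.mul_bdd (c := SchwartzMap.seminorm ℝ 0 0 f₂) f₂.continuous.aestronglyMeasurable
    (.of_forall fun _ => SchwartzMap.norm_le_seminorm ℝ f₂ _))).mul_bdd
      (c := SchwartzMap.seminorm ℝ 0 0 f₃) f₃.continuous.aestronglyMeasurable
    (.of_forall fun _ => SchwartzMap.norm_le_seminorm ℝ f₃ _)

lemma integral_locForm_mul (c : ℕ) (a b : ℤ) (f₁ f₂ f₃ : 𝓢(V, ℂ)) {n : ℕ}
    (H : 𝓢(EuclideanSpace ℝ (Fin n), ℂ)) (σ : EuclideanSpace ℝ (Fin n) →L[ℝ] ℝ)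
    (u v : EuclideanSpace ℝ (Fin n) →L[ℝ] V) {B : ℝ × V × V → ℂ}
    (hB : ∀ s x y, B (s, x, y) = ∫ w, H w * (Real.fourierChar (s * σ w) *
      Real.fourierChar ⟪u w, x⟫_ℝ * Real.fourierChar ⟪v w, y⟫_ℝ)) :
    Integrable (fun w => H w * (Real.fourierChar (2 ^ (a - b) * σ w) *
        ∫ x, lpP 0 a (u w) f₁ x * lpP 0 b (v w) f₂ x * lpP c b 0 f₃ x)) ∧
    ∫ z, locForm c a b f₁ f₂ f₃ z * B (2 ^ (a - b), (2 : ℝ) ^ (-a) • z.1, (2 : ℝ) ^ (-b) • z.2) =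
      ∫ w, H w * (Real.fourierChar (2 ^ (a - b) * σ w) *
        ∫ x, lpP 0 a (u w) f₁ x * lpP 0 b (v w) f₂ x * lpP c b 0 f₃ x) := by
  let e : (V × V) × EuclideanSpace ℝ (Fin n) → ℂ := fun q =>
    Real.fourierChar (2 ^ (a - b) * σ q.2) * Real.fourierChar ⟪u q.2, (2 : ℝ) ^ (-a) • q.1.1⟫_ℝ *
      Real.fourierChar ⟪v q.2, (2 : ℝ) ^ (-b) • q.1.2⟫_ℝ
  have he : Continuous e := by
    refine ((continuous_fourierChar_coe.comp ?_).mul (continuous_fourierChar_coe.comp ?_)).mul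
      (continuous_fourierChar_coe.comp ?_)
    · fun_prop
    · fun_prop
    · fun_prop
  have hnorm : ∀ q, ‖e q‖ ≤ 1 := by
    intro q
    simp only [e, norm_mul, Circle.norm_coe, mul_one, le_refl]
  have hG : Integrable (locForm c a b f₁ f₂ f₃) := integrable_trilinear _ _ _
  have hin : ∀ w, ∫ z, locForm c a b f₁ f₂ f₃ z * e (z, w) =
      Real.fourierChar (2 ^ (a - b) * σ w) *
        ∫ x, lpP 0 a (u w) f₁ x * lpP 0 b (v w) f₂ x * lpP c b 0 f₃ x := by
    intro w
    rw [integral_mul_mul_eq, ← integral_const_mul]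
    refine integral_congr_ae (.of_forall fun z => ?_)
    simp only [e, locForm, fourier_lpP, inner_zero_left, AddChar.map_zero_eq_one, Circle.coe_one,
      one_mul]
    ring
  constructor
  · have hint : Integrable (fun q : (V × V) × EuclideanSpace ℝ (Fin n) =>
        locForm c a b f₁ f₂ f₃ q.1 * H q.2 * e q) :=
      (hG.mul_prod H.integrable).mul_bdd he.aestronglyMeasurable (.of_forall hnorm)
    refine hint.integral_prod_right.congr (.of_forall fun w => ?_)
    simp only
    rw [← hin, ← integral_const_mul]
    congr 1 with z
    ring
  · simp_rw [hB, ← hin]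
    exact integral_mul_integral_swap hG H.integrable he.aestronglyMeasurable hnorm

lemma integral_sum_coefSum (c : ℕ) (J : Finset ℤ) (σ : ℝ) (u v : V) (f₁ f₂ f₃ : 𝓢(V, ℂ)) :
    ∫ x, ∑ b ∈ J, coefSum c J σ u f₁ b x * lpP 0 b v f₂ x * lpP c b 0 f₃ x =
      ∑ b ∈ J, ∑ a ∈ J with a ≤ b + c, Real.fourierChar (2 ^ (a - b) * σ) *
        ∫ x, lpP 0 a u f₁ x * lpP 0 b v f₂ x * lpP c b 0 f₃ x := by
  have hI : ∀ a b : ℤ, Integrable fun x => (Real.fourierChar (2 ^ (a - b) * σ) : ℂ) *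
      (lpP 0 a u f₁ x * lpP 0 b v f₂ x * lpP c b 0 f₃ x) := fun a b =>
    (integrable_mul_mul _ _ _).const_mul _
  have e : ∀ x, ∑ b ∈ J, coefSum c J σ u f₁ b x * lpP 0 b v f₂ x * lpP c b 0 f₃ x =
      ∑ b ∈ J, ∑ a ∈ J with a ≤ b + c, (Real.fourierChar (2 ^ (a - b) * σ) : ℂ) *
        (lpP 0 a u f₁ x * lpP 0 b v f₂ x * lpP c b 0 f₃ x) := by
    intro x
    simp only [coefSum, Finset.sum_mul, mul_assoc]
  simp_rw [e, ← integral_const_mul]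
  rw [integral_finsetSum _ fun b _ => integrable_finsetSum _ fun a _ => hI a b]
  exact Finset.sum_congr rfl fun b _ => integral_finsetSum _ fun a _ => hI a b

lemma integral_truncForm (c : ℕ) (J : Finset ℤ) (f₁ f₂ f₃ : 𝓢(V, ℂ)) {n : ℕ}
    (H : 𝓢(EuclideanSpace ℝ (Fin n), ℂ)) (σ : EuclideanSpace ℝ (Fin n) →L[ℝ] ℝ)
    (u v : EuclideanSpace ℝ (Fin n) →L[ℝ] V) {B : ℝ × V × V → ℂ} (hBc : Continuous B)
    (hc : HasCompactSupport B)
    (hB : ∀ s x y, B (s, x, y) = ∫ w, H w * (Real.fourierChar (s * σ w) *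
      Real.fourierChar ⟪u w, x⟫_ℝ * Real.fourierChar ⟪v w, y⟫_ℝ)) :
    ∫ z, ∑ b ∈ J, ∑ a ∈ J with a ≤ b + c, locForm c a b f₁ f₂ f₃ z *
          B (2 ^ (a - b), (2 : ℝ) ^ (-a) • z.1, (2 : ℝ) ^ (-b) • z.2) =
      ∫ w, H w * ∫ x, ∑ b ∈ J, coefSum c J (σ w) (u w) f₁ b x * lpP 0 b (v w) f₂ x *
        lpP c b 0 f₃ x := by
  obtain ⟨K, hK⟩ := hc.exists_bound_of_continuous hBc
  have hterm : ∀ a b : ℤ, Integrable fun z : V × V => locForm c a b f₁ f₂ f₃ z *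
      B (2 ^ (a - b), (2 : ℝ) ^ (-a) • z.1, (2 : ℝ) ^ (-b) • z.2) := fun a b =>
    Integrable.mul_bdd (c := K) (integrable_trilinear _ _ _)
      (hBc.comp (by fun_prop)).aestronglyMeasurable (.of_forall fun _ => hK _)
  simp_rw [integral_sum_coefSum, Finset.mul_sum]
  have hw := fun a b => (integral_locForm_mul c a b f₁ f₂ f₃ H σ u v hB)
  rw [integral_finsetSum _ fun b _ => integrable_finsetSum _ fun a _ => hterm a b,
    integral_finsetSum _ fun b _ => integrable_finsetSum _ fun a _ => (hw a b).1]
  refine Finset.sum_congr rfl fun b _ => ?_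
  rw [integral_finsetSum _ fun a _ => hterm a b, integral_finsetSum _ fun a _ => (hw a b).1]
  exact Finset.sum_congr rfl fun a _ => (hw a b).2

lemma schwartz_eLpNorm_ne_top (f : 𝓢(V, ℂ)) (p : ℝ≥0∞) : eLpNorm f p volume ≠ ∞ :=
  (f.memLp p volume).eLpNorm_ne_top

variable [Nontrivial V]

/-- Uniform bounds for truncated paraproduct-type trilinear forms with smooth coefficients. -/
lemma exists_truncForm_bound (c : ℕ) {B : ℝ × V × V → ℂ} (hB : ContDiff ℝ (⊤ : ℕ∞) B)
    (hc : HasCompactSupport B) {p₁ p₂ p₃ : ℝ} (hp₁ : 1 < p₁) (hp₂ : 1 < p₂) (hp₃ : 1 < p₃)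
    (hp : 1 / p₁ + 1 / p₂ + 1 / p₃ = 1) : ∃ C : ℝ≥0∞, C ≠ ∞ ∧
    ∀ (J : Finset ℤ) (f₁ f₂ f₃ : 𝓢(V, ℂ)),
      ‖∫ z, ∑ b ∈ J, ∑ a ∈ J with a ≤ b + c, locForm c a b f₁ f₂ f₃ z *
          B (2 ^ (a - b), (2 : ℝ) ^ (-a) • z.1, (2 : ℝ) ^ (-b) • z.2)‖ₑ ≤
        C * (eLpNorm f₁ (ENNReal.ofReal p₁) volume *
          eLpNorm f₂ (ENNReal.ofReal p₂) volume * eLpNorm f₃ (ENNReal.ofReal p₃) volume) := by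
  obtain ⟨n, H, σ, u, v, hrep⟩ := exists_fourier_repr hB hc
  obtain ⟨C, hC, h⟩ := exists_paraproduct_bound V c hp₁ hp₂ hp₃ hp
  have hD' := lintegral_schwartz_growth H σ u v
  refine ⟨(∫⁻ w, ‖H w‖ₑ * ((1 + ‖σ w‖ₑ) * (1 + ‖u w‖ₑ) * (1 + ‖v w‖ₑ))) * C,
    ENNReal.mul_ne_top hD' hC, fun J f₁ f₂ f₃ => ?_⟩
  rw [integral_truncForm c J f₁ f₂ f₃ H σ u v hB.continuous hc hrep]
  replace h := fun w => h (σ w) (u w) (v w) J f₁ f₂ f₃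
  have hP' : eLpNorm f₁ (ENNReal.ofReal p₁) volume * eLpNorm f₂ (ENNReal.ofReal p₂) volume *
      eLpNorm f₃ (ENNReal.ofReal p₃) volume ≠ ∞ :=
    ENNReal.mul_ne_top (ENNReal.mul_ne_top (schwartz_eLpNorm_ne_top _ _)
      (schwartz_eLpNorm_ne_top _ _)) (schwartz_eLpNorm_ne_top _ _)
  generalize eLpNorm f₁ (ENNReal.ofReal p₁) volume * eLpNorm f₂ (ENNReal.ofReal p₂) volume *
      eLpNorm f₃ (ENNReal.ofReal p₃) volume = P at h hP' ⊢
  refine (enorm_integral_le_lintegral_enorm _).trans ?_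
  rw [mul_assoc, ← lintegral_mul_const' _ _ (ENNReal.mul_ne_top hC hP')]
  refine lintegral_mono fun w => ?_
  rw [enorm_mul, mul_assoc]
  refine mul_le_mul_right ((h w).trans (le_of_eq ?_)) _
  ring

end TruncatedForm

lemma sum_Ioc_int_sub {G : Type*} [AddCommGroup G] (F : ℤ → G) {m n : ℤ} (h : m ≤ n) :
    ∑ a ∈ Finset.Ioc m n, (F a - F (a - 1)) = F n - F m := by
  induction n, h using Int.leInduction with
  | base => simp
  | succ n hn ih =>
    have : Finset.Ioc m (n + 1) = insert (n + 1) (Finset.Ioc m n) := by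
      ext a; simp only [Finset.mem_Ioc, Finset.mem_insert]; omega
    rw [this, Finset.sum_insert (by simp), ih, add_sub_cancel_right]
    abel

section Cutoff

variable {V : Type*} [NormedAddCommGroup V] [InnerProductSpace ℝ V] [FiniteDimensional ℝ V]

lemma sum_annFn (N : ℕ) (x : V) : ∑ a ∈ Finset.Ioc (-(N : ℤ)) N, annFn 0 ((2 : ℝ) ^ (-a) • x) =
    lowBump V ((2 : ℝ) ^ (-(N : ℤ)) • x) - lowBump V ((2 : ℝ) ^ (N : ℤ) • x) := by
  have := sum_Ioc_int_sub (fun a : ℤ => lowBump V ((2 : ℝ) ^ (-a) • x))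
    (m := -(N : ℤ)) (n := N) (by omega)
  rw [neg_neg] at this
  rw [← this]
  refine Finset.sum_congr rfl fun a _ => ?_
  rw [annFn, smul_smul, smul_smul, ← zpow_add₀ two_ne_zero, ← zpow_add₀ two_ne_zero]
  congr 3 <;> simp [sub_eq_add_neg]

lemma abs_sum_annFn_le (N : ℕ) (x : V) :
    |∑ a ∈ Finset.Ioc (-(N : ℤ)) N, annFn 0 ((2 : ℝ) ^ (-a) • x)| ≤ 2 := by
  rw [sum_annFn]
  refine (abs_sub _ _).trans ?_
  linarith [abs_lowBump_le ((2 : ℝ) ^ (-(N : ℤ)) • x), abs_lowBump_le ((2 : ℝ) ^ (N : ℤ) • x)]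

lemma tendsto_sum_annFn {x : V} (hx : x ≠ 0) :
    Tendsto (fun N : ℕ => ∑ a ∈ Finset.Ioc (-(N : ℤ)) N, annFn 0 ((2 : ℝ) ^ (-a) • x)) atTop
      (𝓝 1) := by
  have hx' : 0 < ‖x‖ := norm_pos_iff.2 hx
  have h2 : Tendsto (fun N : ℕ => (2 : ℝ) ^ N) atTop atTop :=
    tendsto_pow_atTop_atTop_of_one_lt one_lt_two
  refine tendsto_const_nhds.congr' ?_
  filter_upwards [h2.eventually_ge_atTop ‖x‖, h2.eventually_ge_atTop (2 / ‖x‖)] with N h1 h2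
  rw [sum_annFn, lowBump_eq_one, lowBump_eq_zero, sub_zero]
  · rwa [norm_zpow_smul, zpow_natCast, ← div_le_iff₀ hx']
  · rw [norm_zpow_smul, zpow_neg, zpow_natCast, inv_mul_le_iff₀ (by positivity)]
    linarith

/-- Localisation of a symbol to bounded `s` and to annuli in `x` and `y`. -/
noncomputable def cutB (c : ℕ) (B₀ : ℝ × V × V → ℂ) (q : ℝ × V × V) : ℂ :=
  ((lowBump ℝ ((2 : ℝ) ^ (-(c : ℤ)) • q.1) * annFn 1 q.2.1 * annFn 1 q.2.2 : ℝ) : ℂ) * B₀ q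

lemma cutB_eq {c : ℕ} {B₀ : ℝ × V × V → ℂ} {s : ℝ} {x y : V} (hs : 0 ≤ s) (hs' : s ≤ 2 ^ (c : ℤ))
    (hx : 1 / 2 ≤ ‖x‖) (hx' : ‖x‖ ≤ 2) (hy : 1 / 2 ≤ ‖y‖) (hy' : ‖y‖ ≤ 2) :
    cutB c B₀ (s, x, y) = B₀ (s, x, y) := by
  rw [cutB, lowBump_eq_one, annFn_eq_one, annFn_eq_one]
  · simp
  · norm_num at *; exact hy
  · norm_num at *; exact hy'
  · norm_num at *; exact hx
  · norm_num at *; exact hx'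
  · rw [norm_zpow_smul, Real.norm_of_nonneg hs, zpow_neg, inv_mul_le_iff₀ (by positivity)]
    linarith

lemma contDiff_cutB (c : ℕ) {B₀ : ℝ × V × V → ℂ}
    (hB : ∀ s x y, x ≠ 0 → y ≠ 0 → ContDiffAt ℝ (⊤ : ℕ∞) B₀ (s, x, y)) :
    ContDiff ℝ (⊤ : ℕ∞) (cutB c B₀) := by
  have h0 : ∀ᶠ x in 𝓝 (0 : V), annFn 1 x = 0 := by
    filter_upwards [closedBall_mem_nhds (0 : V) (show (0 : ℝ) < 2 ^ (-((1 : ℕ) : ℤ) - 1) by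
      positivity)] with x hx
    exact annFn_eq_zero_of_le (mem_closedBall_zero_iff.1 hx)
  rw [contDiff_iff_contDiffAt]
  rintro ⟨s, x, y⟩
  by_cases hx : x = 0
  · refine (contDiffAt_const (c := (0 : ℂ))).congr_of_eventuallyEq ?_
    have : Tendsto (fun q : ℝ × V × V => q.2.1) (𝓝 (s, x, y)) (𝓝 0) := by
      rw [← hx]; exact Continuous.tendsto (by fun_prop) (s, x, y)
    filter_upwards [this.eventually h0] with q hq
    simp [cutB, hq]
  by_cases hy : y = 0
  · refine (contDiffAt_const (c := (0 : ℂ))).congr_of_eventuallyEq ?_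
    have : Tendsto (fun q : ℝ × V × V => q.2.2) (𝓝 (s, x, y)) (𝓝 0) := by
      rw [← hy]; exact Continuous.tendsto (by fun_prop) (s, x, y)
    filter_upwards [this.eventually h0] with q hq
    simp [cutB, hq]
  refine ContDiffAt.mul ?_ (hB s x y hx hy)
  refine ContDiff.contDiffAt (Complex.ofRealCLM.contDiff.comp ?_)
  refine ((((lowBump ℝ).contDiff).comp (contDiff_fst.const_smul _)).mul
    ((contDiff_annFn 1).comp contDiff_snd.fst)).mul ((contDiff_annFn 1).comp contDiff_snd.snd)

lemma hasCompactSupport_cutB (c : ℕ) (B₀ : ℝ × V × V → ℂ) : HasCompactSupport (cutB c B₀) := by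
  refine HasCompactSupport.of_support_subset_isCompact
    ((isCompact_closedBall (0 : ℝ) (2 ^ ((c : ℤ) + 1))).prod
      ((isCompact_closedBall (0 : V) (2 ^ (((1 : ℕ) : ℤ) + 1))).prod
        (isCompact_closedBall (0 : V) (2 ^ (((1 : ℕ) : ℤ) + 1))))) fun q hq => ?_
  rw [mem_prod, mem_prod, mem_closedBall_zero_iff, mem_closedBall_zero_iff, mem_closedBall_zero_iff]
  refine ⟨?_, ?_, ?_⟩ <;> by_contra h <;> rw [not_le] at h <;> apply hq
  · rw [cutB, lowBump_eq_zero]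
    · simp
    · rw [norm_zpow_smul]
      calc (2 : ℝ) = 2 ^ (-(c : ℤ)) * 2 ^ ((c : ℤ) + 1) := by rw [← zpow_add₀ two_ne_zero]; simp
        _ ≤ _ := by gcongr
  · rw [cutB, annFn_eq_zero_of_ge h.le]; simp
  · rw [cutB, annFn_eq_zero_of_ge (x := q.2.2) h.le]; simp

end Cutoff

section Sector

variable {V : Type*} [NormedAddCommGroup V] [InnerProductSpace ℝ V] [FiniteDimensional ℝ V]

/-- A homogeneous symbol, supported where the first frequency is dominated by the second one and
the third one is comparable to the second one, with a smooth profile in these variables. -/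
structure IsSector (c : ℕ) (M : V → V → ℂ) (B₀ : ℝ × V × V → ℂ) : Prop where
  contDiffAt : ∀ s x y, x ≠ 0 → y ≠ 0 → ContDiffAt ℝ (⊤ : ℕ∞) B₀ (s, x, y)
  hom : ∀ l : ℝ, 0 < l → ∀ x y, M (l • x) (l • y) = M x y
  eq : ∀ s : ℝ, 0 < s → ∀ x y, x ≠ 0 → y ≠ 0 → M (s • x) y = B₀ (s, x, y)
  supp : ∀ x y, x ≠ 0 → y ≠ 0 → M x y ≠ 0 →
    ‖x‖ ≤ 2 ^ (c : ℤ) * ‖y‖ ∧ 2 ^ (-(c : ℤ)) * ‖y‖ ≤ ‖x + y‖ ∧ ‖x + y‖ ≤ 2 ^ (c : ℤ) * ‖y‖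

variable {c : ℕ} {M : V → V → ℂ} {B₀ : ℝ × V × V → ℂ}

lemma IsSector.eq_scale (h : IsSector c M B₀) {x y : V} (hx : x ≠ 0) (hy : y ≠ 0) (a b : ℤ) :
    M x y = B₀ (2 ^ (a - b), (2 : ℝ) ^ (-a) • x, (2 : ℝ) ^ (-b) • y) := by
  rw [← h.eq _ (by positivity) _ _ (smul_ne_zero (by positivity) hx)
    (smul_ne_zero (by positivity) hy), smul_smul,
    ← zpow_add₀ two_ne_zero, ← h.hom ((2 : ℝ) ^ (-b)) (by positivity)]
  congr 4
  ring

lemma IsSector.le_of_ne_zero (h : IsSector c M B₀) {x y : V} (hx : x ≠ 0) (hy : y ≠ 0)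
    (hM : M x y ≠ 0) {a b : ℤ} (ha : 1 / 2 < ‖(2 : ℝ) ^ (-a) • x‖)
    (hb : ‖(2 : ℝ) ^ (-b) • y‖ < 2) : a ≤ b + (c + 1 : ℕ) := by
  obtain ⟨h1, -, -⟩ := h.supp x y hx hy hM
  rw [norm_zpow_smul, zpow_neg, lt_inv_mul_iff₀ (by positivity)] at ha
  rw [norm_zpow_smul, zpow_neg, inv_mul_lt_iff₀ (by positivity)] at hb
  have : (2 : ℝ) ^ a < 2 ^ (b + c + 2) := by
    rw [zpow_add₀ two_ne_zero, zpow_add₀ two_ne_zero]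
    have hc : (0 : ℝ) < 2 ^ (c : ℤ) := by positivity
    nlinarith
  have := (zpow_lt_zpow_iff_right₀ one_lt_two).1 this
  push_cast
  omega

lemma IsSector.exists_norm_le (h : IsSector c M B₀) :
    ∃ K : ℝ, 0 ≤ K ∧ ∀ x y, x ≠ 0 → y ≠ 0 → ‖M x y‖ ≤ K := by
  obtain ⟨K, hK⟩ := (hasCompactSupport_cutB (c + 1) B₀).exists_bound_of_continuous
    (contDiff_cutB (c + 1) h.contDiffAt).continuous
  refine ⟨K, (norm_nonneg _).trans (hK 0), fun x y hx hy => ?_⟩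
  by_cases hM : M x y = 0
  · rw [hM, norm_zero]; exact (norm_nonneg _).trans (hK 0)
  have hn : ∀ z : V, z ≠ 0 → ∃ a : ℤ, 1 ≤ ‖(2 : ℝ) ^ (-a) • z‖ ∧ ‖(2 : ℝ) ^ (-a) • z‖ < 2 := by
    intro z hz
    obtain ⟨a, ha, ha'⟩ := exists_mem_Ico_zpow (norm_pos_iff.2 hz) one_lt_two
    refine ⟨a, ?_, ?_⟩
    · rwa [norm_zpow_smul, zpow_neg, le_inv_mul_iff₀ (by positivity), mul_one]
    · rw [norm_zpow_smul, zpow_neg, inv_mul_lt_iff₀ (by positivity)]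
      rwa [zpow_add₀ two_ne_zero, zpow_one] at ha'
  obtain ⟨a, ha, ha'⟩ := hn x hx
  obtain ⟨b, hb, hb'⟩ := hn y hy
  have hab := h.le_of_ne_zero hx hy hM (a := a) (lt_of_lt_of_le (by norm_num) ha) hb'
  rw [h.eq_scale hx hy a b, ← cutB_eq (c := c + 1) (B₀ := B₀) (by positivity)
    (zpow_le_zpow_right₀ one_le_two (by omega)) (le_trans (by norm_num) ha) ha'.le
    (le_trans (by norm_num) hb) hb'.le]
  exact hK _

lemma IsSector.continuousOn (h : IsSector c M B₀) :
    ContinuousOn (fun z : V × V => M z.1 z.2) {z | z.1 ≠ 0 ∧ z.2 ≠ 0} := by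
  have e : ContinuousOn (fun z : V × V => B₀ (1, z)) {z | z.1 ≠ 0 ∧ z.2 ≠ 0} := by
    intro z hz
    refine ContinuousAt.continuousWithinAt ?_
    exact (h.contDiffAt 1 z.1 z.2 hz.1 hz.2).continuousAt.comp (f := fun z : V × V => ((1 : ℝ), z))
      (by fun_prop)
  refine e.congr fun z hz => ?_
  simp only
  rw [← h.eq 1 one_pos z.1 z.2 hz.1 hz.2, one_smul]

variable [MeasurableSpace V] [BorelSpace V]

lemma IsSector.sum_locForm (h : IsSector c M B₀) (J : Finset ℤ) (f₁ f₂ f₃ : 𝓢(V, ℂ)) {z : V × V}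
    (hx : z.1 ≠ 0) (hy : z.2 ≠ 0) :
    ∑ b ∈ J, ∑ a ∈ J with a ≤ b + (c + 1 : ℕ), locForm (c + 1) a b f₁ f₂ f₃ z *
      cutB (c + 1) B₀ (2 ^ (a - b), (2 : ℝ) ^ (-a) • z.1, (2 : ℝ) ^ (-b) • z.2) =
    ((∑ a ∈ J, annFn 0 ((2 : ℝ) ^ (-a) • z.1) : ℝ) : ℂ) *
      ((∑ b ∈ J, annFn 0 ((2 : ℝ) ^ (-b) • z.2) : ℝ) : ℂ) * (M z.1 z.2 *
      ((𝓕 f₁ : 𝓢(V, ℂ)) z.1 * (𝓕 f₂ : 𝓢(V, ℂ)) z.2 * (𝓕 f₃ : 𝓢(V, ℂ)) (-(z.1 + z.2)))) := by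
  rw [Complex.ofReal_sum, Complex.ofReal_sum, Finset.sum_mul_sum, Finset.sum_comm (s := J) (t := J),
    Finset.sum_mul]
  refine Finset.sum_congr rfl fun b _ => ?_
  rw [Finset.sum_filter, Finset.sum_mul]
  refine Finset.sum_congr rfl fun a _ => ?_
  rw [locForm_eq]
  by_cases ha : annFn 0 ((2 : ℝ) ^ (-a) • z.1) = 0
  · rw [ha]; simp
  by_cases hb : annFn 0 ((2 : ℝ) ^ (-b) • z.2) = 0
  · rw [hb]; simp
  obtain ⟨ha1, ha2⟩ := annFn_zero_ne_zero ha
  obtain ⟨hb1, hb2⟩ := annFn_zero_ne_zero hb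
  split_ifs with hab
  · rw [cutB_eq (by positivity) (zpow_le_zpow_right₀ one_le_two (by omega)) ha1.le ha2.le hb1.le
      hb2.le, ← h.eq_scale hx hy]
    by_cases hM : M z.1 z.2 = 0
    · rw [hM]; simp
    obtain ⟨-, h2, h3⟩ := h.supp _ _ hx hy hM
    rw [norm_zpow_smul, zpow_neg] at hb1 hb2
    have hb0 : (0 : ℝ) < (2 ^ b)⁻¹ := by positivity
    have hc0 : (0 : ℝ) < 2 ^ (c : ℤ) := by positivity
    rw [annFn_eq_one (c := c + 1)]
    · push_cast; ring
    · rw [norm_zpow_smul, norm_neg, zpow_neg _ b, Nat.cast_succ, neg_add, zpow_add₀ two_ne_zero]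
      have hc1 : (0 : ℝ) < 2 ^ (-(c : ℤ)) := by positivity
      calc (2 : ℝ) ^ (-(c : ℤ)) * 2 ^ (-1 : ℤ) ≤ 2 ^ (-(c : ℤ)) * ((2 ^ b)⁻¹ * ‖z.2‖) := by
            gcongr; norm_num at hb1 ⊢; exact hb1.le
        _ = (2 ^ b)⁻¹ * (2 ^ (-(c : ℤ)) * ‖z.2‖) := by ring
        _ ≤ _ := by gcongr
    · rw [norm_zpow_smul, norm_neg, zpow_neg _ b, Nat.cast_succ, zpow_add₀ two_ne_zero, zpow_one]
      calc (2 ^ b)⁻¹ * ‖z.1 + z.2‖ ≤ (2 ^ b)⁻¹ * (2 ^ (c : ℤ) * ‖z.2‖) := by gcongr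
        _ = 2 ^ (c : ℤ) * ((2 ^ b)⁻¹ * ‖z.2‖) := by ring
        _ ≤ _ := by gcongr
  · have hM : M z.1 z.2 = 0 := by
      by_contra hM
      exact hab (h.le_of_ne_zero hx hy hM ha1 hb2)
    rw [hM]; simp

variable [Nontrivial V]

lemma ae_ne_zero_prod : ∀ᵐ z : V × V, z.1 ≠ 0 ∧ z.2 ≠ 0 := by
  have h : ∀ᵐ x : V, x ≠ 0 := by simp [ae_iff]
  exact (Measure.quasiMeasurePreserving_fst.ae h).and (Measure.quasiMeasurePreserving_snd.ae h)

lemma IsSector.aestronglyMeasurable (h : IsSector c M B₀) :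
    AEStronglyMeasurable (fun z : V × V => M z.1 z.2) volume := by
  have ho : IsOpen {z : V × V | z.1 ≠ 0 ∧ z.2 ≠ 0} :=
    (isOpen_ne.preimage continuous_fst).inter (isOpen_ne.preimage continuous_snd)
  have := h.continuousOn.aestronglyMeasurable (μ := (volume : Measure (V × V))) ho.measurableSet
  rwa [Measure.restrict_eq_self_of_ae_mem (s := {z : V × V | z.1 ≠ 0 ∧ z.2 ≠ 0})
    ae_ne_zero_prod] at this

/-- Boundedness of the trilinear form with a sectorial symbol. -/
lemma IsSector.exists_bound (h : IsSector c M B₀) {p₁ p₂ p₃ : ℝ} (hp₁ : 1 < p₁) (hp₂ : 1 < p₂)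
    (hp₃ : 1 < p₃) (hp : 1 / p₁ + 1 / p₂ + 1 / p₃ = 1) : ∃ C : ℝ≥0∞, C ≠ ∞ ∧
    ∀ f₁ f₂ f₃ : 𝓢(V, ℂ), ‖∫ z : V × V, M z.1 z.2 *
      ((𝓕 f₁ : 𝓢(V, ℂ)) z.1 * (𝓕 f₂ : 𝓢(V, ℂ)) z.2 * (𝓕 f₃ : 𝓢(V, ℂ)) (-(z.1 + z.2)))‖ₑ ≤
        C * (eLpNorm f₁ (ENNReal.ofReal p₁) volume *
          eLpNorm f₂ (ENNReal.ofReal p₂) volume * eLpNorm f₃ (ENNReal.ofReal p₃) volume) := by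
  obtain ⟨K, hK0, hK⟩ := h.exists_norm_le
  have hBs := contDiff_cutB (c + 1) h.contDiffAt
  obtain ⟨C, hC, hb⟩ := exists_truncForm_bound (c + 1) hBs (hasCompactSupport_cutB (c + 1) B₀)
    hp₁ hp₂ hp₃ hp
  refine ⟨C, hC, fun f₁ f₂ f₃ => ?_⟩
  have hint : Integrable fun z : V × V => (𝓕 f₁ : 𝓢(V, ℂ)) z.1 * (𝓕 f₂ : 𝓢(V, ℂ)) z.2 *
    (𝓕 f₃ : 𝓢(V, ℂ)) (-(z.1 + z.2)) := integrable_trilinear _ _ _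
  have hlim := tendsto_integral_of_dominated_convergence (μ := (volume : Measure (V × V)))
    (F := fun (N : ℕ) z => ∑ b ∈ Finset.Ioc (-(N : ℤ)) N,
      ∑ a ∈ Finset.Ioc (-(N : ℤ)) N with a ≤ b + (c + 1 : ℕ), locForm (c + 1) a b f₁ f₂ f₃ z *
      cutB (c + 1) B₀ (2 ^ (a - b), (2 : ℝ) ^ (-a) • z.1, (2 : ℝ) ^ (-b) • z.2))
    (f := fun z => M z.1 z.2 * ((𝓕 f₁ : 𝓢(V, ℂ)) z.1 * (𝓕 f₂ : 𝓢(V, ℂ)) z.2 *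
      (𝓕 f₃ : 𝓢(V, ℂ)) (-(z.1 + z.2))))
    (fun z => 4 * K * ‖(𝓕 f₁ : 𝓢(V, ℂ)) z.1 * (𝓕 f₂ : 𝓢(V, ℂ)) z.2 *
      (𝓕 f₃ : 𝓢(V, ℂ)) (-(z.1 + z.2))‖) ?_ (hint.norm.const_mul _) ?_ ?_
  · refine le_of_tendsto ((continuous_enorm.tendsto _).comp hlim) (.of_forall fun N => ?_)
    exact hb _ f₁ f₂ f₃
  · intro N
    refine (continuous_finsetSum _ fun b _ => continuous_finsetSum _ fun a _ =>
      Continuous.mul ?_ (hBs.continuous.comp (by fun_prop))).aestronglyMeasurable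
    exact ((SchwartzMap.continuous _).comp continuous_fst).mul
      ((SchwartzMap.continuous _).comp continuous_snd) |>.mul
        ((SchwartzMap.continuous _).comp (by fun_prop))
  · intro N
    filter_upwards [ae_ne_zero_prod] with z hz
    rw [h.sum_locForm _ _ _ _ hz.1 hz.2, norm_mul, norm_mul, norm_mul, Complex.norm_real,
      Complex.norm_real, Real.norm_eq_abs, Real.norm_eq_abs, ← mul_assoc]
    refine mul_le_mul_of_nonneg_right ?_ (norm_nonneg _)
    calc _ ≤ 2 * 2 * K := by
          gcongr
          · exact abs_sum_annFn_le N _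
          · exact abs_sum_annFn_le N _
          · exact hK _ _ hz.1 hz.2
      _ = _ := by ring
  · filter_upwards [ae_ne_zero_prod] with z hz
    simp_rw [h.sum_locForm _ _ _ _ hz.1 hz.2]
    have h1 := (Complex.continuous_ofReal.tendsto _).comp (tendsto_sum_annFn hz.1)
    have h2 := (Complex.continuous_ofReal.tendsto _).comp (tendsto_sum_annFn hz.2)
    simpa using (h1.mul h2).mul_const (M z.1 z.2 * ((𝓕 f₁ : 𝓢(V, ℂ)) z.1 *
      (𝓕 f₂ : 𝓢(V, ℂ)) z.2 * (𝓕 f₃ : 𝓢(V, ℂ)) (-(z.1 + z.2))))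

end Sector

section Multiplier

variable {V : Type*} [NormedAddCommGroup V] [InnerProductSpace ℝ V] [FiniteDimensional ℝ V]
  [MeasurableSpace V] [BorelSpace V]

/-- Bounded symbols whose trilinear form is bounded on `L^p₁ × L^p₂ × L^p₃`. -/
structure IsMult (p₁ p₂ p₃ : ℝ) (M : V × V → ℂ) : Prop where
  aesm : AEStronglyMeasurable M volume
  bdd : ∃ K : ℝ, ∀ᵐ z, ‖M z‖ ≤ K
  bound : ∃ C : ℝ≥0∞, C ≠ ∞ ∧ ∀ f₁ f₂ f₃ : 𝓢(V, ℂ), ‖∫ z : V × V, M z *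
    ((𝓕 f₁ : 𝓢(V, ℂ)) z.1 * (𝓕 f₂ : 𝓢(V, ℂ)) z.2 * (𝓕 f₃ : 𝓢(V, ℂ)) (-(z.1 + z.2)))‖ₑ ≤
      C * (eLpNorm f₁ (ENNReal.ofReal p₁) volume *
        eLpNorm f₂ (ENNReal.ofReal p₂) volume * eLpNorm f₃ (ENNReal.ofReal p₃) volume)

variable {p₁ p₂ p₃ : ℝ} {M M' : V × V → ℂ}

lemma IsMult.integrable_mul (h : IsMult p₁ p₂ p₃ M) {G : V × V → ℂ} (hG : Integrable G) :
    Integrable fun z => M z * G z := by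
  obtain ⟨K, hK⟩ := h.bdd
  exact hG.bdd_mul h.aesm hK

lemma IsMult.congr (h : IsMult p₁ p₂ p₃ M) (hM : M =ᵐ[volume] M') : IsMult p₁ p₂ p₃ M' := by
  refine ⟨h.aesm.congr hM, ?_, ?_⟩
  · obtain ⟨K, hK⟩ := h.bdd
    refine ⟨K, ?_⟩
    filter_upwards [hK, hM] with z h1 h2
    rwa [← h2]
  · obtain ⟨C, hC, hb⟩ := h.bound
    refine ⟨C, hC, fun f₁ f₂ f₃ => (le_of_eq ?_).trans (hb f₁ f₂ f₃)⟩
    congr 1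
    refine integral_congr_ae ?_
    filter_upwards [hM] with z hz
    rw [hz]

lemma IsMult.add (h : IsMult p₁ p₂ p₃ M) (h' : IsMult p₁ p₂ p₃ M') :
    IsMult p₁ p₂ p₃ fun z => M z + M' z := by
  refine ⟨h.aesm.add h'.aesm, ?_, ?_⟩
  · obtain ⟨K, hK⟩ := h.bdd
    obtain ⟨K', hK'⟩ := h'.bdd
    refine ⟨K + K', ?_⟩
    filter_upwards [hK, hK'] with z h1 h2
    exact (norm_add_le _ _).trans (add_le_add h1 h2)
  · obtain ⟨C, hC, hb⟩ := h.bound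
    obtain ⟨C', hC', hb'⟩ := h'.bound
    refine ⟨C + C', ENNReal.add_ne_top.2 ⟨hC, hC'⟩, fun f₁ f₂ f₃ => ?_⟩
    have hG := integrable_trilinear (𝓕 f₁ : 𝓢(V, ℂ)) (𝓕 f₂) (𝓕 f₃)
    simp_rw [add_mul]
    rw [integral_add (h.integrable_mul hG) (h'.integrable_mul hG)]
    exact (enorm_add_le _ _).trans (add_le_add (hb _ _ _) (hb' _ _ _))

lemma integral_comp_of_measurePreserving {X Y : Type*} [MeasurableSpace X] [MeasurableSpace Y]
    {μ : Measure X} {ν : Measure Y} {φ : X → Y} (hφ : MeasurePreserving φ μ ν) {G : Y → ℂ}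
    (hG : AEStronglyMeasurable G ν) : ∫ x, G (φ x) ∂μ = ∫ y, G y ∂ν := by
  rw [← hφ.map_eq, integral_map hφ.aemeasurable (by rwa [hφ.map_eq])]

lemma IsMult.swap (h : IsMult p₁ p₂ p₃ M) : IsMult p₂ p₁ p₃ fun z => M (z.2, z.1) := by
  have hφ : MeasurePreserving (Prod.swap : V × V → V × V) volume volume :=
    Measure.measurePreserving_swap
  refine ⟨h.aesm.comp_measurePreserving hφ, ?_, ?_⟩
  · obtain ⟨K, hK⟩ := h.bdd
    exact ⟨K, hφ.quasiMeasurePreserving.ae hK⟩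
  · obtain ⟨C, hC, hb⟩ := h.bound
    refine ⟨C, hC, fun f₁ f₂ f₃ => ?_⟩
    have := integral_comp_of_measurePreserving hφ
      (h.integrable_mul (integrable_trilinear (𝓕 f₂ : 𝓢(V, ℂ)) (𝓕 f₁) (𝓕 f₃))).aestronglyMeasurable
    rw [mul_comm (eLpNorm f₁ _ _)]
    refine (le_of_eq ?_).trans (hb f₂ f₁ f₃)
    rw [← this]
    congr 2 with z
    simp only [Prod.swap, add_comm z.2]
    ring_nf

lemma measurePreserving_rot :
    MeasurePreserving (fun z : V × V => (-(z.1 + z.2), z.1)) volume volume := by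
  have h1 : MeasurePreserving (fun z : V × V => (z.1, z.1 + z.2)) volume volume :=
    measurePreserving_prod_add volume volume
  have h2 : MeasurePreserving (Prod.swap : V × V → V × V) volume volume :=
    Measure.measurePreserving_swap
  have h3 : MeasurePreserving (Prod.map (fun x : V => -x) id : V × V → V × V) volume volume :=
    (Measure.measurePreserving_neg volume).prod (MeasurePreserving.id volume)
  exact h3.comp (h2.comp h1)

lemma IsMult.rot (h : IsMult p₁ p₂ p₃ M) : IsMult p₂ p₃ p₁ fun z => M (-(z.1 + z.2), z.1) := by
  have hφ := measurePreserving_rot (V := V)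
  refine ⟨h.aesm.comp_measurePreserving hφ, ?_, ?_⟩
  · obtain ⟨K, hK⟩ := h.bdd
    exact ⟨K, hφ.quasiMeasurePreserving.ae hK⟩
  · obtain ⟨C, hC, hb⟩ := h.bound
    refine ⟨C, hC, fun f₁ f₂ f₃ => ?_⟩
    have := integral_comp_of_measurePreserving hφ
      (h.integrable_mul (integrable_trilinear (𝓕 f₃ : 𝓢(V, ℂ)) (𝓕 f₁) (𝓕 f₂))).aestronglyMeasurable
    rw [mul_comm (_ * _) (eLpNorm f₃ _ _), ← mul_assoc (eLpNorm f₃ _ _)]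
    refine (le_of_eq ?_).trans (hb f₃ f₁ f₂)
    rw [← this]
    congr 2 with z
    have e : -(-(z.1 + z.2) + z.1) = z.2 := by abel
    simp only [e]
    ring

variable [Nontrivial V]

lemma IsSector.isMult {c : ℕ} {M : V → V → ℂ} {B₀ : ℝ × V × V → ℂ} (h : IsSector c M B₀)
    (hp₁ : 1 < p₁) (hp₂ : 1 < p₂) (hp₃ : 1 < p₃) (hp : 1 / p₁ + 1 / p₂ + 1 / p₃ = 1) :
    IsMult p₁ p₂ p₃ fun z : V × V => M z.1 z.2 := by
  refine ⟨h.aestronglyMeasurable, ?_, h.exists_bound hp₁ hp₂ hp₃ hp⟩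
  obtain ⟨K, -, hK⟩ := h.exists_norm_le
  refine ⟨K, ?_⟩
  filter_upwards [ae_ne_zero_prod] with z hz using hK _ _ hz.1 hz.2

end Multiplier

section Cone

variable {V : Type*} [NormedAddCommGroup V] [InnerProductSpace ℝ V]

/-- A smooth homogeneous cutoff to the cone where `x` is small compared to `y`. -/
noncomputable def cone (ε : ℝ) (x y : V) : ℝ :=
  Real.smoothTransition (2 - ‖x‖ ^ 2 / (ε ^ 2 * ‖y‖ ^ 2))

variable {ε : ℝ} {x y : V}

lemma cone_smul {l : ℝ} (hl : 0 < l) : cone ε (l • x) (l • y) = cone ε x y := by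
  rw [cone, cone, norm_smul, norm_smul, mul_pow, mul_pow, mul_left_comm,
    mul_div_mul_left _ _ (by rw [Real.norm_of_nonneg hl.le]; positivity)]

lemma cone_neg : cone ε (-x) y = cone ε x y := by rw [cone, cone, norm_neg]

lemma cone_eq_one (hε : 0 < ε) (hy : y ≠ 0) (h : ‖x‖ ≤ ε * ‖y‖) : cone ε x y = 1 := by
  have hy' : 0 < ‖y‖ := norm_pos_iff.2 hy
  refine Real.smoothTransition.one_of_one_le ?_
  have : ‖x‖ ^ 2 / (ε ^ 2 * ‖y‖ ^ 2) ≤ 1 := by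
    rw [div_le_one (by positivity), ← mul_pow]
    gcongr
  linarith

lemma norm_le_of_cone_ne_zero (hε : 0 < ε) (hy : y ≠ 0) (h : cone ε x y ≠ 0) :
    ‖x‖ ≤ 2 * ε * ‖y‖ := by
  have hy' : 0 < ‖y‖ := norm_pos_iff.2 hy
  by_contra h'
  rw [not_le] at h'
  refine h (Real.smoothTransition.zero_of_nonpos ?_)
  have : 2 ≤ ‖x‖ ^ 2 / (ε ^ 2 * ‖y‖ ^ 2) := by
    rw [le_div_iff₀ (by positivity)]
    have := pow_le_pow_left₀ (by positivity) h'.le 2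
    nlinarith [sq_nonneg (ε * ‖y‖)]
  linarith

lemma ContDiffAt.cone {F : Type*} [NormedAddCommGroup F] [NormedSpace ℝ F] {u v : F → V} {z : F}
    (hε : 0 < ε) (hu : ContDiffAt ℝ (⊤ : ℕ∞) u z) (hv : ContDiffAt ℝ (⊤ : ℕ∞) v z)
    (h : v z ≠ 0) : ContDiffAt ℝ (⊤ : ℕ∞) (fun w => cone ε (u w) (v w)) z := by
  have h' : 0 < ‖v z‖ := norm_pos_iff.2 h
  refine Real.smoothTransition.contDiff.contDiffAt.comp z ?_
  exact contDiffAt_const.sub ((hu.norm_sq ℝ).div (contDiffAt_const.mul (hv.norm_sq ℝ))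
    (by positivity))

end Cone

section Sectors

variable {V : Type*} [NormedAddCommGroup V] [InnerProductSpace ℝ V] [FiniteDimensional ℝ V]

lemma isSector_cone {ε δ : ℝ} (hε : 0 < ε) (hε8 : ε ≤ 1 / 8) (hεδ : 2 * ε ≤ δ) {n : V → V → ℂ}
    {A : ℝ × V × V → ℂ} (hA : ContDiff ℝ (⊤ : ℕ∞) A)
    (hn : ∀ l : ℝ, 0 < l → ∀ x y, n (l • x) (l • y) = n x y)
    (hnA : ∀ x y, 0 < ‖x‖ → ‖x‖ ≤ δ → 1 / 2 ≤ ‖y‖ → ‖y‖ ≤ 2 → n x y = A (‖x‖, ‖x‖⁻¹ • x, y)) :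
    IsSector 1 (fun x y => (cone ε x y : ℂ) * n x y) fun q =>
      (cone ε (q.1 • q.2.1) q.2.2 : ℂ) *
        A (q.1 * ‖q.2.1‖ / ‖q.2.2‖, ‖q.2.1‖⁻¹ • q.2.1, ‖q.2.2‖⁻¹ • q.2.2) where
  contDiffAt s x y hx hy := by
    have h1 : ContDiffAt ℝ (⊤ : ℕ∞) (fun q : ℝ × V × V => q.2.1) (s, x, y) :=
      contDiff_snd.fst.contDiffAt
    have h2 : ContDiffAt ℝ (⊤ : ℕ∞) (fun q : ℝ × V × V => q.2.2) (s, x, y) :=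
      contDiff_snd.snd.contDiffAt
    have h0 : ContDiffAt ℝ (⊤ : ℕ∞) (fun q : ℝ × V × V => q.1) (s, x, y) :=
      contDiff_fst.contDiffAt
    have hx' : ‖x‖ ≠ 0 := norm_ne_zero_iff.2 hx
    have hy' : ‖y‖ ≠ 0 := norm_ne_zero_iff.2 hy
    have hN1 := h1.norm ℝ hx
    have hN2 := h2.norm ℝ hy
    refine ContDiffAt.mul ?_ (hA.contDiffAt.comp _ (((h0.mul hN1).div hN2 hy').prodMk
      (((hN1.inv hx').smul h1).prodMk ((hN2.inv hy').smul h2))))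
    exact Complex.ofRealCLM.contDiff.contDiffAt.comp _ (ContDiffAt.cone hε (h0.smul h1) h2 hy)
  hom l hl x y := by rw [cone_smul hl, hn l hl]
  eq s hs x y hx hy := by
    by_cases h : cone ε (s • x) y = 0
    · simp [h]
    have hb := norm_le_of_cone_ne_zero hε hy h
    have hx' : 0 < ‖x‖ := norm_pos_iff.2 hx
    have hy' : 0 < ‖y‖ := norm_pos_iff.2 hy
    have hs' : ‖s • x‖ = s * ‖x‖ := by rw [norm_smul, Real.norm_of_nonneg hs.le]
    have e1 : ‖‖y‖⁻¹ • s • x‖ = s * ‖x‖ / ‖y‖ := by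
      rw [norm_smul, hs', norm_inv, norm_norm]; field_simp
    have e2 : ‖‖y‖⁻¹ • y‖ = 1 := by
      rw [norm_smul, norm_inv, norm_norm, inv_mul_cancel₀ hy'.ne']
    simp only
    congr 1
    rw [← hn ‖y‖⁻¹ (by positivity), hnA, e1]
    · congr 3
      rw [smul_smul, smul_smul]
      congr 1
      field_simp
    · rw [e1]; positivity
    · rw [e1, div_le_iff₀ hy', ← hs']
      exact hb.trans (by gcongr)
    · rw [e2]; norm_num
    · rw [e2]; norm_num
  supp x y hx hy h := by
    have hc : cone ε x y ≠ 0 := by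
      intro hc
      exact h (by simp [hc])
    have hb := norm_le_of_cone_ne_zero hε hy hc
    have hy' : 0 < ‖y‖ := norm_pos_iff.2 hy
    have h1 := norm_add_le x y
    have h2 : ‖y‖ ≤ ‖x + y‖ + ‖x‖ := by
      simpa using norm_sub_le (x + y) x
    norm_num
    refine ⟨?_, ?_, ?_⟩ <;> nlinarith

/-- The part of a symbol that lives away from the three singular directions. -/
noncomputable def centralPart (ε : ℝ) (n : V → V → ℂ) (x y : V) : ℂ :=
  (1 - cone ε x y : ℂ) * (1 - cone ε y x) * (1 - cone ε (x + y) x) * n x y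

lemma contDiffAt_centralPart {ε : ℝ} (hε : 0 < ε) {n : V → V → ℂ}
    (hs : ContDiffOn ℝ (⊤ : ℕ∞) (fun z : V × V => n z.1 z.2)
      {z | z.1 ≠ 0 ∧ z.2 ≠ 0 ∧ z.1 + z.2 ≠ 0}) {z : V × V} (hz : z.2 ≠ 0) :
    ContDiffAt ℝ (⊤ : ℕ∞) (fun z : V × V => centralPart ε n z.1 z.2) z := by
  obtain ⟨x, y⟩ := z
  have hy : 0 < ‖y‖ := norm_pos_iff.2 hz
  by_cases hx : x = 0
  · refine (contDiffAt_const (c := (0 : ℂ))).congr_of_eventuallyEq ?_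
    have h1 : ∀ᶠ w : V × V in 𝓝 (x, y), ‖w.1‖ < ε * ‖w.2‖ :=
      (isOpen_lt (by fun_prop) (by fun_prop)).mem_nhds
        (show ‖x‖ < ε * ‖y‖ by rw [hx, norm_zero]; positivity)
    have h2 : ∀ᶠ w : V × V in 𝓝 (x, y), w.2 ≠ 0 :=
      (isOpen_ne.preimage continuous_snd).mem_nhds hz
    filter_upwards [h1, h2] with w hw1 hw2
    simp [centralPart, cone_eq_one hε hw2 hw1.le]
  have hx' : 0 < ‖x‖ := norm_pos_iff.2 hx
  by_cases hxy : x + y = 0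
  · refine (contDiffAt_const (c := (0 : ℂ))).congr_of_eventuallyEq ?_
    have h1 : ∀ᶠ w : V × V in 𝓝 (x, y), ‖w.1 + w.2‖ < ε * ‖w.1‖ :=
      (isOpen_lt (by fun_prop) (by fun_prop)).mem_nhds
        (show ‖x + y‖ < ε * ‖x‖ by rw [hxy, norm_zero]; positivity)
    have h2 : ∀ᶠ w : V × V in 𝓝 (x, y), w.1 ≠ 0 :=
      (isOpen_ne.preimage continuous_fst).mem_nhds hx
    filter_upwards [h1, h2] with w hw1 hw2
    simp [centralPart, cone_eq_one hε hw2 hw1.le]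
  have ho : IsOpen {z : V × V | z.1 ≠ 0 ∧ z.2 ≠ 0 ∧ z.1 + z.2 ≠ 0} :=
    (isOpen_ne.preimage continuous_fst).inter ((isOpen_ne.preimage continuous_snd).inter
      (isOpen_ne.preimage (continuous_fst.add continuous_snd)))
  have h1 : ContDiffAt ℝ (⊤ : ℕ∞) (fun z : V × V => z.1) (x, y) := contDiffAt_fst
  have h2 : ContDiffAt ℝ (⊤ : ℕ∞) (fun z : V × V => z.2) (x, y) := contDiffAt_snd
  have hC : ∀ {u v : V × V → V}, ContDiffAt ℝ (⊤ : ℕ∞) u (x, y) →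
      ContDiffAt ℝ (⊤ : ℕ∞) v (x, y) → v (x, y) ≠ 0 →
      ContDiffAt ℝ (⊤ : ℕ∞) (fun w => (1 - cone ε (u w) (v w) : ℂ)) (x, y) := fun hu hv h =>
    contDiffAt_const.sub (Complex.ofRealCLM.contDiff.contDiffAt.comp _ (ContDiffAt.cone hε hu hv h))
  exact (((hC h1 h2 hz).mul (hC h2 h1 hx)).mul (hC (h1.add h2) h1 hx)).mul
    (hs.contDiffAt (ho.mem_nhds ⟨hx, hz, hxy⟩))

lemma exists_isSector_centralPart {ε : ℝ} (hε : 0 < ε) {n : V → V → ℂ}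
    (hn : ∀ l : ℝ, 0 < l → ∀ x y, n (l • x) (l • y) = n x y)
    (hs : ContDiffOn ℝ (⊤ : ℕ∞) (fun z : V × V => n z.1 z.2)
      {z | z.1 ≠ 0 ∧ z.2 ≠ 0 ∧ z.1 + z.2 ≠ 0}) :
    ∃ c : ℕ, IsSector c (centralPart ε n) fun q => centralPart ε n (q.1 • q.2.1) q.2.2 := by
  obtain ⟨c, hc⟩ := pow_unbounded_of_one_lt (1 + ε⁻¹ + ε⁻¹ ^ 2) (one_lt_two (α := ℝ))
  have hε' : 0 < ε⁻¹ := by positivity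
  refine ⟨c, fun s x y _ hy => ?_, fun l hl x y => ?_, fun _ _ _ _ _ _ => rfl,
    fun x y hx hy h => ?_⟩
  · exact (contDiffAt_centralPart hε hs (z := (s • x, y)) hy).comp
      (f := fun q : ℝ × V × V => (q.1 • q.2.1, q.2.2)) (s, x, y)
      (((contDiff_fst.smul contDiff_snd.fst).prodMk contDiff_snd.snd).contDiffAt)
  · rw [centralPart, centralPart, ← smul_add, cone_smul hl, cone_smul hl, cone_smul hl, hn l hl]
  have hx' : 0 < ‖x‖ := norm_pos_iff.2 hx
  have hy' : 0 < ‖y‖ := norm_pos_iff.2 hy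
  have h1 : ε * ‖y‖ < ‖x‖ := by
    by_contra h'
    exact h (by simp [centralPart, cone_eq_one hε hy (not_lt.1 h')])
  have h2 : ε * ‖x‖ < ‖y‖ := by
    by_contra h'
    exact h (by simp [centralPart, cone_eq_one hε hx (not_lt.1 h')])
  have h3 : ε * ‖x‖ < ‖x + y‖ := by
    by_contra h'
    exact h (by simp [centralPart, cone_eq_one hε hx (not_lt.1 h')])
  have h4 : ‖x‖ ≤ ε⁻¹ * ‖y‖ := by
    rw [inv_mul_eq_div, le_div_iff₀ hε]; linarith
  have h5 := norm_add_le x y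
  rw [zpow_neg, zpow_natCast]
  have hc0 : ε⁻¹ ≤ 2 ^ c := by nlinarith [sq_nonneg ε⁻¹]
  have hc1 : 1 + ε⁻¹ ≤ 2 ^ c := by nlinarith [sq_nonneg ε⁻¹]
  have hc2 : ((2 : ℝ) ^ c)⁻¹ ≤ ε ^ 2 := by
    rw [inv_le_comm₀ (by positivity) (by positivity), ← inv_pow]
    linarith
  refine ⟨h4.trans (by gcongr), ?_, ?_⟩
  · calc _ ≤ ε ^ 2 * ‖y‖ := by gcongr
      _ = ε * (ε * ‖y‖) := by ring
      _ ≤ ε * ‖x‖ := by gcongr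
      _ ≤ _ := h3.le
  · calc _ ≤ ‖x‖ + ‖y‖ := h5
      _ ≤ (1 + ε⁻¹) * ‖y‖ := by linarith
      _ ≤ _ := by gcongr

lemma eq_centralPart_add {ε : ℝ} (hε : 0 < ε) (hε8 : ε ≤ 1 / 8) (n : V → V → ℂ) {x y : V}
    (hx : x ≠ 0) (hy : y ≠ 0) :
    n x y = centralPart ε n x y + cone ε x y * n x y + cone ε y x * n x y +
      cone ε (x + y) x * n x y := by
  have hx' : 0 < ‖x‖ := norm_pos_iff.2 hx
  have hy' : 0 < ‖y‖ := norm_pos_iff.2 hy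
  have h1 := fun h => norm_le_of_cone_ne_zero (x := x) hε hy h
  have h2 := fun h => norm_le_of_cone_ne_zero (x := y) hε hx h
  have h3 := fun h => norm_le_of_cone_ne_zero (x := x + y) hε hx h
  have h4 : ‖y‖ ≤ ‖x + y‖ + ‖x‖ := by simpa using norm_sub_le (x + y) x
  have h5 : ‖x‖ ≤ ‖x + y‖ + ‖y‖ := by simpa using norm_sub_le (x + y) y
  have e1 : cone ε x y * cone ε y x = 0 := by
    by_contra h
    rw [← ne_eq, mul_ne_zero_iff] at h
    nlinarith [h1 h.1, h2 h.2]
  have e2 : cone ε x y * cone ε (x + y) x = 0 := by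
    by_contra h
    rw [← ne_eq, mul_ne_zero_iff] at h
    nlinarith [h1 h.1, h3 h.2]
  have e3 : cone ε y x * cone ε (x + y) x = 0 := by
    by_contra h
    rw [← ne_eq, mul_ne_zero_iff] at h
    nlinarith [h2 h.1, h3 h.2]
  have e1' : (cone ε x y : ℂ) * cone ε y x = 0 := by exact_mod_cast e1
  have e2' : (cone ε x y : ℂ) * cone ε (x + y) x = 0 := by exact_mod_cast e2
  have e3' : (cone ε y x : ℂ) * cone ε (x + y) x = 0 := by exact_mod_cast e3
  rw [centralPart]
  linear_combination (-n x y * (1 - cone ε (x + y) x)) * e1' - n x y * e2' - n x y * e3'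

end Sectors

lemma isMult_of_labels (m : EuclideanSpace ℝ (Fin 3) → EuclideanSpace ℝ (Fin 3) → ℂ)
    (hhom : ∀ l : ℝ, 0 < l → ∀ ξ η : EuclideanSpace ℝ (Fin 3), m (l • ξ) (l • η) = m ξ η)
    (hsmooth : ContDiffOn ℝ (⊤ : ℕ∞)
      (fun p : EuclideanSpace ℝ (Fin 3) × EuclideanSpace ℝ (Fin 3) => m p.1 p.2)
      {p : EuclideanSpace ℝ (Fin 3) × EuclideanSpace ℝ (Fin 3) |
        p.1 ≠ 0 ∧ p.2 ≠ 0 ∧ p.1 ≠ p.2})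
    (hlabel : ∀ i j : Fin 3, i ≠ j →
      ∃ δ : ℝ, 0 < δ ∧
        ∃ A : ℝ × EuclideanSpace ℝ (Fin 3) × EuclideanSpace ℝ (Fin 3) → ℂ,
          ContDiff ℝ (⊤ : ℕ∞) A ∧
          ∀ ξ η : EuclideanSpace ℝ (Fin 3),
            0 < ‖![ξ, η, ξ - η] i‖ → ‖![ξ, η, ξ - η] i‖ ≤ δ →
            1 / 2 ≤ ‖![ξ, η, ξ - η] j‖ → ‖![ξ, η, ξ - η] j‖ ≤ 2 →
            m ξ η = A (‖![ξ, η, ξ - η] i‖,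
              ‖![ξ, η, ξ - η] i‖⁻¹ • ![ξ, η, ξ - η] i, ![ξ, η, ξ - η] j))
    {p₁ p₂ p₃ : ℝ} (hp₁ : 1 < p₁) (hp₂ : 1 < p₂) (hp₃ : 1 < p₃)
    (hp : 1 / p₁ + 1 / p₂ + 1 / p₃ = 1) :
    IsMult p₁ p₂ p₃ fun z : EuclideanSpace ℝ (Fin 3) × EuclideanSpace ℝ (Fin 3) =>
      m (z.1 + z.2) z.1 := by
  obtain ⟨δ₀, hδ₀, A₀, hA₀, h₀⟩ := hlabel 0 1 (by decide)
  obtain ⟨δ₁, hδ₁, A₁, hA₁, h₁⟩ := hlabel 1 2 (by decide)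
  obtain ⟨δ₂, hδ₂, A₂, hA₂, h₂⟩ := hlabel 2 1 (by decide)
  simp only [Matrix.cons_val_zero, Matrix.cons_val_one, Matrix.cons_val] at h₀ h₁ h₂
  obtain ⟨ε, hε, hε8, hε₀, hε₁, hε₂⟩ : ∃ ε : ℝ, 0 < ε ∧ ε ≤ 1 / 8 ∧ 2 * ε ≤ δ₀ ∧ 2 * ε ≤ δ₁ ∧
      2 * ε ≤ δ₂ := by
    refine ⟨min (1 / 8) (min δ₀ (min δ₁ δ₂) / 2), by positivity, min_le_left _ _, ?_, ?_, ?_⟩ <;>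
    · have h1 := min_le_right (1 / 8) (min δ₀ (min δ₁ δ₂) / 2)
      have h2 := min_le_left δ₀ (min δ₁ δ₂)
      have h3 := min_le_right δ₀ (min δ₁ δ₂)
      have h4 := min_le_left δ₁ δ₂
      have h5 := min_le_right δ₁ δ₂
      linarith
  have hn : ∀ l : ℝ, 0 < l → ∀ x y : EuclideanSpace ℝ (Fin 3),
      m (l • x + l • y) (l • x) = m (x + y) x := fun l hl x y => by rw [← smul_add, hhom l hl]
  have hs : ContDiffOn ℝ (⊤ : ℕ∞)
      (fun z : EuclideanSpace ℝ (Fin 3) × EuclideanSpace ℝ (Fin 3) => m (z.1 + z.2) z.1)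
      {z | z.1 ≠ 0 ∧ z.2 ≠ 0 ∧ z.1 + z.2 ≠ 0} := by
    refine hsmooth.comp (g := fun p : EuclideanSpace ℝ (Fin 3) × EuclideanSpace ℝ (Fin 3) =>
      m p.1 p.2) (f := fun z : EuclideanSpace ℝ (Fin 3) × EuclideanSpace ℝ (Fin 3) =>
      (z.1 + z.2, z.1)) ((contDiff_fst.add contDiff_snd).prodMk contDiff_fst).contDiffOn ?_
    rintro z ⟨hz1, hz2, hz3⟩
    exact ⟨hz3, hz1, by simpa using hz2⟩
  obtain ⟨c, hc⟩ := exists_isSector_centralPart hε (n := fun x y => m (x + y) x) hn hs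
  have k₁ : ∀ x y : EuclideanSpace ℝ (Fin 3), 0 < ‖x‖ → ‖x‖ ≤ δ₁ → 1 / 2 ≤ ‖y‖ → ‖y‖ ≤ 2 →
      m (x + y) x = A₁ (‖x‖, ‖x‖⁻¹ • x, y) := fun x y h1 h2 h3 h4 => by
    have := h₁ (x + y) x
    rw [add_sub_cancel_left] at this
    exact this h1 h2 h3 h4
  have k₂ : ∀ x y : EuclideanSpace ℝ (Fin 3), 0 < ‖x‖ → ‖x‖ ≤ δ₂ → 1 / 2 ≤ ‖y‖ → ‖y‖ ≤ 2 →
      m (x + y) y = A₂ (‖x‖, ‖x‖⁻¹ • x, y) := fun x y h1 h2 h3 h4 => by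
    have := h₂ (x + y) y
    rw [add_sub_cancel_right] at this
    exact this h1 h2 h3 h4
  have k₀ : ∀ x y : EuclideanSpace ℝ (Fin 3), 0 < ‖x‖ → ‖x‖ ≤ δ₀ → 1 / 2 ≤ ‖y‖ → ‖y‖ ≤ 2 →
      m (-x) y = A₀ (‖x‖, -(‖x‖⁻¹ • x), y) := fun x y h1 h2 h3 h4 => by
    have := h₀ (-x) y
    rw [norm_neg, smul_neg] at this
    exact this h1 h2 h3 h4
  have I₁ := (isSector_cone hε hε8 hε₁ (n := fun x y => m (x + y) x) hA₁ hn k₁).isMult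
    hp₁ hp₂ hp₃ hp
  have I₂ := ((isSector_cone hε hε8 hε₂ (n := fun x y => m (x + y) y) hA₂
    (fun l hl x y => by rw [← smul_add, hhom l hl]) k₂).isMult hp₂ hp₁ hp₃ (by linarith)).swap
  have I₀ := ((isSector_cone hε hε8 hε₀ (n := fun x y => m (-x) y)
    (A := fun w => A₀ (w.1, -w.2.1, w.2.2))
    (hA₀.comp (contDiff_fst.prodMk (contDiff_snd.fst.neg.prodMk contDiff_snd.snd)))
    (fun l hl x y => by rw [← smul_neg, hhom l hl]) k₀).isMult hp₃ hp₁ hp₂ (by linarith)).rot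
  refine ((((hc.isMult hp₁ hp₂ hp₃ hp).add I₁).add I₂).add I₀).congr ?_
  filter_upwards [ae_ne_zero_prod] with z hz
  have := eq_centralPart_add hε hε8 (fun x y => m (x + y) x) hz.1 hz.2
  refine Eq.trans ?_ this.symm
  simp only [neg_neg, cone_neg, add_comm z.2]

section Duality

variable {V : Type*} [NormedAddCommGroup V] [InnerProductSpace ℝ V] [FiniteDimensional ℝ V]
  [MeasurableSpace V] [BorelSpace V]

lemma eLpNorm_ofReal_eq {f : V → ℂ} {p : ℝ} (hp : 0 < p) :
    eLpNorm f (ENNReal.ofReal p) volume = (∫⁻ x, ‖f x‖ₑ ^ p) ^ (1 / p) := by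
  rw [eLpNorm_eq_lintegral_rpow_enorm_toReal (by simpa using hp) ENNReal.ofReal_ne_top,
    ENNReal.toReal_ofReal hp.le]

lemma enorm_integral_mul_le {r r' : ℝ} (hr : r.HolderConjugate r') {f h : V → ℂ}
    (hf : AEStronglyMeasurable f volume) (hh : AEStronglyMeasurable h volume) :
    ‖∫ x, f x * h x‖ₑ ≤ eLpNorm f (ENNReal.ofReal r) volume *
      eLpNorm h (ENNReal.ofReal r') volume := by
  rw [eLpNorm_ofReal_eq hr.pos, eLpNorm_ofReal_eq hr.symm.pos]
  refine (enorm_integral_le_lintegral_enorm _).trans ?_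
  simp_rw [enorm_mul]
  exact ENNReal.lintegral_mul_le_Lp_mul_Lq volume hr hf.enorm hh.enorm

lemma integrable_mul_of_memLp {r r' : ℝ} (hr : r.HolderConjugate r') {f h : V → ℂ}
    (hf : MemLp f (ENNReal.ofReal r) volume) (hh : MemLp h (ENNReal.ofReal r') volume) :
    Integrable fun x => f x * h x := by
  refine ⟨hf.1.mul hh.1, ?_⟩
  have h1 := ENNReal.lintegral_mul_le_Lp_mul_Lq volume hr hf.1.enorm hh.1.enorm
  rw [← eLpNorm_ofReal_eq hr.pos, ← eLpNorm_ofReal_eq hr.symm.pos] at h1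
  rw [hasFiniteIntegral_iff_enorm]
  simp_rw [enorm_mul]
  exact h1.trans_lt (ENNReal.mul_lt_top hf.2 hh.2)

lemma enorm_integral_mul_le_of_schwartz {r r' : ℝ} (hr : r.HolderConjugate r') {G : V → ℂ}
    (hG : MemLp G (ENNReal.ofReal r) volume) {C : ℝ≥0∞} (hC : C ≠ ∞)
    (hb : ∀ h : 𝓢(V, ℂ), ‖∫ x, G x * h x‖ₑ ≤ C * eLpNorm h (ENNReal.ofReal r') volume)
    {h₀ : V → ℂ} (h₀m : MemLp h₀ (ENNReal.ofReal r') volume) :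
    ‖∫ x, G x * h₀ x‖ₑ ≤ C * eLpNorm h₀ (ENNReal.ofReal r') volume := by
  have key : ∀ t : ℝ, 0 < t → ‖∫ x, G x * h₀ x‖ₑ ≤ C * eLpNorm h₀ (ENNReal.ofReal r') volume +
      (C + eLpNorm G (ENNReal.ofReal r) volume) * ENNReal.ofReal t := by
    intro t ht
    obtain ⟨g, hg1, hg2, hg3⟩ := MemLp.exist_eLpNorm_sub_le ENNReal.ofReal_ne_top
      (by simpa using hr.symm.lt.le) h₀m ht
    let h : 𝓢(V, ℂ) := hg1.toSchwartzMap hg2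
    have hh : (h : V → ℂ) = g := rfl
    have hgm : MemLp g (ENNReal.ofReal r') volume :=
      hg2.continuous.memLp_of_hasCompactSupport hg1
    have e : ∫ x, G x * h₀ x = (∫ x, G x * h x) + ∫ x, G x * (h₀ - g) x := by
      rw [hh, ← integral_add (integrable_mul_of_memLp hr hG hgm)
        (integrable_mul_of_memLp hr hG (h₀m.sub hgm))]
      congr 1 with x
      simp only [Pi.sub_apply]
      ring
    have h1 : eLpNorm h (ENNReal.ofReal r') volume ≤ eLpNorm h₀ (ENNReal.ofReal r') volume +
        ENNReal.ofReal t := by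
      have : (h : V → ℂ) = h₀ - (h₀ - g) := by rw [hh]; simp
      rw [this]
      refine (eLpNorm_sub_le h₀m.1 (h₀m.sub hgm).1 (by simpa using hr.symm.lt.le)).trans ?_
      gcongr
    calc _ ≤ ‖∫ x, G x * h x‖ₑ + ‖∫ x, G x * (h₀ - g) x‖ₑ := by rw [e]; exact enorm_add_le _ _
      _ ≤ C * (eLpNorm h₀ (ENNReal.ofReal r') volume + ENNReal.ofReal t) +
          eLpNorm G (ENNReal.ofReal r) volume * ENNReal.ofReal t := by
        refine add_le_add ((hb h).trans (by gcongr))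
          ((enorm_integral_mul_le hr hG.1 (h₀m.sub hgm).1).trans (by gcongr))
      _ = _ := by ring
  have hlim : Tendsto (fun t : ℝ => C * eLpNorm h₀ (ENNReal.ofReal r') volume +
      (C + eLpNorm G (ENNReal.ofReal r) volume) * ENNReal.ofReal t) (𝓝[>] 0)
      (𝓝 (C * eLpNorm h₀ (ENNReal.ofReal r') volume +
      (C + eLpNorm G (ENNReal.ofReal r) volume) * ENNReal.ofReal 0)) := by
    refine tendsto_const_nhds.add (ENNReal.Tendsto.const_mul ?_
      (.inr (ENNReal.add_ne_top.2 ⟨hC, hG.2.ne⟩)))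
    exact (ENNReal.continuous_ofReal.tendsto 0).mono_left nhdsWithin_le_nhds
  have := ge_of_tendsto hlim (eventually_mem_nhdsWithin.mono fun t ht => key t ht)
  simpa using this

lemma eLpNorm_le_of_schwartz_of_memLp {r r' : ℝ} (hr : r.HolderConjugate r') {G : V → ℂ}
    (hG : MemLp G (ENNReal.ofReal r) volume) {C : ℝ≥0∞} (hC : C ≠ ∞)
    (hb : ∀ h : 𝓢(V, ℂ), ‖∫ x, G x * h x‖ₑ ≤ C * eLpNorm h (ENNReal.ofReal r') volume) :
    eLpNorm G (ENNReal.ofReal r) volume ≤ C := by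
  set X : ℝ≥0∞ := ∫⁻ x, ‖G x‖ₑ ^ r with hX
  have hr0 := hr.pos
  have hr0' := hr.symm.pos
  have hGX : eLpNorm G (ENNReal.ofReal r) volume = X ^ (1 / r) := eLpNorm_ofReal_eq hr0
  have hXt : X ≠ ∞ := by
    intro h
    have := hG.2.ne
    rw [hGX, h, ENNReal.top_rpow_of_pos (by positivity)] at this
    exact this rfl
  let h₀ : V → ℂ := fun x => ((‖G x‖ ^ (r - 2) : ℝ) : ℂ) * starRingEnd ℂ (G x)
  have hn : ∀ x, ‖h₀ x‖ₑ ^ r' = ‖G x‖ₑ ^ r := by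
    intro x
    have h1 : ‖h₀ x‖ = ‖G x‖ ^ (r - 1) := by
      simp only [h₀, norm_mul, RCLike.norm_conj, Complex.norm_real]
      rw [Real.norm_of_nonneg (by positivity)]
      rcases eq_or_ne (G x) 0 with h | h
      · rw [h, norm_zero, mul_zero, Real.zero_rpow (sub_ne_zero.2 hr.lt.ne')]
      · rw [← Real.rpow_add_one (norm_ne_zero_iff.2 h)]
        congr 1; ring
    rw [← ofReal_norm, h1, ← ofReal_norm, ENNReal.ofReal_rpow_of_nonneg (by positivity) hr0'.le,
      ENNReal.ofReal_rpow_of_nonneg (by positivity) hr0.le, ← Real.rpow_mul (norm_nonneg _),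
      hr.sub_one_mul_conj]
  have hm : AEStronglyMeasurable h₀ volume := by
    refine AEStronglyMeasurable.mul ?_ ?_
    · exact ((Complex.measurable_ofReal.comp_aemeasurable
        (hG.1.norm.aemeasurable.pow_const _))).aestronglyMeasurable
    · exact Complex.continuous_conj.comp_aestronglyMeasurable hG.1
  have hhX : eLpNorm h₀ (ENNReal.ofReal r') volume = X ^ (1 / r') := by
    rw [eLpNorm_ofReal_eq hr0']
    simp_rw [hn]
    rfl
  have h₀m : MemLp h₀ (ENNReal.ofReal r') volume := by
    refine ⟨hm, ?_⟩
    rw [hhX]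
    exact ENNReal.rpow_lt_top_of_nonneg (by positivity) hXt
  have hint : ‖∫ x, G x * h₀ x‖ₑ = X := by
    have e : ∀ x, G x * h₀ x = ((‖G x‖ ^ r : ℝ) : ℂ) := by
      intro x
      simp only [h₀]
      rw [mul_left_comm, Complex.mul_conj', ← Complex.ofReal_pow, ← Complex.ofReal_mul]
      congr 1
      rcases eq_or_ne (G x) 0 with h | h
      · rw [h, norm_zero, Real.zero_rpow hr0.ne']; simp
      · rw [← Real.rpow_natCast, ← Real.rpow_add (norm_pos_iff.2 h)]
        congr 1; push_cast; ring
    have hi : Integrable fun x => ‖G x‖ ^ r := by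
      have := (integrable_mul_of_memLp hr hG h₀m).norm
      refine this.congr (.of_forall fun x => ?_)
      simp only [e, Complex.norm_real]
      exact Real.norm_of_nonneg (by positivity)
    simp_rw [e]
    rw [integral_complex_ofReal, ← ofReal_norm, Complex.norm_real,
      Real.norm_of_nonneg (integral_nonneg fun x => by positivity),
      ofReal_integral_eq_lintegral_ofReal hi (.of_forall fun x => by positivity), hX]
    refine lintegral_congr fun x => ?_
    rw [← ofReal_norm, ENNReal.ofReal_rpow_of_nonneg (by positivity) hr0.le]
  have main := enorm_integral_mul_le_of_schwartz hr hG hC hb h₀m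
  rw [hint, hhX] at main
  rw [hGX]
  rcases eq_or_ne X 0 with h0 | h0
  · rw [h0, ENNReal.zero_rpow_of_pos (by positivity)]
    exact zero_le
  have hXX : X ^ (1 / r) * X ^ (1 / r') = X := by
    rw [← ENNReal.rpow_add _ _ h0 hXt, one_div, one_div, hr.inv_add_inv_eq_one, ENNReal.rpow_one]
  refine (ENNReal.mul_le_mul_iff_left (c := X ^ (1 / r')) ?_ ?_).1 (by rwa [hXX])
  · exact fun h => h0 ((ENNReal.rpow_eq_zero_iff_of_pos (by positivity)).1 h)
  · exact ENNReal.rpow_ne_top_of_nonneg (by positivity) hXt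

/-- A continuous function is controlled in `L^r` by its pairings with Schwartz functions. -/
lemma eLpNorm_le_of_schwartz {r r' : ℝ} (hr : r.HolderConjugate r') {F : V → ℂ}
    (hF : Continuous F) {C : ℝ≥0∞} (hC : C ≠ ∞)
    (hb : ∀ h : 𝓢(V, ℂ), ‖∫ x, F x * h x‖ₑ ≤ C * eLpNorm h (ENNReal.ofReal r') volume) :
    eLpNorm F (ENNReal.ofReal r) volume ≤ C := by
  let φ : ℕ → V → ℂ := fun N x => (lowBump V ((2 : ℝ) ^ (-(N : ℤ)) • x) : ℂ)
  have hφs : ∀ N, ContDiff ℝ (⊤ : ℕ∞) (φ N) := fun N =>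
    Complex.ofRealCLM.contDiff.comp ((lowBump V).contDiff.comp (contDiff_id.const_smul _))
  have hφc : ∀ N, HasCompactSupport (φ N) := fun N => by
    refine HasCompactSupport.of_support_subset_isCompact
      (isCompact_closedBall (0 : V) (2 * 2 ^ (N : ℤ))) fun x hx => ?_
    rw [mem_closedBall_zero_iff]
    by_contra h
    rw [not_le] at h
    refine hx ?_
    simp only [φ]
    rw [lowBump_eq_zero, Complex.ofReal_zero]
    rw [norm_zpow_smul, zpow_neg, le_inv_mul_iff₀ (by positivity)]
    linarith
  have hφ1 : ∀ N x, ‖φ N x‖ ≤ 1 := fun N x => by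
    simp only [φ, Complex.norm_real]
    exact abs_lowBump_le _
  have hN : ∀ N, eLpNorm (fun x => F x * φ N x) (ENNReal.ofReal r) volume ≤ C := fun N => by
    refine eLpNorm_le_of_schwartz_of_memLp hr ((hF.mul (hφs N).continuous).memLp_of_hasCompactSupport
      (hφc N).mul_left) hC fun h => ?_
    let k : 𝓢(V, ℂ) := HasCompactSupport.toSchwartzMap (f := fun x => φ N x * h x)
      (hφc N).mul_right ((hφs N).mul (h.smooth _))
    have hk : ∀ x, k x = φ N x * h x := fun x => rfl
    have h1 := hb k
    simp_rw [hk, ← mul_assoc] at h1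
    refine h1.trans ?_
    gcongr
    refine eLpNorm_mono fun x => ?_
    rw [hk, norm_mul]
    exact mul_le_of_le_one_left (norm_nonneg _) (hφ1 N x)
  refine (Lp.eLpNorm_lim_le_liminf_eLpNorm (f := fun N x => F x * φ N x)
    (fun N => (hF.mul (hφs N).continuous).aestronglyMeasurable) F (.of_forall fun x => ?_)).trans ?_
  · refine tendsto_const_nhds.congr' ?_
    have h2 : Tendsto (fun N : ℕ => (2 : ℝ) ^ N) atTop atTop :=
      tendsto_pow_atTop_atTop_of_one_lt one_lt_two
    filter_upwards [h2.eventually_ge_atTop ‖x‖] with N hN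
    simp only [φ]
    rw [lowBump_eq_one, Complex.ofReal_one, mul_one]
    rwa [norm_zpow_smul, zpow_neg, zpow_natCast, inv_mul_le_iff₀ (by positivity), mul_one]
  · exact liminf_le_of_frequently_le' (.of_forall hN)

end Duality

section Operator

variable {V : Type*} [NormedAddCommGroup V] [InnerProductSpace ℝ V] [FiniteDimensional ℝ V]
  [MeasurableSpace V] [BorelSpace V]

/-- The frequency-side density of the pseudo-product. -/
noncomputable def density (m : V → V → ℂ) (f g : 𝓢(V, ℂ)) (w : V × V) : ℂ :=
  m w.1 w.2 * ((𝓕 f : 𝓢(V, ℂ)) w.2 * (𝓕 g : 𝓢(V, ℂ)) (w.1 - w.2))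

lemma measurePreserving_sub_right :
    MeasurePreserving (fun w : V × V => (w.2, w.1 - w.2)) volume volume := by
  have h1 : MeasurePreserving (fun z : V × V => (z.1, -z.1 + z.2)) volume volume :=
    measurePreserving_prod_neg_add volume volume
  have h2 : MeasurePreserving (Prod.swap : V × V → V × V) volume volume :=
    Measure.measurePreserving_swap
  convert h1.comp h2 using 2 with w
  simp [sub_eq_neg_add]

variable {p q r' : ℝ} {m : V → V → ℂ}

lemma IsMult.integrable_density (h : IsMult p q r' fun z : V × V => m (z.1 + z.2) z.1)
    (f g : 𝓢(V, ℂ)) : Integrable (density m f g) := by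
  have h1 := h.integrable_mul ((𝓕 f : 𝓢(V, ℂ)).integrable.mul_prod (𝓕 g : 𝓢(V, ℂ)).integrable)
  have h2 := (measurePreserving_sub_right.integrable_comp h1.aestronglyMeasurable).2 h1
  refine h2.congr (.of_forall fun w => ?_)
  simp [density]

lemma IsMult.integral_density_mul (h : IsMult p q r' fun z : V × V => m (z.1 + z.2) z.1)
    (f g k : 𝓢(V, ℂ)) :
    ∫ x, (∫ ξ, (∫ η, density m f g (ξ, η)) * Real.fourierChar ⟪ξ, x⟫_ℝ) * k x =
      ∫ z : V × V, m (z.1 + z.2) z.1 * ((𝓕 f : 𝓢(V, ℂ)) z.1 * (𝓕 g : 𝓢(V, ℂ)) z.2 *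
        (𝓕 k : 𝓢(V, ℂ)) (-(z.1 + z.2))) := by
  have hd := h.integrable_density f g
  have hN : Integrable fun ξ => ∫ η, density m f g (ξ, η) := hd.integral_prod_left
  have e1 : ∫ x, (∫ ξ, (∫ η, density m f g (ξ, η)) * Real.fourierChar ⟪ξ, x⟫_ℝ) * k x =
      ∫ ξ, (∫ η, density m f g (ξ, η)) * (𝓕 k : 𝓢(V, ℂ)) (-ξ) := by
    simp_rw [fourier_neg_eq_integral, mul_comm _ (k _)]
    exact integral_mul_integral_swap (μ := (volume : Measure V)) (ν := (volume : Measure V))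
      (e := fun z : V × V => (Real.fourierChar ⟪z.2, z.1⟫_ℝ : ℂ)) (K := 1) k.integrable hN
      (continuous_fourierChar_coe.comp (continuous_snd.inner continuous_fst)).aestronglyMeasurable
      (fun z => (Circle.norm_coe _).le)
  have hdk : Integrable fun w : V × V => density m f g w * (𝓕 k : 𝓢(V, ℂ)) (-w.1) :=
    hd.mul_bdd (c := SchwartzMap.seminorm ℝ 0 0 (𝓕 k : 𝓢(V, ℂ)))
      ((SchwartzMap.continuous _).comp continuous_fst.neg).aestronglyMeasurable
      (.of_forall fun w => SchwartzMap.norm_le_seminorm ℝ _ _)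
  have e2 : ∫ ξ, (∫ η, density m f g (ξ, η)) * (𝓕 k : 𝓢(V, ℂ)) (-ξ) =
      ∫ w : V × V, density m f g w * (𝓕 k : 𝓢(V, ℂ)) (-w.1) := by
    rw [Measure.volume_eq_prod, integral_prod _ hdk]
    simp_rw [integral_mul_const]
  rw [e1, e2, ← integral_comp_of_measurePreserving measurePreserving_sub_right
    (h.integrable_mul (integrable_trilinear (𝓕 f : 𝓢(V, ℂ)) (𝓕 g) (𝓕 k))).aestronglyMeasurable]
  congr 1 with w
  simp [density, mul_assoc]

lemma IsMult.continuous_integral_density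
    (h : IsMult p q r' fun z : V × V => m (z.1 + z.2) z.1) (f g : 𝓢(V, ℂ)) :
    Continuous fun x => ∫ ξ, (∫ η, density m f g (ξ, η)) * Real.fourierChar ⟪ξ, x⟫_ℝ := by
  have hN : Integrable fun ξ => ∫ η, density m f g (ξ, η) :=
    (h.integrable_density f g).integral_prod_left
  refine continuous_of_dominated (fun x => ?_) (fun x => .of_forall fun ξ => ?_) hN.norm
    (.of_forall fun ξ => ?_)
  · exact hN.aestronglyMeasurable.mul (continuous_fourierChar_coe.comp
      (continuous_id.inner continuous_const)).aestronglyMeasurable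
  · rw [norm_mul, Circle.norm_coe, mul_one]
  · exact continuous_const.mul (continuous_fourierChar_coe.comp
      (continuous_const.inner continuous_id))

lemma IsMult.exists_eLpNorm_le {r : ℝ} (hr : r.HolderConjugate r')
    (h : IsMult p q r' fun z : V × V => m (z.1 + z.2) z.1) :
    ∃ C : ℝ≥0∞, C ≠ ∞ ∧ ∀ f g : 𝓢(V, ℂ),
      eLpNorm (fun x => ∫ ξ, (∫ η, density m f g (ξ, η)) * Real.fourierChar ⟪ξ, x⟫_ℝ)
        (ENNReal.ofReal r) volume ≤
      C * eLpNorm f (ENNReal.ofReal p) volume * eLpNorm g (ENNReal.ofReal q) volume := by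
  obtain ⟨C, hC, hb⟩ := h.bound
  refine ⟨C, hC, fun f g => ?_⟩
  refine eLpNorm_le_of_schwartz hr (h.continuous_integral_density f g)
    (ENNReal.mul_ne_top (ENNReal.mul_ne_top hC (schwartz_eLpNorm_ne_top f _))
      (schwartz_eLpNorm_ne_top g _)) fun k => ?_
  rw [h.integral_density_mul f g k]
  refine (hb f g k).trans (le_of_eq ?_)
  ring

end Operator

lemma pseudoProduct_eq (m : EuclideanSpace ℝ (Fin 3) → EuclideanSpace ℝ (Fin 3) → ℂ)
    (f g : 𝓢(EuclideanSpace ℝ (Fin 3), ℂ)) :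
    pseudoProduct m f g = fun x =>
      ∫ ξ, (∫ η, density m f g (ξ, η)) * Real.fourierChar ⟪ξ, x⟫_ℝ := by
  funext x
  rw [pseudoProduct]
  congr 1 with ξ
  rw [mul_comm, Real.fourierChar_apply, real_inner_comm x ξ]
  congr 1
  · congr 1 with η
    rw [density, SchwartzMap.fourier_coe, SchwartzMap.fourier_coe, mul_assoc]
  · congr 1
    push_cast
    ring

end PseudoProduct

/-- Boundedness L^p × L^q → L^r (Hölder exponents) of pseudo-product operators with
symbols in the class 𝓑₀: homogeneous of degree 0, smooth away from
{ξ = 0} ∪ {η = 0} ∪ {ξ = η}, and, near the vanishing of any one of the three frequencies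
(ξ, η, ξ−η) while another one stays of size ≈ 1, of the form 𝓐(‖ξ₁‖, ξ₁/‖ξ₁‖, ξ₂)
for some smooth 𝓐. -/
theorem pseudoProduct_bound_B0
    (m : EuclideanSpace ℝ (Fin 3) → EuclideanSpace ℝ (Fin 3) → ℂ)
    (hhom : ∀ l : ℝ, 0 < l → ∀ ξ η : EuclideanSpace ℝ (Fin 3), m (l • ξ) (l • η) = m ξ η)
    (hsmooth : ContDiffOn ℝ (⊤ : ℕ∞)
      (fun p : EuclideanSpace ℝ (Fin 3) × EuclideanSpace ℝ (Fin 3) => m p.1 p.2)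
      {p : EuclideanSpace ℝ (Fin 3) × EuclideanSpace ℝ (Fin 3) |
        p.1 ≠ 0 ∧ p.2 ≠ 0 ∧ p.1 ≠ p.2})
    (hlabel : ∀ i j : Fin 3, i ≠ j →
      ∃ δ : ℝ, 0 < δ ∧
        ∃ A : ℝ × EuclideanSpace ℝ (Fin 3) × EuclideanSpace ℝ (Fin 3) → ℂ,
          ContDiff ℝ (⊤ : ℕ∞) A ∧
          ∀ ξ η : EuclideanSpace ℝ (Fin 3),
            0 < ‖![ξ, η, ξ - η] i‖ → ‖![ξ, η, ξ - η] i‖ ≤ δ →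
            1 / 2 ≤ ‖![ξ, η, ξ - η] j‖ → ‖![ξ, η, ξ - η] j‖ ≤ 2 →
            m ξ η = A (‖![ξ, η, ξ - η] i‖,
              ‖![ξ, η, ξ - η] i‖⁻¹ • ![ξ, η, ξ - η] i, ![ξ, η, ξ - η] j))
    (p q r : ℝ) (hp : 1 < p) (hq : 1 < q) (hr : 1 < r) (hpqr : 1 / r = 1 / p + 1 / q) :
    ∃ C : ℝ, 0 < C ∧ ∀ f g : SchwartzMap (EuclideanSpace ℝ (Fin 3)) ℂ,
      eLpNorm (pseudoProduct m ⇑f ⇑g) (ENNReal.ofReal r) volume ≤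
        ENNReal.ofReal C * eLpNorm ⇑f (ENNReal.ofReal p) volume *
          eLpNorm ⇑g (ENNReal.ofReal q) volume := by
  have hr' : r.HolderConjugate (Real.conjExponent r) := .conjExponent hr
  have hsum : 1 / p + 1 / q + 1 / Real.conjExponent r = 1 := by
    rw [← hpqr, one_div, one_div, hr'.inv_add_inv_eq_one]
  obtain ⟨C, hC, hb⟩ := (PseudoProduct.isMult_of_labels m hhom hsmooth hlabel hp hq hr'.symm.lt
    hsum).exists_eLpNorm_le hr'
  refine ⟨C.toReal + 1, by positivity, fun f g => ?_⟩
  rw [PseudoProduct.pseudoProduct_eq]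
  refine (hb f g).trans ?_
  gcongr
  rw [ENNReal.le_ofReal_iff_toReal_le hC (by positivity)]
  linarith
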